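/- Let ℚ̄ be an algebraic closure of ℚ and n ≥ 1. Let γ₁, …, γ_r ∈ GL_n(ℚ̄) be matrices, all of which, with at most one exception, are semi-simple. Let γ ∈ GL_n(ℚ̄) be a semi-simple matrix having an eigenvalue λ ∈ ℚ̄ˣ that is not a root of unity and such that the cyclic subgroup ⟨λ⟩ of ℚ̄ˣ intersects the product of subgroups Λ(γ₁)⋯Λ(γ_r) trivially. Then the intersection ⟨γ⟩ ∩ (⟨γ₁⟩⋯⟨γ_r⟩) is finite; in particular, the set { m ∈ ℤ : γ^m = γ₁^{k₁}⋯γ_r^{k_r} for some k₁,…,k_r ∈ ℤ } is finite and ⟨γ⟩ is not contained in ⟨γ₁⟩⋯⟨γ_r⟩. -/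

import Mathlib

open Matrix

/-- An element of `GL n ℚ̄` is semi-simple if the corresponding linear endomorphism
of `ℚ̄^n` is a semisimple endomorphism. -/
def IsSemisimpleElt {n : ℕ} (g : GL (Fin n) (AlgebraicClosure ℚ)) : Prop :=
  Module.End.IsSemisimple ((g : Matrix (Fin n) (Fin n) (AlgebraicClosure ℚ)).mulVecLin)

/-- `Λ(g)`: the subgroup of `ℚ̄ˣ` generated by the eigenvalues of `g`
(the roots of its characteristic polynomial). -/
noncomputable def eigGroup {n : ℕ} (g : GL (Fin n) (AlgebraicClosure ℚ)) :
    Subgroup (AlgebraicClosure ℚ)ˣ :=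
  Subgroup.closure {u : (AlgebraicClosure ℚ)ˣ |
    ((g : Matrix (Fin n) (Fin n) (AlgebraicClosure ℚ)).charpoly).IsRoot
      (u : AlgebraicClosure ℚ)}

set_option linter.all false
namespace RM
open NumberField Height
section places
variable (K : Type*) [Field K] [NumberField K]
abbrev Pl := InfinitePlace K ⊕ FinitePlace K
variable {K}
def pv : Pl K → AbsoluteValue K ℝ
  | Sum.inl v => v.1
  | Sum.inr v => v.1
noncomputable def wt : Pl K → ℝ
  | Sum.inl v => v.mult
  | Sum.inr _ => 1
lemma wt_ge (v : Pl K) : 1 ≤ wt v := by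
  rcases v with v | v
  · simp only [wt]; exact_mod_cast v.mult_pos
  · simp [wt]
lemma wt_pos (v : Pl K) : 0 < wt v := lt_of_lt_of_le one_pos (wt_ge v)
lemma pv_inl (v : InfinitePlace K) (x : K) : pv (Sum.inl v) x = v x := rfl
lemma pv_inr (v : FinitePlace K) (x : K) : pv (Sum.inr v) x = v x := rfl
lemma pv_finite {x : K} (hx : x ≠ 0) : {v : Pl K | pv v x ≠ 1}.Finite := by
  have h : (Function.mulSupport fun w : FinitePlace K => w x).Finite :=
    FinitePlace.hasFiniteMulSupport hx
  have h1 : (Set.range (Sum.inl : InfinitePlace K → Pl K)).Finite := Set.finite_range _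
  refine (h1.union (h.image Sum.inr)).subset ?_
  rintro (v | v) hv
  · exact Or.inl ⟨v, rfl⟩
  · exact Or.inr ⟨v, hv, rfl⟩
lemma finsum_pl (f : Pl K → ℝ) (hf : (Function.support f).Finite) :
    ∑ᶠ v, f v = ∑ v : InfinitePlace K, f (Sum.inl v) + ∑ᶠ v : FinitePlace K, f (Sum.inr v) := by
  have h2 : (Function.support fun v : FinitePlace K => f (Sum.inr v)).Finite :=
    hf.preimage (f := Sum.inr) (Sum.inr_injective.injOn)
  have := finsum_mem_union (f := f) (s := Set.range Sum.inl) (t := Set.range Sum.inr)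
    Set.isCompl_range_inl_range_inr.disjoint (Set.finite_range _)
  rw [← finsum_mem_univ, ← Set.range_inl_union_range_inr,
    finsum_mem_union' Set.isCompl_range_inl_range_inr.disjoint
      ((Set.finite_range _).inter_of_left _) (hf.inter_of_right _),
    finsum_mem_range Sum.inl_injective, finsum_mem_range Sum.inr_injective,
    finsum_eq_sum_of_fintype]
lemma supp_log {x : K} (hx : x ≠ 0) :
    (Function.support fun v : Pl K => wt v * Real.log (pv v x)).Finite := by
  refine (pv_finite hx).subset fun v hv h => hv ?_
  simp [h]
lemma supp_posLog {x : K} (hx : x ≠ 0) :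
    (Function.support fun v : Pl K => wt v * Real.posLog (pv v x)).Finite := by
  refine (pv_finite hx).subset fun v hv h => hv ?_
  simp [h]
lemma prodf {x : K} (hx : x ≠ 0) : ∑ᶠ v : Pl K, wt v * Real.log (pv v x) = 0 := by
  have h := prod_abs_eq_one hx
  have hfin : (Function.mulSupport fun w : FinitePlace K => w x).Finite :=
    FinitePlace.hasFiniteMulSupport hx
  rw [finsum_pl _ (supp_log hx)]
  apply_fun Real.log at h
  have hpos : ∀ w : FinitePlace K, w x ≠ 0 := fun w => by
    simpa using hx
  have hpos' : ∀ w : InfinitePlace K, w x ≠ 0 := fun w => by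
    simpa using hx
  rw [finprod_eq_prod_of_mulSupport_subset (s := hfin.toFinset) _ (by simp), Real.log_mul,
    Real.log_prod (fun w _ => pow_ne_zero _ (hpos' w)), Real.log_prod (fun w _ => hpos w),
    Real.log_one] at h
  · rw [← h]
    congr 1
    · refine Finset.sum_congr rfl fun w _ => ?_
      rw [Real.log_pow]; rfl
    · rw [finsum_eq_sum_of_support_subset (s := hfin.toFinset)]
      · refine Finset.sum_congr rfl fun w _ => ?_
        simp [wt, pv_inr]
      · intro w hw
        simp only [Set.Finite.coe_toFinset, Function.mem_mulSupport]
        intro h0; apply hw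
        simp [pv_inr, h0]
  · exact Finset.prod_ne_zero_iff.2 fun w _ => pow_ne_zero _ (hpos' w)
  · exact Finset.prod_ne_zero_iff.2 fun w _ => hpos w
lemma logHeight_eq {x : K} (hx : x ≠ 0) :
    logHeight₁ x = ∑ᶠ v : Pl K, wt v * Real.posLog (pv v x) := by
  rw [finsum_pl _ (supp_posLog hx), NumberField.logHeight₁_eq]
  congr 1
  refine finsum_congr fun w => ?_
  simp [wt, pv_inr]
lemma fsum_le {f g : Pl K → ℝ} (hf : (Function.support f).Finite)
    (hg : (Function.support g).Finite) (h : ∀ v, f v ≤ g v) : ∑ᶠ v, f v ≤ ∑ᶠ v, g v :=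
  by
  classical
  rw [finsum_eq_sum_of_support_subset (s := hf.toFinset ∪ hg.toFinset) f (by simp),
    finsum_eq_sum_of_support_subset (s := hf.toFinset ∪ hg.toFinset) g (by simp)]
  exact Finset.sum_le_sum fun v _ => h v
lemma prod_ineq {c : K} (hc : c ≠ 0) (f : Pl K → ℝ) (hf : (Function.support f).Finite)
    (h : ∀ v, Real.log (pv v c) ≤ f v) : 0 ≤ ∑ᶠ v, wt v * f v := by
  rw [← prodf hc]
  refine fsum_le (supp_log hc) (hf.subset fun v hv h => hv (by simp [h])) fun v => ?_
  exact mul_le_mul_of_nonneg_left (h v) (wt_pos v).le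
lemma pv_na (v : FinitePlace K) (x y : K) :
    pv (Sum.inr v) (x + y) ≤ max (pv (Sum.inr v) x) (pv (Sum.inr v) y) := v.add_le x y
lemma isNA (v : FinitePlace K) : IsNonarchimedean (pv (Sum.inr v)) := fun x y => pv_na v x y
lemma pv_int (v : FinitePlace K) (a : ℤ) : pv (Sum.inr v) (a : K) ≤ 1 :=
  (isNA v).apply_intCast_le_one
lemma pv_int_inf (v : InfinitePlace K) (a : ℤ) : pv (Sum.inl v) (a : K) = |(a : ℝ)| := by
  rw [pv_inl, ← v.norm_embedding_eq]
  simp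
lemma sum_wt_inf : ∑ v : InfinitePlace K, wt (Sum.inl v : Pl K) = Module.finrank ℚ K := by
  rw [← NumberField.InfinitePlace.sum_mult_eq]; simp [wt]
open Polynomial in
lemma one_var (V : ℤ[X]) (hV : V ≠ 0) (B r : ℝ) (hr : (V.natDegree : ℝ) ≤ r)
    (hB : ∀ j, |(V.coeff j : ℝ)| ≤ Real.exp B) (β : K) (i : ℕ)
    (hdvd : (X - C β) ^ i ∣ V.map (Int.castRingHom K)) :
    i * logHeight₁ β ≤ Module.finrank ℚ K * (B + r) := by
  rcases eq_or_ne β 0 with rfl | hβ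
  · have hB0 : 0 ≤ B := by
      by_contra hlt
      push Not at hlt
      have h1 := hB V.natDegree
      have h2 : (1 : ℝ) ≤ |((V.coeff V.natDegree : ℤ) : ℝ)| := by
        exact_mod_cast Int.one_le_abs (by simpa using hV)
      have := Real.exp_lt_one_iff.2 hlt
      linarith
    have hr0 : (0 : ℝ) ≤ r := le_trans (by positivity) hr
    simp only [logHeight₁_zero, mul_zero]
    positivity
  obtain ⟨G, hG⟩ := hdvd
  set a : ℤ := V.leadingCoeff
  have ha : (a : K) ≠ 0 := by simpa [a] using hV
  have hlead : G.leadingCoeff = a := by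
    have := congrArg leadingCoeff hG
    rw [leadingCoeff_mul, ((monic_X_sub_C β).pow i).leadingCoeff, one_mul,
      leadingCoeff_map_of_injective (RingHom.injective_int _)] at this
    simp [← this, a]
  have hsupp : (Function.support fun v : Pl K => i * Real.posLog (pv v β)).Finite := by
    refine (pv_finite hβ).subset fun v hv h => hv ?_
    simp [h]
  have hsuppI : (Function.support fun v : Pl K => v.elim (fun _ => B + r) (fun _ => 0)).Finite := by
    refine (Set.finite_range (Sum.inl : InfinitePlace K → Pl K)).subset ?_
    rintro (v | v) hv
    · exact ⟨v, rfl⟩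
    · simp at hv
  have key := prod_ineq ha (fun v : Pl K => v.elim (fun _ => B + r) (fun _ => 0) -
      i * Real.posLog (pv v β)) ((hsuppI.union hsupp).subset (Function.support_sub _ _)) ?_
  · have e : (fun v : Pl K => wt v * (v.elim (fun _ => B + r) (fun _ => 0) -
      i * Real.posLog (pv v β))) = fun v => wt v * v.elim (fun _ => B + r) (fun _ => 0) -
        i * (wt v * Real.posLog (pv v β)) := by ext v; ring
    rw [finsum_congr (congrFun e), finsum_sub_distrib
      (hsuppI.subset fun v hv h => hv (by simp [h]))
      ((supp_posLog hβ).subset fun v hv h => hv (by simp [h])), ← mul_finsum,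
      ← logHeight_eq hβ, finsum_pl _ (hsuppI.subset fun v hv h => hv (by simp [h]))] at key
    simp only [Sum.elim_inl, Sum.elim_inr, mul_zero, finsum_zero, add_zero, ← Finset.sum_mul,
      sum_wt_inf] at key
    linarith
  · have hmax : ∀ v : Pl K, (i : ℝ) * Real.posLog (pv v β) =
        Real.log (max 1 (pv v β) ^ i) := fun v => by
      rw [Real.log_pow, Real.posLog_eq_log_max_one (by positivity)]
    rintro (v | v)
    · simp only [Sum.elim_inl, hmax]
      have hpos : 0 < pv (Sum.inl v) (a : K) := (pv _).pos ha
      have hm : 0 < max 1 (pv (Sum.inl v) β) := by positivity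
      rw [le_sub_iff_add_le, ← Real.log_mul hpos.ne' (by positivity),
        Real.log_le_iff_le_exp (by positivity)]
      have hM := congrArg (fun p : K[X] => (p.map v.embedding).mahlerMeasure) hG
      simp only [Polynomial.map_mul, Polynomial.map_pow, mahlerMeasure_mul,
        Polynomial.map_sub, map_X, map_C] at hM
      have hp : ∀ p : ℂ[X], ∀ j, (p ^ j).mahlerMeasure = p.mahlerMeasure ^ j := by
        intro p j
        induction j with
        | zero => simp
        | succ j ih => rw [pow_succ, mahlerMeasure_mul, ih, pow_succ]
      rw [hp, mahlerMeasure_X_sub_C, v.norm_embedding_eq] at hM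
      have h1 : pv (Sum.inl v) (a : K) ≤ (G.map v.embedding).mahlerMeasure := by
        refine le_trans (le_of_eq ?_) (leadingCoeff_le_mahlerMeasure _)
        rw [leadingCoeff_map, hlead, v.norm_embedding_eq, pv_inl]
      have h2 := mahlerMeasure_le_sqrt_natDegree_add_one_mul_supNorm
        (((V.map (Int.castRingHom K)).map v.embedding))
      have h3 : (((V.map (Int.castRingHom K)).map v.embedding)).supNorm ≤ Real.exp B := by
        obtain ⟨j, hj⟩ := exists_eq_supNorm ((V.map (Int.castRingHom K)).map v.embedding)
        rw [hj]
        simpa [coeff_map] using hB j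
      have h4 : Real.sqrt ((((V.map (Int.castRingHom K)).map v.embedding)).natDegree + 1) ≤
          Real.exp r := by
        have : ((((V.map (Int.castRingHom K)).map v.embedding)).natDegree : ℝ) ≤ r := by
          refine le_trans ?_ hr
          exact_mod_cast (natDegree_map_le.trans natDegree_map_le)
        rw [Real.sqrt_le_left (Real.exp_pos _).le]
        have h5 := Real.add_one_le_exp r
        have : 1 ≤ Real.exp r := Real.one_le_exp (le_trans (by positivity) hr)
        nlinarith
      calc pv (Sum.inl v) (a : K) * max 1 (pv (Sum.inl v) β) ^ i
          ≤ (G.map v.embedding).mahlerMeasure * max 1 (pv (Sum.inl v) β) ^ i := by gcongr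
        _ = _ := by rw [mul_comm]; exact hM.symm
        _ ≤ _ := h2
        _ ≤ Real.exp r * Real.exp B := by
          have : 0 ≤ (((V.map (Int.castRingHom K)).map v.embedding)).supNorm :=
            Polynomial.supNorm_nonneg _
          gcongr
        _ = _ := by rw [← Real.exp_add, add_comm]
    · simp only [Sum.elim_inr, hmax]
      have hpos : 0 < pv (Sum.inr v) (a : K) := (pv _).pos ha
      have hm : 0 < max 1 (pv (Sum.inr v) β) := by positivity
      rw [le_sub_iff_add_le, ← Real.log_mul hpos.ne' (by positivity)]
      apply Real.log_nonpos (by positivity)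
      have hM := congrArg (fun p : K[X] => p.gaussNorm (pv (Sum.inr v)) 1) hG
      simp only [gaussNorm_mul (isNA v) one_pos] at hM
      have hp : ∀ p : K[X], ∀ j, (p ^ j).gaussNorm (pv (Sum.inr v)) 1 =
          p.gaussNorm (pv (Sum.inr v)) 1 ^ j := by
        intro p j
        induction j with
        | zero => simpa using gaussNorm_C (pv (Sum.inr v)) 1 (1 : K)
        | succ j ih => rw [pow_succ, gaussNorm_mul (isNA v) one_pos, ih, pow_succ]
      rw [hp] at hM
      have h0 : max 1 (pv (Sum.inr v) β) ≤ (X - C β).gaussNorm (pv (Sum.inr v)) 1 := by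
        apply max_le
        · have e : (X - C β : K[X]).coeff 1 = 1 := by simp [coeff_X, coeff_C]
          refine le_trans (le_of_eq ?_) (le_gaussNorm (pv (Sum.inr v)) (X - C β) zero_le_one 1)
          erw [e]; simp
        · have e : (X - C β : K[X]).coeff 0 = -β := by simp [coeff_X, coeff_C]
          refine le_trans (le_of_eq ?_) (le_gaussNorm (pv (Sum.inr v)) (X - C β) zero_le_one 0)
          erw [e]; simp
      have h1 : pv (Sum.inr v) (a : K) ≤ G.gaussNorm (pv (Sum.inr v)) 1 := by
        rw [← hlead]
        simpa using le_gaussNorm (pv (Sum.inr v)) G zero_le_one G.natDegree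
      have h2 : (V.map (Int.castRingHom K)).gaussNorm (pv (Sum.inr v)) 1 ≤ 1 := by
        obtain ⟨j, hj⟩ := exists_eq_gaussNorm (pv (Sum.inr v)) 1 (V.map (Int.castRingHom K))
        rw [hj]; simpa using pv_int v (V.coeff j)
      calc _ ≤ G.gaussNorm (pv (Sum.inr v)) 1 *
            (X - C β).gaussNorm (pv (Sum.inr v)) 1 ^ i := by
            gcongr
            exact hpos.le.trans h1
        _ ≤ 1 := by rw [mul_comm, ← hM]; exact h2
end places
open MvPolynomial
section hasse
variable {σ : Type*} [Fintype σ] [DecidableEq σ] {R S : Type*} [CommRing R] [CommRing S]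
noncomputable def Tay (σ R : Type*) [CommRing R] : MvPolynomial σ R →+* MvPolynomial σ (MvPolynomial σ R) :=
  eval₂Hom (C.comp C) (fun i => C (X i) + X i)
noncomputable def hs (s : σ →₀ ℕ) (P : MvPolynomial σ R) : MvPolynomial σ R := coeff s (Tay σ R P)
lemma hs_add (s : σ →₀ ℕ) (P Q : MvPolynomial σ R) : hs s (P + Q) = hs s P + hs s Q := by
  simp [hs]
lemma hs_sum {ι : Type*} (s : σ →₀ ℕ) (t : Finset ι) (P : ι → MvPolynomial σ R) :
    hs s (∑ i ∈ t, P i) = ∑ i ∈ t, hs s (P i) := by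
  simp [hs, coeff_sum]
lemma hs_C_mul (s : σ →₀ ℕ) (a : R) (P : MvPolynomial σ R) : hs s (C a * P) = C a * hs s P := by
  simp [hs, Tay]
def bn (e s : σ →₀ ℕ) : ℕ := ∏ i, (e i + s i).choose (s i)
lemma bn_pascal (e s : σ →₀ ℕ) (i : σ) (h : i ∈ (e + s).support) :
    bn e s = (if i ∈ e.support then bn (e - Finsupp.single i 1) s else 0) +
      (if i ∈ s.support then bn e (s - Finsupp.single i 1) else 0) := by
  have hp : ∀ e s : σ →₀ ℕ, bn e s = (e i + s i).choose (s i) *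
      ∏ j ∈ Finset.univ.erase i, (e j + s j).choose (s j) := fun e s =>
    (Finset.mul_prod_erase _ _ (Finset.mem_univ i)).symm
  have hc : ∀ e s : σ →₀ ℕ, ∏ j ∈ Finset.univ.erase i, ((e - Finsupp.single i 1 : σ →₀ ℕ) j + s j).choose (s j)
      = ∏ j ∈ Finset.univ.erase i, (e j + s j).choose (s j) := fun e s =>
    Finset.prod_congr rfl fun j hj => by
      have : i ≠ j := (Finset.ne_of_mem_erase hj).symm
      simp [Finsupp.single_apply, this]
  have hd : ∀ e s : σ →₀ ℕ, ∏ j ∈ Finset.univ.erase i, (e j + (s - Finsupp.single i 1 : σ →₀ ℕ) j).choose ((s - Finsupp.single i 1 : σ →₀ ℕ) j)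
      = ∏ j ∈ Finset.univ.erase i, (e j + s j).choose (s j) := fun e s =>
    Finset.prod_congr rfl fun j hj => by
      have : i ≠ j := (Finset.ne_of_mem_erase hj).symm
      simp [Finsupp.single_apply, this]
  rw [hp, hp _ s, hp e, hc, hd]
  simp only [Finsupp.mem_support_iff, Finsupp.coe_add, Pi.add_apply, Finsupp.coe_tsub,
    Pi.sub_apply, Finsupp.single_eq_same] at h ⊢
  generalize ∏ j ∈ Finset.univ.erase i, (e j + s j).choose (s j) = q
  generalize e i = a at *
  generalize s i = b at *
  rcases a with _ | a <;> rcases b with _ | b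
  · simp at h
  · simp
  · simp
  · simp only [Nat.add_sub_cancel, ne_eq, Nat.add_eq_zero_iff, one_ne_zero, and_false,
      not_false_eq_true, if_true, ← add_mul]
    congr 1
    rw [show a + 1 + (b + 1) = (a + b + 1) + 1 by ring, Nat.choose_succ_succ,
      show a + (b + 1) = a + b + 1 by ring, show a + 1 + b = a + b + 1 by ring]
    ring
lemma coeff_hs (s e : σ →₀ ℕ) (P : MvPolynomial σ R) :
    coeff e (hs s P) = bn e s * coeff (e + s) P := by
  induction P using MvPolynomial.induction_on generalizing s e with
  | C a =>
    simp only [hs, Tay, eval₂Hom_C, RingHom.comp_apply, coeff_C]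
    by_cases h : s = 0
    · subst h; by_cases h2 : e = 0
      · subst h2; simp [bn]
      · simp [Ne.symm h2, coeff_C]
    · have : ¬ (0 = e + s) := fun h' => h (by
        ext i; have := DFunLike.congr_fun h' i
        simp only [Finsupp.coe_add, Pi.add_apply, Finsupp.coe_zero, Pi.zero_apply] at this ⊢; omega)
      simp [Ne.symm h, this]
  | add p q hp hq => rw [hs_add, coeff_add, hp, hq, coeff_add]; ring
  | mul_X p i hp =>
    have h1 : hs s (p * X i) = hs s p * X i +
        (if i ∈ s.support then hs (s - Finsupp.single i 1) p else 0) := by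
      simp only [hs, map_mul]
      rw [show Tay σ R (X i) = C (X i) + X i by simp [Tay], mul_add, coeff_add, coeff_mul_X',
        mul_comm _ (C _), coeff_C_mul, mul_comm (X i)]
    rw [h1, coeff_add, coeff_mul_X', coeff_mul_X']
    by_cases h : i ∈ (e + s).support
    · rw [bn_pascal e s i h, if_pos h, Nat.cast_add, add_mul]
      congr 1
      · by_cases h2 : i ∈ e.support
        · simp only [if_pos h2, hp]
          congr 2
          have := Finsupp.mem_support_iff.1 h2
          ext j; by_cases hj : i = j
          · subst hj; simp; omega
          · simp [Finsupp.single_apply, hj]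
        · rw [if_neg h2, if_neg h2]; simp
      · by_cases h2 : i ∈ s.support
        · simp only [if_pos h2, hp]
          congr 2
          have := Finsupp.mem_support_iff.1 h2
          ext j; by_cases hj : i = j
          · subst hj; simp; omega
          · simp [Finsupp.single_apply, hj]
        · rw [if_neg h2, if_neg h2]; simp
    · have h2 : i ∉ e.support := by simp at h ⊢; omega
      have h3 : i ∉ s.support := by simp at h ⊢; omega
      rw [if_neg h2, if_neg h3, if_neg h]; simp
noncomputable def Tr [Algebra R S] (β : σ → S) : MvPolynomial σ R →+* MvPolynomial σ S :=
  eval₂Hom (C.comp (algebraMap R S)) (fun i => X i + C (β i))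
lemma hs_Tr [Algebra R S] (β : σ → S) (s : σ →₀ ℕ) (P : MvPolynomial σ R) :
    hs s (Tr β P) = Tr β (hs s P) := by
  have h : (Tay σ S).comp (Tr (R := R) β) = (MvPolynomial.map (Tr β)).comp (Tay σ R) := by
    apply MvPolynomial.ringHom_ext
    · intro a; simp [Tay, Tr]
    · intro i; simp [Tay, Tr]; ring
  have := RingHom.congr_fun h P
  simp only [RingHom.comp_apply] at this
  simp only [hs, this, coeff_map]
end hasse
section wronsk
variable {m : ℕ} {F : Type*} [Field F] [CharZero F]
def bspan (F : Type*) [Field F] (m j : ℕ) : Submodule F ((Fin m →₀ ℕ) → F) :=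
  Submodule.span F {f | ∃ s : Fin m →₀ ℕ, ∑ i, s i ≤ j ∧ f = fun e => ((∏ i, (e i).choose (s i) : ℕ) : F)}
lemma bspan_step (j : ℕ) (i : Fin m) (c : F) (f) (hf : f ∈ bspan F m j) :
    (fun e : Fin m →₀ ℕ => ((e i : F) - c) * f e) ∈ bspan F m (j + 1) := by
  let L : ((Fin m →₀ ℕ) → F) →ₗ[F] ((Fin m →₀ ℕ) → F) :=
    { toFun := fun f e => ((e i : F) - c) * f e
      map_add' := fun f g => by ext; simp; ring
      map_smul' := fun a f => by ext; simp; ring }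
  have : bspan F m j ≤ (bspan F m (j+1)).comap L := by
    rw [bspan, Submodule.span_le]
    rintro _ ⟨s, hs, rfl⟩
    have hsum : ∑ l, (s + Finsupp.single i 1 : Fin m →₀ ℕ) l = ∑ l, s l + 1 := by
      simp [Finset.sum_add_distrib, Finsupp.single_apply]
    have h1 : (fun e : Fin m →₀ ℕ => ((∏ l, (e l).choose ((s + Finsupp.single i 1 : Fin m →₀ ℕ) l) : ℕ) : F))
        ∈ bspan F m (j+1) := Submodule.subset_span ⟨_, by omega, rfl⟩
    have h2 : (fun e : Fin m →₀ ℕ => ((∏ l, (e l).choose (s l) : ℕ) : F))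
        ∈ bspan F m (j+1) := Submodule.subset_span ⟨_, by omega, rfl⟩
    have h3 := (bspan F m (j+1)).add_mem ((bspan F m (j+1)).smul_mem ((s i + 1 : ℕ) : F) h1)
      ((bspan F m (j+1)).smul_mem ((s i : F) - c) h2)
    show L _ ∈ bspan F m (j+1)
    refine (congrArg (· ∈ bspan F m (j+1)) ?_).mpr h3
    ext e
    simp only [L, LinearMap.coe_mk, AddHom.coe_mk, Pi.add_apply, Pi.smul_apply, smul_eq_mul]
    rw [← Finset.mul_prod_erase _ _ (Finset.mem_univ i),
      ← Finset.mul_prod_erase Finset.univ (fun l => (e l).choose ((s + Finsupp.single i 1 : Fin m →₀ ℕ) l)) (Finset.mem_univ i),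
      Finset.prod_congr (s₁ := Finset.univ.erase i) rfl (f := fun l => (e l).choose ((s + Finsupp.single i 1 : Fin m →₀ ℕ) l)) (g := fun l => (e l).choose (s l)) (fun l hl => by
        have : i ≠ l := (Finset.ne_of_mem_erase hl).symm
        simp [Finsupp.single_apply, this])]
    have hch : (e i : F) * ((e i).choose (s i) : ℕ) = ((s i + 1 : ℕ) : F) * ((e i).choose (s i + 1) : ℕ) + (s i : F) * ((e i).choose (s i) : ℕ) := by
      have := Nat.choose_succ_right_eq (e i) (s i)
      rcases le_or_gt (s i) (e i) with h | h
      · have h' : ((e i - s i : ℕ) : F) = (e i : F) - s i := Nat.cast_sub h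
        have this' := congrArg (Nat.cast : ℕ → F) this
        simp only [Nat.cast_mul, h'] at this'
        linear_combination -this'
      · simp [Nat.choose_eq_zero_of_lt h, Nat.choose_eq_zero_of_lt (h.trans (Nat.lt_succ_self _))]
    generalize ∏ l ∈ Finset.univ.erase i, (e l).choose (s l) = q
    simp only [Finsupp.coe_add, Pi.add_apply, Finsupp.single_eq_same, Nat.cast_mul]
    linear_combination (q : F) * hch
  exact this hf
lemma sep_prod {ι : Type*} [DecidableEq ι] (t : Finset ι) (e : ι → Fin m →₀ ℕ) (e0 : Fin m →₀ ℕ)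
    (h : ∀ b ∈ t, e b ≠ e0) :
    ∃ f ∈ bspan F m t.card, f e0 ≠ 0 ∧ ∀ b ∈ t, f (e b) = 0 := by
  induction t using Finset.induction_on with
  | empty => exact ⟨fun _ => 1, Submodule.subset_span ⟨0, by simp, by ext; simp⟩, by simp, by simp⟩
  | insert b t hb ih =>
    obtain ⟨f, hf, h0, h1⟩ := ih fun c hc => h c (Finset.mem_insert_of_mem hc)
    have := h b (Finset.mem_insert_self _ _)
    obtain ⟨i, hi⟩ := DFunLike.ne_iff.1 this
    refine ⟨_, by rw [Finset.card_insert_of_notMem hb]; exact bspan_step _ i (e b i : F) f hf, ?_, ?_⟩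
    · refine mul_ne_zero (sub_ne_zero.2 ?_) h0
      exact_mod_cast hi.symm
    · intro c hc
      rcases Finset.mem_insert.1 hc with rfl | hc
      · simp
      · simp [h1 c hc]
lemma exists_binom_det {k : ℕ} (e : Fin k → Fin m →₀ ℕ) (he : Function.Injective e) :
    ∃ s : Fin k → Fin m →₀ ℕ, (∀ a, ∑ i, s a i ≤ k - 1) ∧
      (Matrix.of fun a b => ((∏ i, (e b i).choose (s a i) : ℕ) : F)).det ≠ 0 := by
  let ev : ((Fin m →₀ ℕ) → F) →ₗ[F] (Fin k → F) := LinearMap.funLeft F F e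
  set A : Set (Fin k → F) := ev '' {f | ∃ s : Fin m →₀ ℕ, ∑ i, s i ≤ k - 1 ∧ f = fun e => ((∏ i, (e i).choose (s i) : ℕ) : F)} with hA
  have hspan : Submodule.span F A = ⊤ := by
    rw [hA, ← Submodule.map_span, eq_top_iff, ← (Pi.basisFun F (Fin k)).span_eq, Submodule.span_le]
    rintro _ ⟨b, rfl⟩
    obtain ⟨f, hf, h0, h1⟩ := sep_prod (F := F) (Finset.univ.erase b) e (e b)
      (fun c hc h => (Finset.ne_of_mem_erase hc) (he h))
    rw [Finset.card_erase_of_mem (Finset.mem_univ b), Finset.card_fin] at hf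
    refine ⟨(f (e b))⁻¹ • f, Submodule.smul_mem _ _ hf, ?_⟩
    ext c
    simp only [ev, LinearMap.funLeft_apply, Pi.smul_apply, smul_eq_mul, Pi.basisFun_apply]
    by_cases hc : c = b
    · subst hc; simp [h0]
    · simp [hc, h1 c (Finset.mem_erase.2 ⟨hc, Finset.mem_univ _⟩)]
  obtain ⟨f, hfA, -, hfl⟩ := Submodule.exists_fun_fin_finrank_span_eq F A
  have hr : Module.finrank F (Submodule.span F A) = k := by rw [hspan]; simp
  have hfA' : ∀ a : Fin k, ∃ s : Fin m →₀ ℕ, ∑ i, s i ≤ k - 1 ∧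
      f (Fin.cast hr.symm a) = fun b => ((∏ i, (e b i).choose (s i) : ℕ) : F) := by
    intro a
    obtain ⟨_, ⟨s, hs, rfl⟩, h⟩ := hfA (Fin.cast hr.symm a)
    exact ⟨s, hs, h.symm⟩
  choose s hs1 hs2 using hfA'
  refine ⟨s, hs1, ?_⟩
  have hl : LinearIndependent F fun a : Fin k => f (Fin.cast hr.symm a) :=
    hfl.comp _ (Fin.cast_injective _)
  have hu := Matrix.linearIndependent_rows_iff_isUnit
    (A := Matrix.of fun a b => ((∏ i, (e b i).choose (s a i) : ℕ) : F))
  have : IsUnit (Matrix.of fun a b => ((∏ i, (e b i).choose (s a i) : ℕ) : F)) := by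
    rw [← hu]
    convert hl using 2 with a
    rw [hs2]; rfl
  exact ((Matrix.isUnit_iff_isUnit_det _).1 this).ne_zero
end wronsk
open MvPolynomial
section wronsk2
variable {m : ℕ} {F : Type*} [Field F] [CharZero F]
open MonomialOrder
lemma coeff_prod_le (ord : MonomialOrder (Fin m)) {ι : Type*} (t : Finset ι) (P : ι → MvPolynomial (Fin m) F) (d : ι → Fin m →₀ ℕ)
    (h : ∀ i ∈ t, ord.toSyn (ord.degree (P i)) ≤ ord.toSyn (d i)) :
    coeff (∑ i ∈ t, d i) (∏ i ∈ t, P i) = ∏ i ∈ t, coeff (d i) (P i) ∧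
      ord.toSyn (ord.degree (∏ i ∈ t, P i)) ≤ ord.toSyn (∑ i ∈ t, d i) := by
  classical
  induction t using Finset.induction_on with
  | empty => simp
  | insert a t ha ih =>
    obtain ⟨h1, h2⟩ := ih fun i hi => h i (Finset.mem_insert_of_mem hi)
    have h3 := h a (Finset.mem_insert_self _ _)
    rw [Finset.sum_insert ha, Finset.prod_insert ha, Finset.prod_insert ha]
    refine ⟨?_, ?_⟩
    · rw [ord.coeff_mul_of_add_of_degree_le h3 h2, h1]
    · refine ord.degree_mul_le.trans ?_
      rw [map_add, map_add]; exact add_le_add h3 h2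
lemma coeff_mon_hs (s e : Fin m →₀ ℕ) (f : MvPolynomial (Fin m) F) :
    coeff e (monomial s 1 * hs s f) = ((∏ i, (e i).choose (s i) : ℕ) : F) * coeff e f := by
  rw [coeff_monomial_mul']
  split_ifs with h
  · rw [coeff_hs, one_mul, tsub_add_cancel_of_le h]
    congr 2
    refine Finset.prod_congr rfl fun i _ => ?_
    have := h i
    simp [this]
  · have : ∃ i, e i < s i := by
      by_contra hc; push Not at hc; exact h hc
    obtain ⟨i, hi⟩ := this
    rw [Finset.prod_eq_zero (Finset.mem_univ i) (Nat.choose_eq_zero_of_lt hi)]; simp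
lemma wronsk {k : ℕ} (φ : Fin k → MvPolynomial (Fin m) F) (hφ : LinearIndependent F φ) :
    ∃ s : Fin k → Fin m →₀ ℕ, (∀ a, ∑ i, s a i ≤ k - 1) ∧
      (Matrix.of fun a b => hs (s a) (φ b)).det ≠ 0 := by
  classical
  let ord : MonomialOrder (Fin m) := MonomialOrder.lex
  set V := Submodule.span F (Set.range φ) with hV
  have hfr : Module.finrank F V = k := by
    rw [hV, finrank_span_eq_card hφ]; simp
  let D : Set (Fin m →₀ ℕ) := {d | ∃ f ∈ V, f ≠ 0 ∧ ord.degree f = d}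
  have hd : ∃ d : Fin k → D, Function.Injective d := by
    rcases Set.finite_or_infinite D with hD | hD
    · haveI := hD.fintype
      have : k ≤ Fintype.card D := by
        rw [← hfr, ← Module.finrank_fintype_fun_eq_card F]
        let ev : V →ₗ[F] (D → F) := LinearMap.pi fun d => (lcoeff F d.1).comp V.subtype
        refine LinearMap.finrank_le_finrank_of_injective (f := ev) ?_
        rw [← LinearMap.ker_eq_bot, LinearMap.ker_eq_bot']
        intro f hf
        by_contra hne
        have hne' : (f : MvPolynomial (Fin m) F) ≠ 0 := fun h => hne (Subtype.ext h)
        have := congrFun hf ⟨ord.degree f.1, f.1, f.2, hne', rfl⟩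
        simp only [ev, LinearMap.pi_apply, LinearMap.comp_apply, Submodule.subtype_apply, lcoeff_apply,
          Pi.zero_apply] at this
        exact ord.leadingCoeff_ne_zero_iff.2 hne' this
      exact ⟨fun a => (Fintype.equivFin D).symm (Fin.castLE this a), fun a b h => by simpa using h⟩
    · haveI := hD.to_subtype
      exact ⟨fun a => Infinite.natEmbedding D a, fun a b h => Fin.ext ((Infinite.natEmbedding D).injective h)⟩
  obtain ⟨d, hd⟩ := hd
  choose f hfV hf0 hfd using fun a => (d a).2
  obtain ⟨s, hs1, hs2⟩ := exists_binom_det (F := F) (fun a => (d a).1) (fun a b h => hd (Subtype.ext h))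
  refine ⟨s, hs1, fun hdet => ?_⟩
  have hg : ∀ a, ∃ g : Fin k → F, ∑ b, g b • φ b = f a := fun a =>
    (Submodule.mem_span_range_iff_exists_fun F).1 (hfV a)
  choose g hg using hg
  have h1 : (Matrix.of fun a b => hs (s a) (f b)) = (Matrix.of fun a b => hs (s a) (φ b)) *
      (Matrix.of fun a b => C (g b a)) := by
    ext1 a b
    simp only [Matrix.of_apply, Matrix.mul_apply, ← hg, hs_sum, smul_eq_C_mul, hs_C_mul]
    exact Finset.sum_congr rfl fun c _ => mul_comm _ _
  have h2 : (Matrix.of fun a b => hs (s a) (f b)).det = 0 := by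
    rw [h1, Matrix.det_mul, hdet, zero_mul]
  have h3 : (Matrix.of fun a b => (monomial (s a) (1 : F)) * hs (s a) (f b)).det = 0 := by
    have := Matrix.det_mul_column (fun a => monomial (s a) (1 : F)) (Matrix.of fun a b => hs (s a) (f b))
    rw [h2, mul_zero] at this
    exact this
  have h4 := congrArg (coeff (∑ b, (d b).1)) h3
  rw [Matrix.det_apply', coeff_sum, coeff_zero] at h4
  apply hs2
  have h5 : ∏ b, coeff (d b).1 (f b) ≠ 0 := Finset.prod_ne_zero_iff.2 fun b _ => by
    rw [← hfd b]; exact ord.leadingCoeff_ne_zero_iff.2 (hf0 b)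
  refine Or.resolve_right (mul_eq_zero.1 (?_ : _ * ∏ b, coeff (d b).1 (f b) = 0)) h5
  rw [← h4, Matrix.det_apply', Finset.sum_mul]
  refine Finset.sum_congr rfl fun τ _ => ?_
  have hc : ((Equiv.Perm.sign τ : ℤ) : MvPolynomial (Fin m) F) = C ((Equiv.Perm.sign τ : ℤ) : F) := by
    simp
  rw [hc, coeff_C_mul, (coeff_prod_le ord Finset.univ _ (fun b => (d b).1) _).1, mul_assoc,
    ← Finset.prod_mul_distrib]
  · congr 1
    refine Finset.prod_congr rfl fun b _ => ?_
    simp only [Matrix.of_apply, coeff_mon_hs]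
  · intro b _
    rw [ord.degree_le_iff]
    intro c hc
    rw [mem_support_iff, Matrix.of_apply, coeff_mon_hs] at hc
    rw [← hfd b]
    exact ord.le_degree (mem_support_iff.2 (right_ne_zero_of_mul hc))
end wronsk2
open MvPolynomial
section L1
variable {σ : Type*} {R : Type*} [CommRing R] (ν : AbsoluteValue R ℝ)
noncomputable def L1 (P : MvPolynomial σ R) : ℝ := ∑ e ∈ P.support, ν (coeff e P)
lemma L1_eq_of_subset {P : MvPolynomial σ R} {t : Finset (σ →₀ ℕ)} (h : P.support ⊆ t) :
    L1 ν P = ∑ e ∈ t, ν (coeff e P) :=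
  Finset.sum_subset h fun e _ he => by simp [notMem_support_iff.1 he]
lemma L1_nonneg (P : MvPolynomial σ R) : 0 ≤ L1 ν P := Finset.sum_nonneg fun _ _ => ν.nonneg _
lemma L1_add (P Q : MvPolynomial σ R) : L1 ν (P + Q) ≤ L1 ν P + L1 ν Q := by
  classical
  rw [L1_eq_of_subset ν (support_add (p := P) (q := Q)),
    L1_eq_of_subset ν (Finset.subset_union_left (s₁ := P.support) (s₂ := Q.support)),
    L1_eq_of_subset ν (Finset.subset_union_right (s₁ := P.support) (s₂ := Q.support)),
    ← Finset.sum_add_distrib]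
  exact Finset.sum_le_sum fun e _ => by rw [coeff_add]; exact ν.add_le _ _
@[simp] lemma L1_zero : L1 ν (0 : MvPolynomial σ R) = 0 := by simp [L1]
lemma L1_sum {ι : Type*} (t : Finset ι) (P : ι → MvPolynomial σ R) :
    L1 ν (∑ i ∈ t, P i) ≤ ∑ i ∈ t, L1 ν (P i) := by
  classical
  induction t using Finset.induction_on with
  | empty => simp
  | insert a t ha ih =>
    rw [Finset.sum_insert ha, Finset.sum_insert ha]
    exact (L1_add ν _ _).trans (by gcongr)
lemma L1_monomial (e : σ →₀ ℕ) (a : R) : L1 ν (monomial e a) = ν a := by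
  classical
  rw [L1_eq_of_subset ν support_monomial_subset]; simp
lemma L1_mul (P Q : MvPolynomial σ R) : L1 ν (P * Q) ≤ L1 ν P * L1 ν Q := by
  have h : P * Q = ∑ e ∈ P.support, ∑ f ∈ Q.support, monomial (e + f) (coeff e P * coeff f Q) := by
    conv_lhs => rw [P.as_sum, Q.as_sum]
    rw [Finset.sum_mul_sum]
    exact Finset.sum_congr rfl fun e _ => Finset.sum_congr rfl fun f _ => by rw [monomial_mul]
  rw [show L1 ν P * L1 ν Q = _ from Finset.sum_mul_sum _ _ _ _, h]
  refine (L1_sum ν _ _).trans (Finset.sum_le_sum fun e _ => ?_)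
  refine (L1_sum ν _ _).trans (Finset.sum_le_sum fun f _ => ?_)
  rw [L1_monomial, map_mul]
lemma L1_C (a : R) : L1 ν (C a : MvPolynomial σ R) = ν a := L1_monomial ν 0 a
lemma L1_X [Nontrivial R] (i : σ) : L1 ν (X i : MvPolynomial σ R) = ν 1 := L1_monomial ν _ 1
lemma coeff_le_L1 (P : MvPolynomial σ R) (e) : ν (coeff e P) ≤ L1 ν P := by
  by_cases h : e ∈ P.support
  · exact Finset.single_le_sum (f := fun e => ν (coeff e P)) (fun _ _ => ν.nonneg _) h
  · rw [notMem_support_iff.1 h, map_zero]; exact L1_nonneg ν P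
lemma L1_prod [IsDomain R] {ι : Type*} (t : Finset ι) (P : ι → MvPolynomial σ R) :
    L1 ν (∏ i ∈ t, P i) ≤ ∏ i ∈ t, L1 ν (P i) := by
  classical
  induction t using Finset.induction_on with
  | empty => rw [Finset.prod_empty, ← C_1, L1_C]; simp
  | insert a t ha ih =>
    rw [Finset.prod_insert ha, Finset.prod_insert ha]
    exact (L1_mul ν _ _).trans (mul_le_mul_of_nonneg_left ih (L1_nonneg ν _))
lemma L1_det [IsDomain R] {k : ℕ} (M : Matrix (Fin k) (Fin k) (MvPolynomial σ R)) (b : ℝ)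
    (h : ∀ i j, L1 ν (M i j) ≤ b) : L1 ν M.det ≤ (k.factorial : ℝ) * b ^ k := by
  rw [Matrix.det_apply]
  refine (L1_sum ν _ _).trans ?_
  have : ∀ τ ∈ (Finset.univ : Finset (Equiv.Perm (Fin k))),
      L1 ν (Equiv.Perm.sign τ • ∏ i, M (τ i) i) ≤ b ^ k := by
    intro τ _
    have h1 : L1 ν (Equiv.Perm.sign τ • ∏ i, M (τ i) i) = L1 ν (∏ i, M (τ i) i) := by
      rcases Int.units_eq_one_or (Equiv.Perm.sign τ) with h | h <;> rw [h]
      · simp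
      · simp [L1]
    rw [h1]
    refine (L1_prod ν _ _).trans ?_
    refine (Finset.prod_le_prod (fun _ _ => L1_nonneg ν _) fun i _ => h (τ i) i).trans ?_
    simp
  refine (Finset.sum_le_card_nsmul _ _ _ this).trans ?_
  simp [Fintype.card_perm]
noncomputable def nuZ : AbsoluteValue ℤ ℝ :=
  AbsoluteValue.abs.comp (f := Int.castRingHom ℝ) (RingHom.injective_int _)
lemma nuZ_apply (a : ℤ) : nuZ a = |(a : ℝ)| := rfl
end L1
section wge
variable {σ : Type*} [Fintype σ] {R : Type*} [CommRing R]
def wge (w : σ → ℝ) (x : ℝ) (Q : MvPolynomial σ R) : Prop :=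
  ∀ s : σ →₀ ℕ, coeff s Q ≠ 0 → x ≤ ∑ i, s i * w i
lemma wge_mul {w : σ → ℝ} {x y : ℝ} {P Q : MvPolynomial σ R} (hP : wge w x P) (hQ : wge w y Q) :
    wge w (x + y) (P * Q) := by
  classical
  intro s hs
  rw [coeff_mul] at hs
  obtain ⟨⟨a, b⟩, hab, hne⟩ := Finset.exists_ne_zero_of_sum_ne_zero hs
  rw [Finset.HasAntidiagonal.mem_antidiagonal] at hab
  have h1 := hP a (left_ne_zero_of_mul hne)
  have h2 := hQ b (right_ne_zero_of_mul hne)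
  simp only at hab
  rw [← hab]
  simp only [Finsupp.coe_add, Pi.add_apply, Nat.cast_add, add_mul, Finset.sum_add_distrib]
  linarith
lemma wge_sum {ι : Type*} {w : σ → ℝ} {x : ℝ} (t : Finset ι) (P : ι → MvPolynomial σ R)
    (hP : ∀ i ∈ t, wge w x (P i)) : wge w x (∑ i ∈ t, P i) := by
  intro s hs
  rw [coeff_sum] at hs
  obtain ⟨i, hi, hne⟩ := Finset.exists_ne_zero_of_sum_ne_zero hs
  exact hP i hi s hne
lemma wge_prod {ι : Type*} {w : σ → ℝ} (t : Finset ι) (P : ι → MvPolynomial σ R) (x : ι → ℝ)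
    (hP : ∀ i ∈ t, wge w (x i) (P i)) : wge w (∑ i ∈ t, x i) (∏ i ∈ t, P i) := by
  classical
  induction t using Finset.induction_on with
  | empty =>
    intro s hs
    rw [Finset.prod_empty, coeff_one] at hs
    have : 0 = s := by by_contra h; exact hs (if_neg h)
    subst this; simp
  | insert a t ha ih =>
    rw [Finset.sum_insert ha, Finset.prod_insert ha]
    exact wge_mul (hP a (Finset.mem_insert_self _ _)) (ih fun i hi => hP i (Finset.mem_insert_of_mem hi))
lemma wge_det {k : ℕ} {w : σ → ℝ} (M : Matrix (Fin k) (Fin k) (MvPolynomial σ R))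
    (x : Fin k → ℝ) (h : ∀ i j, wge w (x j) (M i j)) : wge w (∑ j, x j) M.det := by
  rw [Matrix.det_apply']
  refine wge_sum _ _ fun τ _ => ?_
  have : ((Equiv.Perm.sign τ : ℤ) : MvPolynomial σ R) = C ((Equiv.Perm.sign τ : ℤ) : R) := by simp
  intro s hs
  rw [this, coeff_C_mul] at hs
  exact wge_prod _ _ x (fun i _ => h (τ i) i) s (right_ne_zero_of_mul hs)
end wge
section tens
variable {m : ℕ} {R S : Type*} [CommRing R] [CommRing S]
noncomputable def tens (U : MvPolynomial (Fin m) R) (V : MvPolynomial (Fin 1) R) :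
    MvPolynomial (Fin (m+1)) R := rename Fin.succ U * rename (fun _ => 0) V
lemma coeff_tens (U : MvPolynomial (Fin m) R) (V : MvPolynomial (Fin 1) R) (e : Fin (m+1) →₀ ℕ) :
    coeff e (tens U V) = coeff e.tail U * coeff (Finsupp.single 0 (e 0)) V := by
  classical
  unfold tens
  induction U using MvPolynomial.induction_on' with
  | add p q hp hq => rw [map_add, add_mul, coeff_add, hp, hq, coeff_add]; ring
  | monomial u a =>
    induction V using MvPolynomial.induction_on' with
    | add p q hp hq => rw [map_add, mul_add, coeff_add, hp, hq, coeff_add]; ring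
    | monomial v b =>
      rw [rename_monomial, rename_monomial, monomial_mul, coeff_monomial, coeff_monomial,
        coeff_monomial]
      have h : (Finsupp.mapDomain Fin.succ u + Finsupp.mapDomain (fun _ => 0) v = e) ↔
          (u = e.tail ∧ v = Finsupp.single 0 (e 0)) := by
        have h0 : ∀ i : Fin m, (Finsupp.mapDomain (fun _ : Fin 1 => (0 : Fin (m+1))) v) i.succ = 0 := by
          intro i; apply Finsupp.mapDomain_notin_range; simp
        have h00 : (Finsupp.mapDomain (fun _ : Fin 1 => (0 : Fin (m+1))) v) 0 = v 0 :=
          Finsupp.mapDomain_apply (f := fun _ : Fin 1 => (0 : Fin (m+1)))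
            (fun a b _ => Subsingleton.elim a b) v 0
        have h1 : ∀ i : Fin m, (Finsupp.mapDomain Fin.succ u) i.succ = u i := fun i =>
          Finsupp.mapDomain_apply (Fin.succ_injective m) u i
        have h10 : (Finsupp.mapDomain Fin.succ u) 0 = 0 := by
          apply Finsupp.mapDomain_notin_range; simp [Fin.succ_ne_zero]
        constructor
        · rintro rfl
          constructor
          · ext i; simp [Finsupp.tail_apply, h0, h1]
          · ext; simp [h00, h10]
        · rintro ⟨rfl, rfl⟩
          ext i; refine Fin.cases ?_ (fun i => ?_) i
          · simp [h00, h10]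
          · simp [h0, h1, Finsupp.tail_apply]
      simp only [h]
      by_cases h1 : u = e.tail <;> by_cases h2 : v = Finsupp.single 0 (e 0) <;> simp [h1, h2]
lemma hs_tens (s : Fin (m+1) →₀ ℕ) (U : MvPolynomial (Fin m) R) (V : MvPolynomial (Fin 1) R) :
    hs s (tens U V) = tens (hs s.tail U) (hs (Finsupp.single 0 (s 0)) V) := by
  ext e
  rw [coeff_hs, coeff_tens, coeff_tens, coeff_hs, coeff_hs]
  have h1 : bn e s = bn (Finsupp.single (0 : Fin 1) (e 0)) (Finsupp.single 0 (s 0)) * bn e.tail s.tail := by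
    simp [bn, Fin.prod_univ_succ, Finsupp.tail_apply]
  have h2 : (e + s).tail = e.tail + s.tail := by ext; simp [Finsupp.tail_apply]
  rw [h1, h2, Finsupp.add_apply, Finsupp.single_add]; push_cast; ring
lemma Tr_tens [Algebra R S] (β : Fin (m+1) → S) (U : MvPolynomial (Fin m) R) (V : MvPolynomial (Fin 1) R) :
    Tr β (tens U V) = tens (Tr (fun i => β i.succ) U) (Tr (fun _ => β 0) V) := by
  have h : ∀ (τ : Type) (f : τ → Fin (m+1)) (p : MvPolynomial τ R),
      Tr β (rename f p) = rename f (Tr (fun i => β (f i)) p) := by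
    intro τ f p
    have : (Tr (R := R) β).comp (rename f : MvPolynomial τ R →ₐ[R] _).toRingHom =
        (rename f : MvPolynomial τ S →ₐ[S] _).toRingHom.comp (Tr (R := R) (fun i => β (f i))) := by
      apply MvPolynomial.ringHom_ext
      · intro a; simp [Tr, algebraMap_eq]
      · intro i; simp [Tr]
    exact RingHom.congr_fun this p
  rw [tens, map_mul, h, h]; rfl
lemma hs_map (f : R →+* S) (s : Fin m →₀ ℕ) (P : MvPolynomial (Fin m) R) :
    hs s (map f P) = map f (hs s P) := by
  ext e; rw [coeff_hs, coeff_map, coeff_map, coeff_hs]; simp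
lemma Tr_map {T : Type*} [CommRing T] [Algebra R S] [Algebra S T] [Algebra R T] [IsScalarTower R S T]
    (β : Fin m → T) (P : MvPolynomial (Fin m) R) :
    Tr β (map (algebraMap R S) P) = Tr β P := by
  have : (Tr (R := S) β).comp (map (algebraMap R S)) = Tr (R := R) β := by
    apply MvPolynomial.ringHom_ext
    · intro a; simp [Tr, ← IsScalarTower.algebraMap_apply]
    · intro i; simp [Tr]
  exact RingHom.congr_fun this P
lemma Tr_ne_zero [Algebra R S] (hinj : Function.Injective (algebraMap R S)) (β : Fin m → S)
    {P : MvPolynomial (Fin m) R} (hP : P ≠ 0) : Tr β P ≠ 0 := by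
  have h : (Tr (R := S) (fun i => - β i)).comp (Tr (R := R) β) = map (algebraMap R S) := by
    apply MvPolynomial.ringHom_ext
    · intro a; simp [Tr]
    · intro i; simp [Tr]
  intro h0
  have := RingHom.congr_fun h P
  rw [RingHom.comp_apply, h0, map_zero] at this
  exact hP (map_injective _ hinj (by rw [← this, map_zero]))
lemma tens_rank {F : Type*} [Field F] (P : MvPolynomial (Fin (m+1)) F) (hP : P ≠ 0) (r : ℕ)
    (hr : ∀ e, coeff e P ≠ 0 → e 0 ≤ r) :
    ∃ k, 1 ≤ k ∧ k ≤ r + 1 ∧ ∃ (φ : Fin k → MvPolynomial (Fin m) F) (ψ : Fin k → MvPolynomial (Fin 1) F),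
      LinearIndependent F φ ∧ LinearIndependent F ψ ∧ P = ∑ a, tens (φ a) (ψ a) := by
  classical
  let p : Fin (r+1) → MvPolynomial (Fin m) F := fun b => Polynomial.coeff (finSuccEquiv F m P) b
  let V := Submodule.span F (Set.range p)
  haveI : Module.Finite F V := FiniteDimensional.span_of_finite F (Set.finite_range p)
  let φ := Module.finBasis F V
  have hpV : ∀ b, p b ∈ V := fun b => Submodule.subset_span ⟨b, rfl⟩
  let ψ : Fin (Module.finrank F V) → MvPolynomial (Fin 1) F := fun a =>
    ∑ b : Fin (r+1), monomial (Finsupp.single 0 (b : ℕ)) (φ.coord a ⟨p b, hpV b⟩)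
  have hψ : ∀ a (b : ℕ), coeff (Finsupp.single 0 b) (ψ a) =
      if h : b < r + 1 then φ.coord a ⟨p ⟨b, h⟩, hpV _⟩ else 0 := by
    intro a b
    simp only [ψ, coeff_sum, coeff_monomial]
    split_ifs with h
    · rw [Finset.sum_eq_single ⟨b, h⟩]
      · simp
      · intro c _ hc
        rw [if_neg]
        intro h'; apply hc; ext; simpa using DFunLike.congr_fun h' 0
      · simp
    · refine Finset.sum_eq_zero fun c _ => ?_
      rw [if_neg]
      intro h'; apply h
      have : (c : ℕ) = b := by simpa using DFunLike.congr_fun h' 0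
      omega
  have hPeq : P = ∑ a, tens (φ a : MvPolynomial (Fin m) F) (ψ a) := by
    ext e
    rw [coeff_sum]
    simp only [coeff_tens, hψ]
    split_ifs with h
    · have h1 : ∑ a, φ.coord a ⟨p ⟨e 0, h⟩, hpV _⟩ • φ a = ⟨p ⟨e 0, h⟩, hpV _⟩ := φ.sum_repr _
      have h2 := congrArg (fun v : V => coeff e.tail (v : MvPolynomial (Fin m) F)) h1
      simp only [Submodule.coe_sum, Submodule.coe_smul, coeff_sum, coeff_smul, smul_eq_mul] at h2
      rw [Finset.sum_congr rfl fun a _ => mul_comm _ _, h2]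
      simp only [p, finSuccEquiv_coeff_coeff]
      rw [Finsupp.cons_tail]
    · simp only [mul_zero, Finset.sum_const_zero]
      by_contra hne
      exact h (Nat.lt_succ_of_le (hr e hne))
  refine ⟨Module.finrank F V, ?_, ?_, fun a => φ a, ψ, ?_, ?_, hPeq⟩
  · by_contra hk
    have hk' : Module.finrank F V = 0 := by omega
    haveI : IsEmpty (Fin (Module.finrank F V)) := by rw [hk']; infer_instance
    apply hP; rw [hPeq]; simp
  · exact (finrank_range_le_card p).trans (by simp)
  · exact φ.linearIndependent.map' V.subtype (by simp)
  · rw [Fintype.linearIndependent_iff]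
    intro u hu
    let l : V →ₗ[F] F := ∑ a, u a • φ.coord a
    have hl : l = 0 := by
      have : ∀ x (hx : x ∈ V), l ⟨x, hx⟩ = 0 := by
        intro x hx
        induction hx using Submodule.span_induction with
        | mem x h =>
          obtain ⟨b, rfl⟩ := h
          have := congrArg (coeff (Finsupp.single 0 (b : ℕ))) hu
          simp only [coeff_sum, coeff_smul, hψ, coeff_zero, b.2, dif_pos] at this
          simpa [l] using this
        | zero => exact map_zero l
        | add x y hx hy h1 h2 =>
          have := map_add l ⟨x, hx⟩ ⟨y, hy⟩
          rw [h1, h2, add_zero] at this; exact this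
        | smul a x hx h1 =>
          have := map_smul l a ⟨x, hx⟩
          rw [h1, smul_zero] at this; exact this
      ext x; exact this x.1 x.2
    intro a
    have := LinearMap.congr_fun hl (φ a)
    simpa [l, Finsupp.single_apply] using this
end tens
open MvPolynomial Height
section
variable {K : Type*} [Field K] [NumberField K]
noncomputable def uni (R : Type*) [CommRing R] : MvPolynomial (Fin 1) R →+* Polynomial R :=
  eval₂Hom Polynomial.C (fun _ => Polynomial.X)
lemma coeff_uni {R : Type*} [CommRing R] (V : MvPolynomial (Fin 1) R) (j : ℕ) :
    (uni R V).coeff j = coeff (Finsupp.single 0 j) V := by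
  classical
  induction V using MvPolynomial.induction_on' with
  | add p q hp hq => rw [map_add, Polynomial.coeff_add, hp, hq, coeff_add]
  | monomial u a =>
    have : uni R (monomial u a) = Polynomial.C a * Polynomial.X ^ (u 0) := by
      rw [uni, coe_eval₂Hom, eval₂_monomial, Finsupp.prod_fintype _ _ (by simp)]; simp
    rw [this, Polynomial.coeff_C_mul_X_pow, coeff_monomial]
    congr 1
    have : u = Finsupp.single 0 j ↔ j = u 0 := by
      constructor
      · rintro rfl; simp
      · rintro rfl; ext; simp
    simp [this]
lemma ext1 (e : Fin 1 →₀ ℕ) : e = Finsupp.single 0 (e 0) := by ext; simp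
lemma one_var' (V : MvPolynomial (Fin 1) ℤ) (hV : V ≠ 0) (B r : ℝ)
    (hr : ∀ e, coeff e V ≠ 0 → (e 0 : ℝ) ≤ r) (hr0 : 0 ≤ r) (hB : L1 nuZ V ≤ Real.exp B) (β : K) :
    ∃ s : ℕ, coeff (Finsupp.single 0 s) (Tr (fun _ => β) V) ≠ 0 ∧
      s * logHeight₁ β ≤ Module.finrank ℚ K * (B + r) := by
  classical
  have hT : Tr (fun _ => β) V ≠ 0 := Tr_ne_zero (RingHom.injective_int (algebraMap ℤ K)) _ hV
  have hex : ∃ s : ℕ, coeff (Finsupp.single 0 s) (Tr (fun _ => β) V) ≠ 0 := by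
    by_contra! h
    apply hT; ext e; rw [ext1 e, h]; simp
  refine ⟨Nat.find hex, Nat.find_spec hex, ?_⟩
  have hU : uni ℤ V ≠ 0 := by
    intro h; apply hV; ext e; rw [ext1 e, ← coeff_uni, h]; simp
  refine one_var (uni ℤ V) hU B r ?_ ?_ β _ ?_
  · refine hr (Finsupp.single 0 (uni ℤ V).natDegree) ?_ |>.trans' (by simp)
    rw [← coeff_uni]
    exact Polynomial.leadingCoeff_ne_zero.2 hU
  · intro j
    rw [coeff_uni, ← nuZ_apply]
    exact (coeff_le_L1 _ _ _).trans hB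
  · have h1 : uni K (Tr (fun _ => β) V) = ((uni ℤ V).map (Int.castRingHom K)).comp (Polynomial.X + Polynomial.C β) := by
      have : (uni K).comp (Tr (R := ℤ) (fun _ => β)) =
          ((Polynomial.compRingHom (Polynomial.X + Polynomial.C β)).comp
            (Polynomial.mapRingHom (Int.castRingHom K))).comp (uni ℤ) := by
        apply MvPolynomial.ringHom_ext
        · intro a; simp [uni, Tr]
        · intro i; simp [uni, Tr]
      exact RingHom.congr_fun this V
    have h2 : Polynomial.X ^ (Nat.find hex) ∣ uni K (Tr (fun _ => β) V) := by
      rw [Polynomial.X_pow_dvd_iff]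
      intro d hd
      rw [coeff_uni]
      exact not_not.1 (Nat.find_min hex hd)
    obtain ⟨G, hG⟩ := h2
    refine ⟨G.comp (Polynomial.X - Polynomial.C β), ?_⟩
    have := congrArg (fun p => Polynomial.comp p (Polynomial.X - Polynomial.C β)) (h1.symm.trans hG)
    simpa [Polynomial.comp_assoc, Polynomial.mul_comp] using this
lemma L1_hs {m : ℕ} (P : MvPolynomial (Fin m) ℤ) (s : Fin m →₀ ℕ) (R : ℝ)
    (h : ∀ e, coeff e P ≠ 0 → ((∑ i, e i : ℕ) : ℝ) ≤ R) : L1 nuZ (hs s P) ≤ Real.exp R * L1 nuZ P := by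
  classical
  have hinj : Set.InjOn (fun e => e + s) (hs s P).support := fun a _ b _ hab => by simpa using hab
  rw [L1, L1, Finset.mul_sum]
  have hsub : (hs s P).support.image (fun e => e + s) ⊆ P.support := by
    intro e he
    obtain ⟨f, hf, rfl⟩ := Finset.mem_image.1 he
    rw [mem_support_iff, coeff_hs] at hf
    exact mem_support_iff.2 (right_ne_zero_of_mul hf)
  refine le_trans ?_ (Finset.sum_le_sum_of_subset_of_nonneg hsub fun e _ _ =>
    mul_nonneg (Real.exp_nonneg _) (nuZ.nonneg _))
  rw [Finset.sum_image hinj]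
  refine Finset.sum_le_sum fun e he => ?_
  rw [mem_support_iff, coeff_hs] at he
  rw [coeff_hs, map_mul]
  refine mul_le_mul_of_nonneg_right ?_ (nuZ.nonneg _)
  have hd := h _ (right_ne_zero_of_mul he)
  rw [nuZ_apply]
  push_cast
  rw [Nat.abs_cast]
  have h1 : bn e s ≤ 2 ^ (∑ i, (e + s) i) := by
    rw [← Finset.prod_pow_eq_pow_sum]
    exact Finset.prod_le_prod' fun i _ => by
      rw [Finsupp.add_apply]; exact Nat.choose_le_two_pow _ _
  have h2 : (bn e s : ℝ) ≤ (Real.exp 1) ^ (∑ i, (e + s) i) := by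
    refine (Nat.cast_le.2 h1).trans ?_
    push_cast
    exact pow_le_pow_left₀ (by norm_num) (by have := Real.add_one_le_exp 1; linarith) _
  rw [← Real.exp_nat_mul, mul_one] at h2
  exact h2.trans (Real.exp_le_exp.2 hd)
lemma count_low (k r : ℕ) (hr : 1 ≤ r) (hk : k ≤ r + 1) (θ : ℝ) (h0 : 0 < θ) (h1 : θ ≤ 1) :
    k * θ ^ 2 / 8 ≤ ∑ j : Fin k, max 0 (θ - (j : ℕ) / r) := by
  have hr' : (0:ℝ) < r := by exact_mod_cast hr
  rw [Fin.sum_univ_eq_sum_range (fun j => max 0 (θ - (j : ℝ) / r)) k]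
  set N := min k (⌊θ * r / 2⌋₊ + 1)
  have hN : (k : ℝ) * θ / 4 ≤ N := by
    simp only [N, Nat.cast_min, le_min_iff]
    have hkr : (k : ℝ) ≤ 2 * r := by
      have : k ≤ 2 * r := by omega
      exact_mod_cast this
    constructor
    · nlinarith [(Nat.cast_nonneg k : (0:ℝ) ≤ k)]
    · have := Nat.lt_floor_add_one (θ * r / 2)
      push_cast
      nlinarith
  have h2 : ∑ j ∈ Finset.range N, θ / 2 ≤ ∑ j ∈ Finset.range N, max 0 (θ - (j : ℝ) / r) := by
    refine Finset.sum_le_sum fun j hj => le_max_of_le_right ?_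
    have hj' : j ≤ ⌊θ * r / 2⌋₊ := by
      have := Finset.mem_range.1 hj
      have h3 : N ≤ ⌊θ * r / 2⌋₊ + 1 := min_le_right _ _
      omega
    have h4 : (j : ℝ) ≤ θ * r / 2 := (Nat.cast_le.2 hj').trans (Nat.floor_le (by positivity))
    have : (j : ℝ) / r ≤ θ / 2 := by rw [div_le_iff₀ hr']; linarith
    linarith
  have h3 := Finset.sum_le_sum_of_subset_of_nonneg (f := fun j : ℕ => max 0 (θ - (j : ℝ) / r))
    (Finset.range_subset_range.2 (min_le_left k (⌊θ * r / 2⌋₊ + 1))) (fun _ _ _ => le_max_left _ _)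
  rw [Finset.sum_const, Finset.card_range, nsmul_eq_mul] at h2
  nlinarith
end
open MvPolynomial Height
section
variable {K : Type*} [Field K] [NumberField K]
lemma split_W (K : Type*) [Field K] [NumberField K] {m : ℕ} (P : MvPolynomial (Fin (m+1)) ℤ) (hP : P ≠ 0) (r : ℕ)
    (hr : ∀ e, coeff e P ≠ 0 → e 0 ≤ r) :
    ∃ k, 1 ≤ k ∧ k ≤ r + 1 ∧ ∃ (s : Fin k → Fin m →₀ ℕ) (c : Fin k → Fin k),
      (∀ a, ∑ i, s a i ≤ k - 1) ∧ Function.Bijective c ∧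
      ∃ (U : MvPolynomial (Fin m) K) (V : MvPolynomial (Fin 1) K), U ≠ 0 ∧ V ≠ 0 ∧
        map (algebraMap ℤ K) (Matrix.of fun a b => hs (Finsupp.cons (c b : ℕ) (s a)) P).det = tens U V := by
  have hPK : map (algebraMap ℤ K) P ≠ 0 := by
    intro h; apply hP
    exact map_injective _ (RingHom.injective_int (algebraMap ℤ K)) (by rw [h, map_zero])
  obtain ⟨k, hk1, hk2, φ, ψ, hφ, hψ, hsum⟩ := tens_rank (map (algebraMap ℤ K) P) hPK r (by
    intro e he; apply hr e; intro h; apply he; rw [coeff_map, h, map_zero])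
  obtain ⟨s, hs1, hs2⟩ := wronsk φ hφ
  obtain ⟨c, hc1, hc2⟩ := wronsk ψ hψ
  have hck : ∀ b, c b 0 < k := fun b => by
    have := hc1 b; simp at this; omega
  refine ⟨k, hk1, hk2, s, fun b => ⟨c b 0, hck b⟩, hs1, ?_, _, _, hs2, hc2, ?_⟩
  · apply Function.Injective.bijective_of_finite
    intro a b hab
    by_contra hne
    apply hc2
    apply Matrix.det_zero_of_row_eq hne
    have : c a = c b := by rw [ext1 (c a), ext1 (c b)]; simp at hab; rw [hab]
    ext j; simp [this]
  · rw [tens, RingHom.map_det]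
    rw [AlgHom.map_det, AlgHom.map_det, ← Matrix.det_transpose (((rename fun _ => 0) : MvPolynomial (Fin 1) K →ₐ[K] _).mapMatrix _), ← Matrix.det_mul]
    congr 1
    ext1 a b
    simp only [RingHom.mapMatrix_apply, Matrix.map_apply, Matrix.of_apply, AlgHom.mapMatrix_apply, Matrix.mul_apply, Matrix.transpose_apply]
    rw [← hs_map, hsum, hs_sum]
    refine Finset.sum_congr rfl fun i _ => ?_
    rw [hs_tens]
    simp only [Finsupp.cons_zero, Finsupp.tail_cons, ← ext1]
    rfl
set_option maxHeartbeats 1000000 in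
theorem roth_lemma (K : Type*) [Field K] [NumberField K] (m : ℕ) : ∀ ε : ℝ, 0 < ε → ∃ C : ℝ, 1 ≤ C ∧ ∃ σ : ℝ, 0 < σ ∧
    ∀ (r : Fin m → ℕ) (β : Fin m → K) (P : MvPolynomial (Fin m) ℤ) (B R : ℝ), P ≠ 0 →
      (∀ e, coeff e P ≠ 0 → ∀ h, e h ≤ r h) → (∀ h, 1 ≤ r h) →
      (∀ h h', h < h' → (r h : ℝ) ≤ σ * r h') → 0 ≤ B → L1 nuZ P ≤ Real.exp B → (∀ h, (r h : ℝ) ≤ R) →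
      (∀ h, C * (B + R) ≤ r h * logHeight₁ (β h)) →
      ∃ s, coeff s (Tr β P) ≠ 0 ∧ ∑ h, (s h : ℝ) * (r h : ℝ)⁻¹ ≤ ε := by
  induction m with
  | zero =>
    intro ε hε
    refine ⟨1, le_rfl, 1, one_pos, fun r β P B R hP _ _ _ _ _ _ _ => ?_⟩
    have := Tr_ne_zero (RingHom.injective_int (algebraMap ℤ K)) β hP
    obtain ⟨s, hs⟩ := MvPolynomial.ne_zero_iff.1 this
    exact ⟨s, hs, by simpa using hε.le⟩
  | succ m ih =>
    intro ε0 hε0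
    set ε := min ε0 1 with hεd
    have hε : 0 < ε := lt_min hε0 one_pos
    have hε1 : ε ≤ 1 := min_le_right _ _
    set ε' := ε ^ 2 / 200 with hε'
    have hε'0 : 0 < ε' := by positivity
    obtain ⟨C', hC'1, σ', hσ', H⟩ := ih ε' hε'0
    set d : ℝ := ((Module.finrank ℚ K : ℕ) : ℝ)
    have hdp : 0 < d := Nat.cast_pos.2 Module.finrank_pos
    have hd : 0 ≤ d := hdp.le
    refine ⟨C' * (m+3) + d * (m+3) / ε', ?_, min σ' (ε/2), by positivity, ?_⟩
    · have : 0 ≤ d * (m+3) / ε' := by positivity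
      have : (0:ℝ) ≤ m := Nat.cast_nonneg _
      nlinarith
    intro r β P B R hP hdeg hr1 hlac hB hPB hR hβ
    by_contra! hcon
    set w : Fin (m+1) → ℝ := fun h => (r h : ℝ)⁻¹ with hw
    have hTP : wge w ε (Tr β P) := fun s hs => (min_le_left _ _).trans (hcon s hs).le
    have hr0 : (1:ℝ) ≤ r 0 := by exact_mod_cast hr1 0
    have hrp : ∀ h, (0:ℝ) < r h := fun h => by exact_mod_cast hr1 h
    have hR1 : 1 ≤ R := hr0.trans (hR 0)
    obtain ⟨k, hk1, hk2, s, c, hsd, hc, U', V', hU', hV', hW⟩ := split_W K P hP (r 0) (fun e he => hdeg e he 0)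
    set W := (Matrix.of fun a b => hs (Finsupp.cons (c b : ℕ) (s a)) P).det with hWd
    have hk0 : (1:ℝ) ≤ k := by exact_mod_cast hk1
    -- lower bound
    set θ := ε / 2
    have hlow : wge w (∑ j : Fin k, max 0 (θ - (c j : ℕ) / r 0)) (Tr β W) := by
      rw [hWd, RingHom.map_det]
      refine wge_det _ _ fun a b => ?_
      simp only [RingHom.mapMatrix_apply, Matrix.map_apply, Matrix.of_apply]
      rw [← hs_Tr]
      intro e he
      rw [coeff_hs] at he
      have h1 := hTP _ (right_ne_zero_of_mul he)
      simp only [Finsupp.add_apply, Nat.cast_add, add_mul, Finset.sum_add_distrib] at h1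
      have h0 : 0 ≤ ∑ i, (e i : ℝ) * w i := Finset.sum_nonneg fun i _ => by simp only [hw]; positivity
      have h2 : ∑ i, ((Finsupp.cons (c b : ℕ) (s a) : Fin (m+1) →₀ ℕ) i : ℝ) * w i ≤ (c b : ℕ) / r 0 + ε / 2 := by
        rw [Fin.sum_univ_succ]
        simp only [Finsupp.cons_zero, Finsupp.cons_succ]
        have h3 : ∑ i : Fin m, (s a i : ℝ) * w i.succ ≤ ∑ i : Fin m, (s a i : ℝ) * ((ε/2) * (r 0 : ℝ)⁻¹) := by
          refine Finset.sum_le_sum fun i _ => mul_le_mul_of_nonneg_left ?_ (Nat.cast_nonneg _)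
          have h4 := hlac 0 i.succ (Fin.succ_pos i)
          have h5 : (r 0 : ℝ) ≤ ε/2 * r i.succ := h4.trans (mul_le_mul_of_nonneg_right (min_le_right _ _) (hrp _).le)
          simp only [hw]
          rw [inv_eq_one_div, div_le_iff₀ (hrp _)]
          have : ε / 2 * (r 0 : ℝ)⁻¹ * r i.succ = (ε/2 * r i.succ) / r 0 := by ring
          rw [this, le_div_iff₀ (hrp _)]; linarith
        rw [← Finset.sum_mul] at h3
        have h6 : (∑ i : Fin m, (s a i : ℝ)) ≤ r 0 := by
          have := hsd a
          have : ∑ i, s a i ≤ r 0 := by omega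
          exact_mod_cast this
        have h7 : (∑ i : Fin m, (s a i : ℝ)) * (ε / 2 * (r 0 : ℝ)⁻¹) ≤ r 0 * (ε / 2 * (r 0 : ℝ)⁻¹) :=
          mul_le_mul_of_nonneg_right h6 (by positivity)
        have h8 : r 0 * (ε / 2 * (r 0 : ℝ)⁻¹) = ε / 2 := by field_simp
        have h9 : ((c b : ℕ) : ℝ) * w 0 = (c b : ℕ) / r 0 := by simp only [hw]; rw [div_eq_mul_inv]
        rw [h9]; linarith
      refine max_le h0 ?_
      simp only [θ]; linarith
    have hsum : ∑ j : Fin k, max 0 (θ - (c j : ℕ) / r 0) = ∑ j : Fin k, max 0 (θ - (j : ℕ) / r 0) :=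
      hc.sum_comp (fun j : Fin k => max 0 (θ - (j : ℕ) / (r 0 : ℝ)))
    have hcl := count_low k (r 0) (hr1 0) hk2 θ (by positivity) (by simp only [θ]; linarith)
    -- size of W
    have hsize : L1 nuZ W ≤ Real.exp (k * (B + (m+2) * R)) := by
      have h1 : ∀ a b, L1 nuZ ((Matrix.of fun a b => hs (Finsupp.cons (c b : ℕ) (s a)) P) a b) ≤
          Real.exp (B + (m+1) * R) := by
        intro a b
        refine (L1_hs P _ ((m+1)*R) ?_).trans ?_
        · intro e he
          push_cast
          refine (Finset.sum_le_sum (fun i _ => (Nat.cast_le.2 (hdeg e he i)).trans (hR i))).trans ?_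
          simp
        · rw [add_comm B, Real.exp_add]
          exact mul_le_mul_of_nonneg_left hPB (Real.exp_nonneg _)
      refine (L1_det nuZ _ _ h1).trans ?_
      have h2 : (k.factorial : ℝ) ≤ Real.exp R ^ k := by
        have : (k.factorial : ℝ) ≤ (k:ℝ) ^ k := by exact_mod_cast Nat.factorial_le_pow k
        refine this.trans (pow_le_pow_left₀ (by positivity) ?_ _)
        have h3 : (k:ℝ) ≤ r 0 + 1 := by exact_mod_cast hk2
        have := Real.add_one_le_exp R
        have := hR 0
        linarith
      refine (mul_le_mul_of_nonneg_right h2 (by positivity)).trans ?_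
      rw [← mul_pow, ← Real.exp_add, ← Real.exp_nat_mul]
      apply le_of_eq; congr 1; ring
    have hWdeg : ∀ e, coeff e W ≠ 0 → ∀ h, e h ≤ k * r h := by
      intro e he h
      have h1 : wge (fun i => if i = h then (-1:ℝ) else 0) (∑ j : Fin k, -(r h : ℝ)) W := by
        refine wge_det _ _ fun a b => ?_
        intro f hf
        simp only [Matrix.of_apply, coeff_hs] at hf
        have := hdeg _ (right_ne_zero_of_mul hf) h
        simp only [Finsupp.add_apply] at this
        have h2 : f h ≤ r h := by omega
        have h3 : (f h : ℝ) ≤ r h := by exact_mod_cast h2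
        simpa using h3
      have h2 := h1 e he
      simp at h2
      exact_mod_cast h2
    -- slices
    obtain ⟨eV, heV⟩ := MvPolynomial.ne_zero_iff.1 hV'
    obtain ⟨eU, heU⟩ := MvPolynomial.ne_zero_iff.1 hU'
    have hcoef : ∀ e, ((coeff e W : ℤ) : K) = coeff e.tail U' * coeff (Finsupp.single 0 (e 0)) V' := by
      intro e; rw [← coeff_tens, ← hW, coeff_map]; rfl
    classical
    let U : MvPolynomial (Fin m) ℤ := ∑ e ∈ W.support with e 0 = eV 0, monomial e.tail (coeff e W)
    let V : MvPolynomial (Fin 1) ℤ := ∑ e ∈ W.support with e.tail = eU, monomial (Finsupp.single 0 (e 0)) (coeff e W)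
    have hUc : ∀ f, coeff f U = coeff (Finsupp.cons (eV 0) f) W := by
      intro f
      simp only [U, coeff_sum, coeff_monomial]
      rw [Finset.sum_ite, Finset.sum_const_zero, add_zero, Finset.filter_filter]
      have : ∀ e : Fin (m+1) →₀ ℕ, (e 0 = eV 0 ∧ e.tail = f) ↔ e = Finsupp.cons (eV 0) f := by
        intro e; constructor
        · rintro ⟨h1, h2⟩; rw [← h1, ← h2, Finsupp.cons_tail]
        · rintro rfl; simp
      simp only [this, Finset.filter_eq']
      split_ifs with h
      · simp
      · simp [notMem_support_iff.1 h]
    have hVc : ∀ j, coeff (Finsupp.single 0 j) V = coeff (Finsupp.cons j eU) W := by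
      intro f
      simp only [V, coeff_sum, coeff_monomial]
      rw [Finset.sum_ite, Finset.sum_const_zero, add_zero, Finset.filter_filter]
      have : ∀ e : Fin (m+1) →₀ ℕ, (e.tail = eU ∧ (Finsupp.single 0 (e 0) : Fin 1 →₀ ℕ) = Finsupp.single 0 f) ↔ e = Finsupp.cons f eU := by
        intro e; constructor
        · rintro ⟨h1, h2⟩
          have h2 : e 0 = f := by simpa using DFunLike.congr_fun h2 0
          rw [← h1, ← h2, Finsupp.cons_tail]
        · rintro rfl; simp
      simp only [this, Finset.filter_eq']
      split_ifs with h
      · simp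
      · simp [notMem_support_iff.1 h]
    have hUK : map (algebraMap ℤ K) U = C (coeff eV V') * U' := by
      ext f; rw [coeff_map, hUc, coeff_C_mul, algebraMap_int_eq, eq_intCast, hcoef, mul_comm]
      simp [← ext1]
    have hVK : map (algebraMap ℤ K) V = C (coeff eU U') * V' := by
      ext f; rw [coeff_map, ext1 f, hVc, coeff_C_mul, algebraMap_int_eq, eq_intCast, hcoef]
      simp
    have hU0 : U ≠ 0 := by
      intro h; rw [h, map_zero] at hUK
      exact mul_ne_zero (C_ne_zero.2 heV) hU' hUK.symm
    have hV0 : V ≠ 0 := by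
      intro h; rw [h, map_zero] at hVK
      exact mul_ne_zero (C_ne_zero.2 heU) hV' hVK.symm
    have hUL : L1 nuZ U ≤ L1 nuZ W := by
      refine (L1_sum _ _ _).trans ?_
      simp only [L1_monomial]
      exact Finset.sum_le_sum_of_subset_of_nonneg (Finset.filter_subset _ _) fun _ _ _ => nuZ.nonneg _
    have hVL : L1 nuZ V ≤ L1 nuZ W := by
      refine (L1_sum _ _ _).trans ?_
      simp only [L1_monomial]
      exact Finset.sum_le_sum_of_subset_of_nonneg (Finset.filter_subset _ _) fun _ _ _ => nuZ.nonneg _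
    have hCd : 0 ≤ d * (m+3) / ε' := by positivity
    have hBR : k * (B + (m+2) * R) + k * R ≤ k * ((m+3) * (B + R)) := by
      have : 0 ≤ (m:ℝ) * B := by positivity
      nlinarith
    have hBR0 : 0 < B + R := by linarith
    obtain ⟨sU, hsU, hsU2⟩ := H (fun h => k * r h.succ) (fun h => β h.succ) U (k * (B + (m+2) * R)) (k * R) hU0
      (fun e he h => by rw [hUc] at he; simpa using hWdeg _ he h.succ)
      (fun h => Nat.mul_pos hk1 (hr1 _))
      (fun h h' hh => by
        push_cast
        have := hlac h.succ h'.succ (Fin.succ_lt_succ_iff.2 hh)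
        have h2 : (r h.succ : ℝ) ≤ σ' * r h'.succ := this.trans (mul_le_mul_of_nonneg_right (min_le_left _ _) (hrp _).le)
        nlinarith)
      (by positivity) (hUL.trans hsize)
      (fun h => by push_cast; exact mul_le_mul_of_nonneg_left (hR _) (by positivity))
      (fun h => by
        push_cast
        have h1 := hβ h.succ
        have h2 : C' * (k * (B + (m+2) * R) + k * R) ≤ C' * (k * ((m+3) * (B + R))) :=
          mul_le_mul_of_nonneg_left hBR (by linarith)
        have h3 : C' * ((m+3) * (B+R)) ≤ r h.succ * logHeight₁ (β h.succ) := by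
          refine le_trans ?_ h1
          nlinarith [mul_nonneg hCd hBR0.le]
        nlinarith)
    obtain ⟨sV, hsV, hsV2⟩ := one_var' V hV0 (k * (B + (m+2) * R)) (k * R)
      (fun e he => by
        rw [ext1 e, hVc] at he
        have h1 := hWdeg _ he 0
        rw [Finsupp.cons_zero] at h1
        have h2 : (e 0 : ℝ) ≤ k * r 0 := by exact_mod_cast h1
        exact h2.trans (mul_le_mul_of_nonneg_left (hR 0) (by positivity)))
      (by positivity) (hVL.trans hsize) (β 0)
    have hsV3 : (sV : ℝ) * w 0 ≤ k * ε' := by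
      have h1 := hβ 0
      have h2 : (sV : ℝ) * logHeight₁ (β 0) ≤ d * (k * ((m+3) * (B+R))) := hsV2.trans (mul_le_mul_of_nonneg_left hBR hd)
      have h3 : d * (m+3) / ε' * (B+R) ≤ r 0 * logHeight₁ (β 0) := by
        refine le_trans ?_ h1
        have : 0 ≤ C' * (m+3) * (B+R) := by positivity
        nlinarith
      simp only [hw]
      rw [← div_eq_mul_inv, div_le_iff₀ (hrp 0)]
      have hh : 0 ≤ logHeight₁ (β 0) := zero_le_logHeight₁ _
      have h4 : d * (m+3) * (B+R) ≤ ε' * (r 0 * logHeight₁ (β 0)) := by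
        have h5 := mul_le_mul_of_nonneg_left h3 hε'0.le
        have h6 : ε' * (d * (m+3) / ε' * (B+R)) = d * (m+3) * (B+R) := by field_simp
        linarith
      have h5 : 0 < d * (m+3) * (B+R) := by positivity
      have hhp : 0 < logHeight₁ (β 0) := by
        rcases hh.eq_or_lt with h | h
        · rw [← h] at h4; simp at h4; linarith
        · exact h
      refine le_of_mul_le_mul_right ?_ hhp
      calc (sV : ℝ) * logHeight₁ (β 0) ≤ k * (d * (m+3) * (B+R)) := by linarith
        _ ≤ k * (ε' * (r 0 * logHeight₁ (β 0))) := mul_le_mul_of_nonneg_left h4 (by positivity)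
        _ = _ := by ring
    -- conclusion
    have hU1 : coeff sU (Tr (fun i => β i.succ) U') ≠ 0 := by
      intro h; apply hsU
      rw [← Tr_map (S := K), hUK, map_mul]
      have : Tr (fun i : Fin m => β i.succ) (C (coeff eV V')) = C (coeff eV V') := by simp [Tr]
      rw [this, coeff_C_mul, h, mul_zero]
    have hV1 : coeff (Finsupp.single 0 sV) (Tr (fun _ => β 0) V') ≠ 0 := by
      intro h; apply hsV
      rw [← Tr_map (S := K), hVK, map_mul]
      have : Tr (fun _ : Fin 1 => β 0) (C (coeff eU U')) = C (coeff eU U') := by simp [Tr]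
      rw [this, coeff_C_mul, h, mul_zero]
    have hfin := hlow (Finsupp.cons sV sU) (by
      rw [← Tr_map (S := K), hW, Tr_tens, coeff_tens]
      simpa using ⟨hU1, hV1⟩)
    rw [hsum, Fin.sum_univ_succ] at hfin
    simp only [Finsupp.cons_zero, Finsupp.cons_succ] at hfin
    have hU3 : ∑ i : Fin m, (sU i : ℝ) * w i.succ ≤ k * ε' := by
      have h1 := mul_le_mul_of_nonneg_left hsU2 (by positivity : (0:ℝ) ≤ k)
      refine le_trans (le_of_eq ?_) h1
      rw [Finset.mul_sum]
      refine Finset.sum_congr rfl fun i _ => ?_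
      simp only [hw]; push_cast
      have := hrp i.succ
      field_simp
    have : (k:ℝ) * θ^2/8 ≤ 2 * (k * ε') := by linarith
    have h9 : (k:ℝ) * (θ^2/8 - 2*ε') ≤ 0 := by linarith
    have h10 : θ^2/8 - 2*ε' = ε^2 * (1/32 - 1/100) := by simp only [θ, hε']; ring
    rw [h10] at h9
    have : 0 < (k:ℝ) * (ε^2 * (1/32 - 1/100)) := by positivity
    linarith
end
open MvPolynomial
section
variable {m n : ℕ}
def Ex (r : Fin m → ℕ) : Finset (Fin m → Fin n → ℕ) :=
  Fintype.piFinset fun h => Finset.piAntidiag Finset.univ (r h)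
lemma mem_Ex {r : Fin m → ℕ} {J : Fin m → Fin n → ℕ} : J ∈ Ex r ↔ ∀ h, ∑ i, J h i = r h := by
  simp [Ex, Fintype.mem_piFinset]
lemma sum_anti (hn : 1 ≤ n) (r : ℕ) (i : Fin n) :
    (∑ s ∈ Finset.piAntidiag (Finset.univ : Finset (Fin n)) r, (s i : ℝ)) =
      r / n * (Finset.piAntidiag (Finset.univ : Finset (Fin n)) r).card := by
  have h : ∀ j, (∑ s ∈ Finset.piAntidiag (Finset.univ : Finset (Fin n)) r, (s j : ℝ)) =
      ∑ s ∈ Finset.piAntidiag (Finset.univ : Finset (Fin n)) r, (s i : ℝ) := by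
    intro j
    refine Finset.sum_bij' (fun s _ => s ∘ Equiv.swap i j) (fun s _ => s ∘ Equiv.swap i j) ?_ ?_ ?_ ?_ ?_
    · intro s hs; simp at hs ⊢; rw [← hs]; exact Equiv.sum_comp (Equiv.swap i j) s
    · intro s hs; simp at hs ⊢; rw [← hs]; exact Equiv.sum_comp (Equiv.swap i j) s
    · intro s hs; ext; simp
    · intro s hs; ext; simp
    · intro s hs; simp
  have h2 : ∑ j, (∑ s ∈ Finset.piAntidiag (Finset.univ : Finset (Fin n)) r, (s j : ℝ)) =
      r * (Finset.piAntidiag (Finset.univ : Finset (Fin n)) r).card := by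
    rw [Finset.sum_comm, Finset.sum_congr rfl (g := fun _ => (r:ℝ))]
    · simp [mul_comm]
    · intro s hs; simp at hs; exact_mod_cast hs
  rw [Finset.sum_congr rfl fun j _ => h j] at h2
  simp at h2
  have : (0:ℝ) < n := by exact_mod_cast hn
  field_simp; linarith
lemma cheb (hn : 1 ≤ n) (r : Fin m → ℕ) (hr : ∀ h, 1 ≤ r h) (i : Fin n) :
    ∑ J ∈ Ex (n := n) r, (∑ h, ((J h i : ℝ) / r h - 1 / n)) ^ 2 ≤ m * (Ex (n := n) r).card := by
  classical
  have hrp : ∀ h, (0:ℝ) < r h := fun h => by exact_mod_cast hr h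
  let f : Fin m → (Fin n → ℕ) → ℝ := fun h s => (s i : ℝ) / r h - 1 / n
  have hf0 : ∀ h, ∑ s ∈ Finset.piAntidiag Finset.univ (r h), f h s = 0 := by
    intro h
    simp only [f, Finset.sum_sub_distrib, ← Finset.sum_div, sum_anti hn]
    have : (0:ℝ) < n := by exact_mod_cast hn
    have := hrp h
    simp; field_simp; simp
  have hcross : ∀ h h', h ≠ h' → ∑ J ∈ Ex (n := n) r, f h (J h) * f h' (J h') = 0 := by
    intro h h' hne
    let g : Fin m → (Fin n → ℕ) → ℝ := fun l s => if l = h then f h s else if l = h' then f h' s else 1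
    have h1 : ∀ J : Fin m → Fin n → ℕ, ∏ l, g l (J l) = f h (J h) * f h' (J h') := by
      intro J
      rw [← Finset.mul_prod_erase _ _ (Finset.mem_univ h), ← Finset.mul_prod_erase _ _ (Finset.mem_erase.2 ⟨hne.symm, Finset.mem_univ h'⟩),
        Finset.prod_eq_one]
      · simp [g, hne.symm]
      · intro l hl; simp at hl; simp [g, hl]
    rw [← Finset.sum_congr rfl fun J _ => h1 J, Ex, ← Finset.prod_univ_sum]
    refine Finset.prod_eq_zero (Finset.mem_univ h) ?_
    simpa [g] using hf0 h
  have hexp : ∀ J : Fin m → Fin n → ℕ, (∑ h, ((J h i : ℝ) / r h - 1 / n)) ^ 2 =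
      ∑ h, ∑ h', f h (J h) * f h' (J h') := by
    intro J; rw [sq, Finset.sum_mul_sum]
  rw [Finset.sum_congr rfl fun J _ => hexp J, Finset.sum_comm]
  have : ∀ h ∈ (Finset.univ : Finset (Fin m)), ∑ J ∈ Ex (n := n) r, ∑ h', f h (J h) * f h' (J h') ≤ (Ex (n := n) r).card := by
    intro h _
    rw [Finset.sum_comm, Finset.sum_eq_single h]
    · have : ∀ J ∈ Ex (n := n) r, f h (J h) * f h (J h) ≤ 1 := by
        intro J hJ
        have h1 : J h i ≤ r h := by
          rw [← mem_Ex.1 hJ h]; exact Finset.single_le_sum (f := J h) (fun _ _ => Nat.zero_le _) (Finset.mem_univ i)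
        have h2 : (J h i : ℝ) / r h ≤ 1 := by
          rw [div_le_one (hrp h)]; exact_mod_cast h1
        have h3 : 0 ≤ (J h i : ℝ) / r h := by positivity
        have h4 : (1:ℝ)/n ≤ 1 := by
          rw [div_le_one (by exact_mod_cast hn)]; exact_mod_cast hn
        have h5 : 0 ≤ (1:ℝ)/n := by positivity
        have : |f h (J h)| ≤ 1 := by rw [abs_le]; constructor <;> simp only [f] <;> linarith
        rw [← sq, ← sq_abs]; exact pow_le_one₀ (abs_nonneg _) this
      refine (Finset.sum_le_card_nsmul _ _ _ this).trans ?_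
      simp
    · intro h' _ hne; exact hcross h h' hne.symm
    · simp
  refine (Finset.sum_le_card_nsmul _ _ _ this).trans ?_
  simp
lemma bad_card (hn : 1 ≤ n) (r : Fin m → ℕ) (hr : ∀ h, 1 ≤ r h) (i : Fin n) (ε : ℝ) (hε : 0 < ε) :
    m * ε ^ 2 * ((Ex (n := n) r).filter fun J => ∑ h, (J h i : ℝ) / r h < m * (1 / n - ε)).card ≤ (Ex (n := n) r).card := by
  classical
  rcases Nat.eq_zero_or_pos m with rfl | hm
  · simp
  have hm' : (0:ℝ) < m := by exact_mod_cast hm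
  have h := cheb hn r hr i
  have h2 : ((Ex (n := n) r).filter fun J => ∑ h, (J h i : ℝ) / r h < m * (1 / n - ε)).card * (m * ε)^2 ≤
      ∑ J ∈ Ex (n := n) r, (∑ h, ((J h i : ℝ) / r h - 1 / n)) ^ 2 := by
    refine le_trans ?_ (Finset.sum_le_sum_of_subset_of_nonneg (Finset.filter_subset (fun J => ∑ h, (J h i : ℝ) / r h < m * (1 / n - ε)) _) fun _ _ _ => sq_nonneg _)
    rw [← nsmul_eq_mul]
    refine Finset.card_nsmul_le_sum _ _ _ fun J hJ => ?_
    have := (Finset.mem_filter.1 hJ).2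
    rw [Finset.sum_sub_distrib]
    simp only [Finset.sum_const, Finset.card_univ, Fintype.card_fin, nsmul_eq_mul]
    rw [← neg_sq (∑ x, (J x i : ℝ) / r x - _)]
    apply pow_le_pow_left₀ (by positivity)
    linarith
  have h3 := h2.trans h
  refine le_of_mul_le_mul_left ?_ hm'
  calc _ = _ := by ring
    _ ≤ _ := h3
lemma card_Ex_le (r : Fin m → ℕ) : ((Ex (n := n) r).card : ℝ) ≤ Real.exp (n * ∑ h, (r h : ℝ)) := by
  rw [Ex, Fintype.card_piFinset, Finset.mul_sum, Real.exp_sum]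
  push_cast
  refine Finset.prod_le_prod (fun _ _ => by positivity) fun h _ => ?_
  have h1 : Finset.piAntidiag (Finset.univ : Finset (Fin n)) (r h) ⊆ Fintype.piFinset fun _ => Finset.range (r h + 1) := by
    intro s hs
    simp at hs ⊢
    intro i; rw [← hs]; exact Finset.single_le_sum (f := s) (fun _ _ => Nat.zero_le _) (Finset.mem_univ i)
  have h2 := Finset.card_le_card h1
  simp at h2
  have h3 : ((Finset.piAntidiag (Finset.univ : Finset (Fin n)) (r h)).card : ℝ) ≤ ((r h : ℝ) + 1) ^ n := by exact_mod_cast h2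
  refine h3.trans ?_
  rw [Real.exp_nat_mul]
  exact pow_le_pow_left₀ (by positivity) (Real.add_one_le_exp _) _
end
open MvPolynomial
lemma siegel {α β : Type*} [Fintype α] [Fintype β] (A : Matrix α β ℤ) (b : ℝ) (hb : 1 ≤ b)
    (hA : ∀ i j, |(A i j : ℝ)| ≤ b) (hc : 2 * Fintype.card α ≤ Fintype.card β) (hβ : 0 < Fintype.card β) :
    ∃ t : β → ℤ, t ≠ 0 ∧ A *ᵥ t = 0 ∧ ∀ j, |(t j : ℝ)| ≤ Fintype.card β * b := by
  classical
  have hN : (1:ℝ) ≤ Fintype.card β := by exact_mod_cast hβ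
  rcases Nat.eq_zero_or_pos (Fintype.card α) with h0 | h0
  · haveI := Fintype.card_eq_zero_iff.1 h0
    haveI := Fintype.card_pos_iff.1 hβ
    obtain ⟨j⟩ := this
    refine ⟨Pi.single j 1, by simp, Subsingleton.elim _ _, fun l => ?_⟩
    have : |((Pi.single j (1:ℤ) : β → ℤ) l : ℝ)| ≤ 1 := by
      rcases eq_or_ne l j with rfl | h
      · simp
      · simp [h]
    nlinarith
  · obtain ⟨t, ht0, ht1, ht2⟩ := Int.Matrix.exists_ne_zero_int_vec_norm_le A (by omega) h0
    refine ⟨t, ht0, ht1, fun j => ?_⟩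
    have h1 := (norm_le_pi_norm t j).trans ht2
    rw [Int.norm_eq_abs] at h1
    refine h1.trans ?_
    have hAn := (Matrix.norm_le_iff (A := A) (zero_le_one.trans hb)).2 (fun i j => by rw [Int.norm_eq_abs]; exact hA i j)
    have hbase := mul_le_mul_of_nonneg_left (max_le hb hAn) (zero_le_one.trans hN)
    refine le_trans ?_ hbase
    refine le_trans (Real.rpow_le_rpow_of_exponent_le (y := _) (z := 1) ?_ ?_) (by rw [Real.rpow_one])
    · exact one_le_mul_of_one_le_of_one_le hN (le_max_left _ _)
    · have : (2:ℝ) * Fintype.card α ≤ Fintype.card β := by exact_mod_cast hc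
      have h0' : (0:ℝ) < Fintype.card α := by exact_mod_cast h0
      rw [div_le_one (by linarith)]; linarith
section
variable {m n : ℕ}
noncomputable def toE (J : Fin m → Fin n → ℕ) : (Fin m × Fin n) →₀ ℕ :=
  Finsupp.equivFunOnFinite.symm (fun p => J p.1 p.2)
lemma toE_apply (J : Fin m → Fin n → ℕ) (p) : toE J p = J p.1 p.2 := rfl
lemma toE_inj {J J' : Fin m → Fin n → ℕ} (h : toE J = toE J') : J = J' := by
  ext a b; exact DFunLike.congr_fun h (a, b)
lemma toE_surj (e : (Fin m × Fin n) →₀ ℕ) : toE (fun a b => e (a, b)) = e := by ext p; rfl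
noncomputable def lf (A : Matrix (Fin n) (Fin n) ℤ) (p : Fin m × Fin n) : MvPolynomial (Fin m × Fin n) ℤ :=
  ∑ j, C (A p.2 j) * X (p.1, j)
noncomputable def sb (A : Matrix (Fin n) (Fin n) ℤ) : MvPolynomial (Fin m × Fin n) ℤ →ₐ[ℤ] MvPolynomial (Fin m × Fin n) ℤ :=
  aeval (lf A)
lemma sb_mon (A : Matrix (Fin n) (Fin n) ℤ) (e : (Fin m × Fin n) →₀ ℕ) (a : ℤ) :
    sb A (monomial e a) = C a * ∏ p, lf A p ^ e p := by
  rw [sb, aeval_monomial, Finsupp.prod_fintype _ _ (by simp)]; rfl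
lemma L1_pow {σ R : Type*} [CommRing R] [IsDomain R] (ν : AbsoluteValue R ℝ) (P : MvPolynomial σ R) (k : ℕ) :
    L1 ν (P ^ k) ≤ L1 ν P ^ k := by
  have := L1_prod ν (Finset.range k) (fun _ => P)
  simpa using this
lemma L1_sb_mon (A : Matrix (Fin n) (Fin n) ℤ) (a : ℝ) (ha : ∀ i, ∑ j, |(A i j : ℝ)| ≤ a)
    (r : Fin m → ℕ) (J : Fin m → Fin n → ℕ) (hJ : J ∈ Ex r) :
    L1 nuZ (sb A (monomial (toE J) 1)) ≤ a ^ (∑ h, r h) := by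
  rw [sb_mon, C_1, one_mul]
  have h1 : ∀ p : Fin m × Fin n, L1 nuZ (lf A p) ≤ a := by
    intro p
    refine (L1_sum _ _ _).trans (le_trans (Finset.sum_le_sum fun j _ => ?_) (ha p.2))
    refine (L1_mul _ _ _).trans ?_
    rw [L1_C, L1_X]; simp [nuZ_apply]
  refine (L1_prod _ _ _).trans ?_
  refine (Finset.prod_le_prod (fun _ _ => L1_nonneg _ _) fun p _ => (L1_pow _ _ _).trans
    (pow_le_pow_left₀ (L1_nonneg _ _) (h1 p) _)).trans ?_
  rw [Finset.prod_pow_eq_pow_sum, Fintype.sum_prod_type]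
  simp only [toE_apply]
  rw [Finset.sum_congr rfl fun h _ => mem_Ex.1 hJ h]
lemma sb_hom (A : Matrix (Fin n) (Fin n) ℤ) (r : Fin m → ℕ) (P : MvPolynomial (Fin m × Fin n) ℤ)
    (hP : ∀ e, coeff e P ≠ 0 → ∀ h, ∑ i, e (h, i) = r h) :
    ∀ e, coeff e (sb A P) ≠ 0 → ∀ h, ∑ i, e (h, i) = r h := by
  classical
  intro e he h
  have key : ∀ c : ℝ, wge (fun p : Fin m × Fin n => if p.1 = h then c else 0) (c * r h) (sb A P) := by
    intro c
    have hl : ∀ p : Fin m × Fin n, wge (fun p : Fin m × Fin n => if p.1 = h then c else 0) (if p.1 = h then c else 0) (lf A p) := by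
      intro p
      refine wge_sum _ _ fun j _ => ?_
      intro s hs
      rw [coeff_C_mul, coeff_X] at hs
      have : Finsupp.single (p.1, j) 1 = s := by
        by_contra h'; exact hs (by simp [h'])
      rw [← this, Finset.sum_eq_single (p.1, j)]
      · simp
      · intro q _ hq; simp [Finsupp.single_apply, hq.symm]
      · simp
    rw [P.as_sum, map_sum]
    refine wge_sum _ _ fun f hf => ?_
    rw [sb_mon]
    intro s hs
    rw [coeff_C_mul] at hs
    have hw := wge_prod (w := fun p : Fin m × Fin n => if p.1 = h then c else 0) Finset.univ (fun p => lf A p ^ f p)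
      (fun p => f p * (if p.1 = h then c else 0)) (fun p _ => by
        have := wge_prod (w := fun p : Fin m × Fin n => if p.1 = h then c else 0) (Finset.range (f p)) (fun _ => lf A p)
          (fun _ => if p.1 = h then c else 0) (fun _ _ => hl p)
        simpa using this) s (right_ne_zero_of_mul hs)
    refine le_trans (le_of_eq ?_) hw
    rw [← hP f (mem_support_iff.1 hf) h, Fintype.sum_prod_type, Finset.sum_eq_single h]
    · simp [Finset.mul_sum, mul_comm]
    · intro b _ hb; simp [hb]
    · simp
  have hs : ∀ c : ℝ, ∑ p : Fin m × Fin n, (e p : ℝ) * (if p.1 = h then c else 0) = c * (∑ i, e (h, i) : ℕ) := by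
    intro c
    rw [Fintype.sum_prod_type, Finset.sum_eq_single h]
    · simp [Finset.mul_sum, mul_comm]
    · intro b _ hb; simp [hb]
    · simp
  have h1 := key 1 e he
  have h2 := key (-1) e he
  rw [hs] at h1 h2
  have : ((∑ i, e (h, i) : ℕ) : ℝ) = r h := by linarith
  exact_mod_cast this
theorem aux_poly (n q : ℕ) (hn : 1 ≤ n) (A : Fin q → Matrix (Fin n) (Fin n) ℤ) (ε : ℝ) (hε : 0 < ε) :
    ∃ m : ℕ, 1 ≤ m ∧ ∃ D : ℝ, 0 ≤ D ∧ ∀ r : Fin m → ℕ, (∀ h, 1 ≤ r h) →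
      ∃ P : MvPolynomial (Fin m × Fin n) ℤ, P ≠ 0 ∧
        (∀ e, coeff e P ≠ 0 → ∀ h, ∑ i, e (h, i) = r h) ∧
        L1 nuZ P ≤ Real.exp (D * ∑ h, (r h : ℝ)) ∧
        ∀ k, L1 nuZ (sb (A k) P) ≤ Real.exp (D * ∑ h, (r h : ℝ)) ∧
          ∀ e, coeff e (sb (A k) P) ≠ 0 → ∀ i, m * (1 / n - ε) ≤ ∑ h, (e (h, i) : ℝ) / r h := by
  classical
  let m := ⌈2 * q * n / ε ^ 2⌉₊ + 1
  have hm : 2 * q * n ≤ m * ε ^ 2 := by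
    have h1 : 2 * q * n / ε ^ 2 ≤ m := (Nat.le_ceil _).trans (by simp [m])
    rwa [div_le_iff₀ (by positivity)] at h1
  let a0 : ℝ := ∑ k, ∑ i, ∑ j, |(A k i j : ℝ)|
  have ha0 : 0 ≤ a0 := by positivity
  have hA : ∀ k i, ∑ j, |(A k i j : ℝ)| ≤ Real.exp a0 := by
    intro k i
    refine le_trans ?_ (((lt_add_one a0).le).trans (Real.add_one_le_exp a0))
    refine le_trans ?_ (Finset.single_le_sum (f := fun k => ∑ i, ∑ j, |(A k i j : ℝ)|) (fun _ _ => by positivity) (Finset.mem_univ k))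
    exact Finset.single_le_sum (f := fun i => ∑ j, |(A k i j : ℝ)|) (fun _ _ => by positivity) (Finset.mem_univ i)
  refine ⟨m, by simp [m], 2 * n + 2 * a0, by positivity, fun r hr => ?_⟩
  set Sr : ℝ := ∑ h, (r h : ℝ) with hSr
  have hSr0 : 0 ≤ Sr := by positivity
  have hpow : Real.exp a0 ^ (∑ h, r h) = Real.exp (a0 * Sr) := by
    rw [← Real.exp_nat_mul, mul_comm]; push_cast; rfl
  let N := (Ex (n := n) r).card
  let Bad := (Ex (n := n) r).filter fun J => ∃ i, ∑ h, (J h i : ℝ) / r h < m * (1 / n - ε)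
  have hBad : 2 * (q * Bad.card) ≤ N := by
    have h1 : Bad ⊆ Finset.univ.biUnion fun i => (Ex (n := n) r).filter fun J => ∑ h, (J h i : ℝ) / r h < m * (1 / n - ε) := by
      intro J hJ
      obtain ⟨h1, i, h2⟩ := Finset.mem_filter.1 hJ
      exact Finset.mem_biUnion.2 ⟨i, Finset.mem_univ _, Finset.mem_filter.2 ⟨h1, h2⟩⟩
    have h2 := (Finset.card_le_card h1).trans Finset.card_biUnion_le
    have h3 : m * ε ^ 2 * (Bad.card : ℝ) ≤ n * N := by
      have h4 : (Bad.card : ℝ) ≤ ∑ i, (((Ex (n := n) r).filter fun J => ∑ h, (J h i : ℝ) / r h < m * (1 / n - ε)).card : ℝ) := by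
        exact_mod_cast h2
      refine (mul_le_mul_of_nonneg_left h4 (by positivity)).trans ?_
      rw [Finset.mul_sum]
      refine (Finset.sum_le_sum fun i _ => bad_card hn r hr i ε hε).trans ?_
      simp [N]
    have hn' : (0:ℝ) < n := by exact_mod_cast hn
    have h5 : 2 * q * n * (Bad.card : ℝ) ≤ n * N := (mul_le_mul_of_nonneg_right hm (by positivity)).trans h3
    have h6 : 2 * (q * (Bad.card : ℝ)) ≤ N := le_of_mul_le_mul_left (by linarith) hn'
    exact_mod_cast h6
  let M : Matrix (Fin q × Bad) (Ex (n := n) r) ℤ := fun x J => coeff (toE x.2.1) (sb (A x.1) (monomial (toE J.1) 1))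
  have hNpos : 0 < N := Finset.card_pos.2 ⟨fun h i => if i = ⟨0, hn⟩ then r h else 0, by rw [mem_Ex]; intro h; simp⟩
  obtain ⟨t, ht0, ht1, ht2⟩ := siegel M (Real.exp (a0 * Sr)) (Real.one_le_exp (by positivity))
    (fun x J => by
      rw [← nuZ_apply, ← hpow]
      exact (coeff_le_L1 _ _ _).trans (L1_sb_mon (A x.1) _ (hA x.1) r J.1 J.2))
    (by simpa using hBad) (by rw [Fintype.card_coe]; exact hNpos)
  rw [Fintype.card_coe] at ht2
  let P : MvPolynomial (Fin m × Fin n) ℤ := ∑ J : Ex (n := n) r, monomial (toE J.1) (t J)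
  have hPc : ∀ J : Ex (n := n) r, coeff (toE J.1) P = t J := by
    intro J
    simp only [P, coeff_sum, coeff_monomial]
    rw [Finset.sum_eq_single J]
    · simp
    · intro J' _ hne; rw [if_neg]; intro h; exact hne (Subtype.ext (toE_inj h))
    · simp
  have hhom : ∀ e, coeff e P ≠ 0 → ∀ h, ∑ i, e (h, i) = r h := by
    intro e he h
    simp only [P, coeff_sum, coeff_monomial] at he
    obtain ⟨J, _, hJ⟩ := Finset.exists_ne_zero_of_sum_ne_zero he
    have : toE J.1 = e := by by_contra h'; exact hJ (if_neg h')
    rw [← this]; exact mem_Ex.1 J.2 h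
  have hcard : (N : ℝ) ≤ Real.exp (n * Sr) := card_Ex_le r
  have htb : ∑ J : Ex (n := n) r, |(t J : ℝ)| ≤ Real.exp ((2 * n + a0) * Sr) := by
    refine (Finset.sum_le_card_nsmul _ _ _ fun J _ => ht2 J).trans ?_
    rw [Finset.card_univ, Fintype.card_coe, nsmul_eq_mul]
    calc (N:ℝ) * (N * Real.exp (a0 * Sr)) ≤ Real.exp (n * Sr) * (Real.exp (n * Sr) * Real.exp (a0 * Sr)) := by gcongr
      _ = _ := by rw [← Real.exp_add, ← Real.exp_add]; congr 1; ring
  refine ⟨P, ?_, hhom, ?_, fun k => ⟨?_, ?_⟩⟩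
  · intro h
    apply ht0; ext J; rw [← hPc J, h]; simp
  · refine (L1_sum _ _ _).trans ?_
    simp only [L1_monomial, nuZ_apply]
    refine htb.trans (Real.exp_le_exp.2 (mul_le_mul_of_nonneg_right (by linarith) hSr0))
  · have : sb (A k) P = ∑ J : Ex (n := n) r, C (t J) * sb (A k) (monomial (toE J.1) 1) := by
      simp only [P, map_sum]
      refine Finset.sum_congr rfl fun J _ => ?_
      rw [sb_mon, sb_mon, C_1, one_mul]
    rw [this]
    refine (L1_sum _ _ _).trans ?_
    have h1 : ∀ J ∈ (Finset.univ : Finset (Ex (n := n) r)), L1 nuZ (C (t J) * sb (A k) (monomial (toE J.1) 1)) ≤ |(t J : ℝ)| * Real.exp (a0 * Sr) := by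
      intro J _
      refine (L1_mul _ _ _).trans ?_
      rw [L1_C, nuZ_apply, ← hpow]
      exact mul_le_mul_of_nonneg_left (L1_sb_mon (A k) _ (hA k) r J.1 J.2) (abs_nonneg _)
    refine (Finset.sum_le_sum h1).trans ?_
    rw [← Finset.sum_mul]
    refine (mul_le_mul_of_nonneg_right htb (by positivity)).trans ?_
    rw [← Real.exp_add]
    exact Real.exp_le_exp.2 (by linarith)
  · intro e he i
    by_contra! hlt
    have hmem : (fun a b => e (a, b)) ∈ Bad := by
      refine Finset.mem_filter.2 ⟨mem_Ex.2 (sb_hom (A k) r P hhom e he), i, hlt⟩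
    have h1 := congrFun ht1 (k, ⟨_, hmem⟩)
    apply he
    rw [Matrix.mulVec, dotProduct] at h1
    simp only [M, toE_surj, Pi.zero_apply] at h1
    simp only [P, map_sum, coeff_sum]
    rw [← h1]
    refine Finset.sum_congr rfl fun J _ => ?_
    rw [sb_mon, sb_mon, C_1, one_mul, coeff_C_mul, mul_comm]
end
open MvPolynomial Height
section
variable {K : Type*} [Field K] [NumberField K] {m n N : ℕ}
noncomputable def Thl (i1 : Fin n) (F : Fin m → Fin N → Fin n → K) (p : Fin m × Fin n) :
    MvPolynomial (Fin m × Option (Fin N)) K :=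
  ∑ k, C (F p.1 k p.2) * X (p.1, some k) + if p.2 = i1 then X (p.1, none) else 0
noncomputable def Th (i1 : Fin n) (F : Fin m → Fin N → Fin n → K) :
    MvPolynomial (Fin m × Fin n) ℤ →+* MvPolynomial (Fin m × Option (Fin N)) K :=
  eval₂Hom (C.comp (Int.castRingHom K)) (Thl i1 F)
noncomputable def Ps (Zl : Fin m → Fin N → MvPolynomial (Fin m × Fin n) K) :
    MvPolynomial (Fin m × Option (Fin N)) K →+* MvPolynomial (Fin m × Fin n) (MvPolynomial (Fin m) K) :=
  eval₂Hom (C.comp C) (fun q => match q.2 with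
    | none => C (X q.1)
    | some k => map C (Zl q.1 k))
lemma Ps_supp (Zl : Fin m → Fin N → MvPolynomial (Fin m × Fin n) K) (G : MvPolynomial (Fin m × Option (Fin N)) K)
    (κ s) (h : coeff s (coeff κ (Ps Zl G)) ≠ 0) : ∃ u, coeff u G ≠ 0 ∧ ∀ h, u (h, none) = s h := by
  classical
  rw [G.as_sum, map_sum, coeff_sum, coeff_sum] at h
  obtain ⟨u, hu, hne⟩ := Finset.exists_ne_zero_of_sum_ne_zero h
  refine ⟨u, mem_support_iff.1 hu, ?_⟩
  have h1 : Ps Zl (monomial u (coeff u G)) = C (C (coeff u G) * ∏ h, X h ^ u (h, none)) *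
      map C (∏ h, ∏ k, Zl h k ^ u (h, some k)) := by
    rw [Ps, coe_eval₂Hom, eval₂_monomial, Finsupp.prod_fintype _ _ (by simp), Fintype.prod_prod_type]
    simp only [Fintype.prod_option, Finset.prod_mul_distrib]
    simp only [map_prod, map_pow, map_mul, RingHom.comp_apply]
    ring
  rw [h1, coeff_C_mul, coeff_map, mul_comm, coeff_C_mul, coeff_C_mul] at hne
  have h2 := right_ne_zero_of_mul (right_ne_zero_of_mul hne)
  have h3 : (∏ h : Fin m, (X h : MvPolynomial (Fin m) K) ^ u (h, none)) =
      monomial (Finsupp.equivFunOnFinite.symm fun h => u (h, none)) 1 := by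
    rw [monomial_eq, Finsupp.prod_fintype _ _ (by simp)]; simp
  rw [h3, coeff_monomial] at h2
  have h4 : Finsupp.equivFunOnFinite.symm (fun h => u (h, none)) = s := by
    by_contra h'; exact h2 (if_neg h')
  intro h; rw [← h4]; rfl
set_option maxHeartbeats 1600000 in
theorem nonvan (i1 p : Fin n) (hp : p ≠ i1) (r : Fin m → ℕ) (P : MvPolynomial (Fin m × Fin n) ℤ) (hP : P ≠ 0)
    (hhom : ∀ e, coeff e P ≠ 0 → ∀ h, ∑ i, e (h, i) = r h)
    (x : Fin m → Fin n → K) (hx : ∀ h, x h i1 ≠ 0) (F : Fin m → Fin N → Fin n → K)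
    (hF : ∀ h a, ∑ i, x h i * a i = 0 → a ∈ Submodule.span K (Set.range (F h)))
    (w : Fin m → ℝ) (ε : ℝ)
    (hroth : ∀ Q : MvPolynomial (Fin m) ℤ, Q ≠ 0 → (∀ e, coeff e Q ≠ 0 → ∀ h, e h ≤ r h) → L1 nuZ Q ≤ L1 nuZ P →
      ∃ s, coeff s (Tr (fun h => -(x h p / x h i1)) Q) ≠ 0 ∧ ∑ h, (s h : ℝ) * w h ≤ ε) :
    ∃ u, coeff u (Th i1 F P) ≠ 0 ∧ ∑ h, (u (h, none) : ℝ) * w h ≤ ε := by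
  classical
  have hτ : ∀ h i, ∃ τ : Fin N → K, i ≠ i1 → ∀ j, ∑ k, τ k * F h k j =
      (if j = i then 1 else 0) - if j = i1 then x h i / x h i1 else 0 := by
    intro h i
    by_cases hi : i = i1
    · exact ⟨0, fun h => absurd hi h⟩
    have h1 := hF h (fun j => (if j = i then 1 else 0) - if j = i1 then x h i / x h i1 else 0) (by
      simp only [mul_sub, Finset.sum_sub_distrib, mul_ite, mul_one, mul_zero, Finset.sum_ite_eq', Finset.mem_univ, if_true]
      have := hx h
      field_simp; simp)
    obtain ⟨τ, hτ⟩ := (Submodule.mem_span_range_iff_exists_fun K).1 h1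
    refine ⟨τ, fun _ j => ?_⟩
    have := congrFun hτ j
    simpa using this
  choose τ hτ using hτ
  let Z0 : Fin m → Fin n → MvPolynomial (Fin m × Fin n) K := fun h i =>
    if i = i1 then 0 else if i = p then 1 else X (h, i)
  let Zl : Fin m → Fin N → MvPolynomial (Fin m × Fin n) K := fun h k => ∑ i, C (τ h i k) * Z0 h i
  let β : Fin m → K := fun h => -(x h p / x h i1)
  have hlin : ∀ h j, ∑ k, C (F h k j) * Zl h k =
      (if j = i1 then C (β h) - ∑ i ∈ Finset.univ.filter (fun i => i ≠ i1 ∧ i ≠ p), C (x h i / x h i1) * X (h, i) else Z0 h j) := by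
    intro h j
    have h1 : ∑ k, C (F h k j) * Zl h k = ∑ i, C (∑ k, τ h i k * F h k j) * Z0 h i := by
      simp only [Zl, Finset.mul_sum, map_sum, Finset.sum_mul]
      rw [Finset.sum_comm]
      refine Finset.sum_congr rfl fun i _ => Finset.sum_congr rfl fun k _ => ?_
      rw [C_mul]; ring
    have h2 : ∀ i, C (∑ k, τ h i k * F h k j) * Z0 h i =
        C ((if j = i then 1 else 0) - if j = i1 then x h i / x h i1 else 0) * Z0 h i := by
      intro i
      by_cases hi : i = i1
      · simp [Z0, hi]
      · rw [hτ h i hi j]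
    rw [h1, Finset.sum_congr rfl fun i _ => h2 i]
    split_ifs with hj
    · subst hj
      rw [← Finset.add_sum_erase _ _ (Finset.mem_univ p), Finset.sum_filter, ← Finset.add_sum_erase Finset.univ (fun a => if a ≠ j ∧ a ≠ p then C (x h a / x h j) * X (h, a) else 0) (Finset.mem_univ p)]
      simp only [ne_eq, not_true_eq_false, and_false, if_false, zero_add]
      rw [sub_eq_add_neg (C (β h)), ← Finset.sum_neg_distrib]
      congr 1
      · simp [Z0, hp, hp.symm, β]
      · refine Finset.sum_congr rfl fun i hi => ?_
        have hip := Finset.ne_of_mem_erase hi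
        by_cases hij : i = j
        · simp [Z0, hij]
        · simp [Z0, hij, hip, Ne.symm hij]
    · simp
  -- the composite
  let L : Fin m → MvPolynomial (Fin m × Fin n) (MvPolynomial (Fin m) K) := fun h =>
    C (X h + C (β h)) - map C (∑ i ∈ Finset.univ.filter (fun i => i ≠ i1 ∧ i ≠ p), C (x h i / x h i1) * X (h, i))
  have hL0 : ∀ h, constantCoeff (L h) = X h + C (β h) := by
    intro h
    simp [L]
  have hcomp : ∀ q : Fin m × Fin n, Ps Zl (Thl i1 F q) = if q.2 = i1 then L q.1 else map C (Z0 q.1 q.2) := by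
    rintro ⟨h, j⟩
    have h1 : Ps Zl (Thl i1 F (h, j)) = map C (∑ k, C (F h k j) * Zl h k) + if j = i1 then C (X h) else 0 := by
      simp only [Thl, map_add, map_sum, map_mul]
      congr 1
      · refine Finset.sum_congr rfl fun k _ => ?_
        simp [Ps]
      · split_ifs <;> simp [Ps]
    rw [h1, hlin]
    split_ifs with hj
    · simp only [L, map_sub, map_add, map_C]; ring
    · simp
  let res : ((Fin m × Fin n) →₀ ℕ) → ((Fin m × Fin n) →₀ ℕ) := fun e => e.filter (fun q => q.2 ≠ i1 ∧ q.2 ≠ p)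
  have hmon : ∀ e a, Ps Zl (Th i1 F (monomial e a)) =
      C (C (a : K)) * (monomial (res e) 1 * ∏ h, L h ^ e (h, i1)) := by
    intro e a
    rw [Th, coe_eval₂Hom, eval₂_monomial, Finsupp.prod_fintype _ _ (by simp), map_mul, map_prod]
    simp only [map_pow, hcomp]
    congr 1
    · simp [Ps]
    · rw [monomial_eq, Finsupp.prod_fintype _ _ (by simp), C_1, one_mul, Fintype.prod_prod_type, Fintype.prod_prod_type,
        ← Finset.prod_mul_distrib]
      refine Finset.prod_congr rfl fun h _ => ?_
      rw [← Finset.mul_prod_erase _ _ (Finset.mem_univ i1), ← Finset.mul_prod_erase Finset.univ (fun y => X (h, y) ^ (res e) (h, y)) (Finset.mem_univ i1)]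
      simp only [if_true, res]
      rw [Finsupp.filter_apply_neg _ _ (by simp), pow_zero, one_mul, mul_comm]
      congr 1
      refine Finset.prod_congr rfl fun i hi => ?_
      have hi1 := Finset.ne_of_mem_erase hi
      by_cases hip : i = p
      · rw [Finsupp.filter_apply_neg _ _ (by simp [hip])]
        simp [hi1, Z0, hip, hp]
      · rw [Finsupp.filter_apply_pos _ _ (by simp [hip, hi1])]
        simp [hi1, Z0, hip]
  obtain ⟨e0, he0, hmin⟩ := Finset.exists_min_image P.support (fun e => (res e).degree) (by
    rwa [Finset.nonempty_iff_ne_empty, ne_eq, MvPolynomial.support_eq_empty])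
  let κ := res e0
  let pr : ((Fin m × Fin n) →₀ ℕ) → (Fin m →₀ ℕ) := fun e => Finsupp.equivFunOnFinite.symm fun h => e (h, i1)
  let Q : MvPolynomial (Fin m) ℤ := ∑ e ∈ P.support with res e = κ, monomial (pr e) (coeff e P)
  have hinj : ∀ e ∈ P.support, ∀ f ∈ P.support, res e = κ → res f = κ → pr e = pr f → e = f := by
    intro e he f hf h1 h2 h3
    have h4 : ∀ h i, i ≠ p → e (h, i) = f (h, i) := by
      intro h i hi
      by_cases hi1 : i = i1
      · subst hi1; exact DFunLike.congr_fun h3 h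
      · have := DFunLike.congr_fun (h1.trans h2.symm) (h, i)
        simp only [res] at this
        rwa [Finsupp.filter_apply_pos _ _ ⟨hi1, hi⟩, Finsupp.filter_apply_pos _ _ ⟨hi1, hi⟩] at this
    ext ⟨h, i⟩
    by_cases hi : i = p
    · subst hi
      have h5 := hhom e (mem_support_iff.1 he) h
      have h6 := hhom f (mem_support_iff.1 hf) h
      rw [← Finset.add_sum_erase _ _ (Finset.mem_univ i)] at h5 h6
      rw [Finset.sum_congr rfl (fun j hj => h4 h j (Finset.ne_of_mem_erase hj))] at h5
      exact Nat.add_right_cancel (h5.trans h6.symm)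
    · exact h4 h i hi
  have hQc : coeff (pr e0) Q = coeff e0 P := by
    simp only [Q, coeff_sum, coeff_monomial]
    rw [Finset.sum_eq_single e0]
    · simp
    · intro f hf hne
      rw [Finset.mem_filter] at hf
      rw [if_neg]
      intro h; exact hne (hinj f hf.1 e0 he0 hf.2 rfl h)
    · intro h; exact (h (Finset.mem_filter.2 ⟨he0, rfl⟩)).elim
  obtain ⟨s, hs1, hs2⟩ := hroth Q (by
      intro h; rw [h] at hQc; exact mem_support_iff.1 he0 (by rw [← hQc]; simp))
    (by
      intro e he h
      simp only [Q, coeff_sum, coeff_monomial] at he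
      obtain ⟨f, hf, hne⟩ := Finset.exists_ne_zero_of_sum_ne_zero he
      have h1 : pr f = e := by by_contra h'; exact hne (if_neg h')
      rw [← h1, ← hhom f (mem_support_iff.1 (Finset.mem_filter.1 hf).1) h]
      exact Finset.single_le_sum (f := fun i => f (h, i)) (fun _ _ => Nat.zero_le _) (Finset.mem_univ i1))
    (by
      refine (L1_sum _ _ _).trans ?_
      simp only [L1_monomial]
      exact Finset.sum_le_sum_of_subset_of_nonneg (Finset.filter_subset _ _) fun _ _ _ => nuZ.nonneg _)
  have hcoef : coeff κ (Ps Zl (Th i1 F P)) = Tr β Q := by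
    conv_lhs => rw [P.as_sum]
    simp only [map_sum, coeff_sum, Q]
    rw [Finset.sum_filter]
    refine Finset.sum_congr rfl fun e he => ?_
    rw [hmon, coeff_C_mul, coeff_monomial_mul', one_mul]
    have hTr : Tr β (monomial (pr e) (coeff e P)) = C ((coeff e P : ℤ) : K) * ∏ h, (X h + C (β h)) ^ e (h, i1) := by
      rw [Tr, coe_eval₂Hom, eval₂_monomial, Finsupp.prod_fintype _ _ (by simp)]
      simp [pr]
    by_cases hle : res e ≤ κ
    · have heq : res e = κ := by
        have h1 := hmin e he
        have h2 : (κ - res e).degree + (res e).degree = κ.degree := by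
          rw [← map_add, tsub_add_cancel_of_le hle]
        have h3 : (κ - res e).degree = 0 := by simp only [κ] at h2 ⊢; omega
        rw [Finsupp.degree_eq_zero_iff] at h3
        have := tsub_add_cancel_of_le hle
        rw [h3, zero_add] at this
        exact this
      rw [if_pos hle, if_pos heq, hTr, heq, tsub_self]
      congr 1
      change constantCoeff _ = _
      rw [map_prod]
      exact Finset.prod_congr rfl fun h _ => by rw [map_pow, hL0]
    · rw [if_neg hle, if_neg (fun h => hle h.le), mul_zero]
  rw [← hcoef] at hs1
  obtain ⟨u, hu1, hu2⟩ := Ps_supp Zl _ κ s hs1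
  exact ⟨u, hu1, by simpa only [hu2] using hs2⟩
end
open MvPolynomial Height
section
variable {K : Type*} [Field K] {τ σ : Type*} (ν : AbsoluteValue K ℝ) (ρ : τ → ℝ)
noncomputable def wm (e : τ →₀ ℕ) : ℝ := e.prod fun i k => ρ i ^ k
noncomputable def Lw (P : MvPolynomial τ K) : ℝ := ∑ e ∈ P.support, ν (coeff e P) * wm ρ e
lemma Lw_eq {P : MvPolynomial τ K} {t : Finset (τ →₀ ℕ)} (h : P.support ⊆ t) :
    Lw ν ρ P = ∑ e ∈ t, ν (coeff e P) * wm ρ e :=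
  Finset.sum_subset h fun e _ he => by simp [notMem_support_iff.1 he]
variable (hρ : ∀ i, 0 ≤ ρ i)
lemma wm_nonneg (hρ : ∀ i, 0 ≤ ρ i) (e) : 0 ≤ wm ρ e := Finset.prod_nonneg fun i _ => pow_nonneg (hρ i) _
lemma Lw_nonneg (hρ : ∀ i, 0 ≤ ρ i) (P : MvPolynomial τ K) : 0 ≤ Lw ν ρ P :=
  Finset.sum_nonneg fun _ _ => mul_nonneg (ν.nonneg _) (wm_nonneg ρ hρ _)
lemma Lw_add (hρ : ∀ i, 0 ≤ ρ i) (P Q : MvPolynomial τ K) : Lw ν ρ (P + Q) ≤ Lw ν ρ P + Lw ν ρ Q := by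
  classical
  rw [Lw_eq ν ρ (support_add (p := P) (q := Q)),
    Lw_eq ν ρ (Finset.subset_union_left (s₁ := P.support) (s₂ := Q.support)),
    Lw_eq ν ρ (Finset.subset_union_right (s₁ := P.support) (s₂ := Q.support)),
    ← Finset.sum_add_distrib]
  exact Finset.sum_le_sum fun e _ => by
    rw [coeff_add, ← add_mul]; exact mul_le_mul_of_nonneg_right (ν.add_le _ _) (wm_nonneg ρ hρ _)
lemma Lw_sum (hρ : ∀ i, 0 ≤ ρ i) {ι : Type*} (t : Finset ι) (P : ι → MvPolynomial τ K) :
    Lw ν ρ (∑ i ∈ t, P i) ≤ ∑ i ∈ t, Lw ν ρ (P i) := by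
  classical
  induction t using Finset.induction_on with
  | empty => simp [Lw]
  | insert a t ha ih =>
    rw [Finset.sum_insert ha, Finset.sum_insert ha]
    exact (Lw_add ν ρ hρ _ _).trans (by gcongr)
lemma Lw_monomial (e : τ →₀ ℕ) (a : K) : Lw ν ρ (monomial e a) = ν a * wm ρ e := by
  classical
  rw [Lw_eq ν ρ support_monomial_subset]; simp
lemma Lw_C (a : K) : Lw ν ρ (C a) = ν a := by
  rw [← monomial_zero', Lw_monomial]; simp [wm]
lemma Lw_X (i : τ) : Lw ν ρ (X i : MvPolynomial τ K) = ρ i := by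
  rw [X, Lw_monomial]; simp [wm]
lemma Lw_mul (hρ : ∀ i, 0 ≤ ρ i) (P Q : MvPolynomial τ K) : Lw ν ρ (P * Q) ≤ Lw ν ρ P * Lw ν ρ Q := by
  have h : P * Q = ∑ e ∈ P.support, ∑ f ∈ Q.support, monomial (e + f) (coeff e P * coeff f Q) := by
    conv_lhs => rw [P.as_sum, Q.as_sum]
    rw [Finset.sum_mul_sum]
    exact Finset.sum_congr rfl fun e _ => Finset.sum_congr rfl fun f _ => by rw [monomial_mul]
  rw [show Lw ν ρ P * Lw ν ρ Q = _ from Finset.sum_mul_sum _ _ _ _, h]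
  refine (Lw_sum ν ρ hρ _ _).trans (Finset.sum_le_sum fun e _ => ?_)
  refine (Lw_sum ν ρ hρ _ _).trans (Finset.sum_le_sum fun f _ => ?_)
  rw [Lw_monomial, map_mul, wm, Finsupp.prod_add_index' (by simp) (by intros; rw [pow_add])]
  exact le_of_eq (by rw [wm, wm]; ring)
lemma Lw_pow (hρ : ∀ i, 0 ≤ ρ i) (P : MvPolynomial τ K) (k : ℕ) : Lw ν ρ (P ^ k) ≤ Lw ν ρ P ^ k := by
  induction k with
  | zero => rw [pow_zero, ← C_1, Lw_C]; simp
  | succ k ih =>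
    rw [pow_succ, pow_succ]
    exact (Lw_mul ν ρ hρ _ _).trans (mul_le_mul_of_nonneg_right ih (Lw_nonneg ν ρ hρ _))
lemma Lw_prod (hρ : ∀ i, 0 ≤ ρ i) {ι : Type*} (t : Finset ι) (P : ι → MvPolynomial τ K) :
    Lw ν ρ (∏ i ∈ t, P i) ≤ ∏ i ∈ t, Lw ν ρ (P i) := by
  classical
  induction t using Finset.induction_on with
  | empty => rw [Finset.prod_empty, ← C_1, Lw_C]; simp
  | insert a t ha ih =>
    rw [Finset.prod_insert ha, Finset.prod_insert ha]
    exact (Lw_mul ν ρ hρ _ _).trans (mul_le_mul_of_nonneg_left ih (Lw_nonneg ν ρ hρ _))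
lemma coeff_le_Lw (hρ : ∀ i, 0 ≤ ρ i) (P : MvPolynomial τ K) (e) : ν (coeff e P) * wm ρ e ≤ Lw ν ρ P := by
  by_cases h : e ∈ P.support
  · exact Finset.single_le_sum (f := fun e => ν (coeff e P) * wm ρ e)
      (fun _ _ => mul_nonneg (ν.nonneg _) (wm_nonneg ρ hρ _)) h
  · rw [notMem_support_iff.1 h, map_zero, zero_mul]; exact Lw_nonneg ν ρ hρ P
theorem local_bound [Fintype σ] (hν : ∀ a : ℤ, ν (a : K) ≤ |(a : ℝ)|) (hρ : ∀ i, 0 ≤ ρ i) (L : σ → MvPolynomial τ K) (b : σ → ℝ)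
    (hb : ∀ p, Lw ν ρ (L p) ≤ b p) (P : MvPolynomial σ ℤ) (M : ℝ)
    (hM : ∀ J, coeff J P ≠ 0 → ∏ p, b p ^ J p ≤ M) (u : τ →₀ ℕ) :
    ν (coeff u (eval₂Hom (C.comp (Int.castRingHom K)) L P)) * wm ρ u ≤ L1 nuZ P * M := by
  classical
  refine (coeff_le_Lw ν ρ hρ _ u).trans ?_
  conv_lhs => rw [P.as_sum, map_sum]
  refine (Lw_sum ν ρ hρ _ _).trans ?_
  rw [L1, Finset.sum_mul]
  refine Finset.sum_le_sum fun J hJ => ?_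
  rw [coe_eval₂Hom, eval₂_monomial, Finsupp.prod_fintype _ _ (by simp)]
  refine (Lw_mul ν ρ hρ _ _).trans ?_
  have hb0 : ∀ p, 0 ≤ b p := fun p => (Lw_nonneg ν ρ hρ _).trans (hb p)
  refine mul_le_mul ?_ ?_ (Lw_nonneg ν ρ hρ _) (nuZ.nonneg _)
  · rw [RingHom.comp_apply, Lw_C]; exact hν _
  · refine ((Lw_prod ν ρ hρ _ _).trans ?_).trans (hM J (mem_support_iff.1 hJ))
    exact Finset.prod_le_prod (fun _ _ => Lw_nonneg ν ρ hρ _) fun p _ =>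
      (Lw_pow ν ρ hρ _ _).trans (pow_le_pow_left₀ (Lw_nonneg ν ρ hρ _) (hb p) _)
lemma na_sum {ι : Type*} (hna : IsNonarchimedean ν) (s : Finset ι) (f : ι → K) {M : ℝ} (hM : 0 ≤ M)
    (h : ∀ i ∈ s, ν (f i) ≤ M) : ν (∑ i ∈ s, f i) ≤ M := by
  classical
  induction s using Finset.induction_on with
  | empty => simpa
  | insert a t ha ih =>
    rw [Finset.sum_insert ha]
    exact (hna _ _).trans (max_le (h a (by simp)) (ih fun i hi => h i (by simp [hi])))
theorem local_bound_na [Fintype σ] (hna : IsNonarchimedean ν) (hν : ∀ a : ℤ, ν (a : K) ≤ 1) (L : σ → MvPolynomial τ K) (b : σ → ℝ) (hb0 : ∀ p, 0 ≤ b p)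
    (hb : ∀ p u, ν (coeff u (L p)) ≤ b p) (P : MvPolynomial σ ℤ) (M : ℝ) (hM0 : 0 ≤ M)
    (hM : ∀ J, coeff J P ≠ 0 → ∏ p, b p ^ J p ≤ M) (u : τ →₀ ℕ) :
    ν (coeff u (eval₂Hom (C.comp (Int.castRingHom K)) L P)) ≤ M := by
  classical
  have hmul : ∀ (f g : MvPolynomial τ K) (a c : ℝ), 0 ≤ a → 0 ≤ c → (∀ u, ν (coeff u f) ≤ a) → (∀ u, ν (coeff u g) ≤ c) →
      ∀ u, ν (coeff u (f * g)) ≤ a * c := by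
    intro f g a c ha hc hf hg u
    rw [coeff_mul]
    refine na_sum ν hna _ _ (mul_nonneg ha hc) fun i _ => ?_
    rw [map_mul]
    exact mul_le_mul (hf _) (hg _) (ν.nonneg _) ha
  have hone : ∀ u, ν (coeff u (1 : MvPolynomial τ K)) ≤ 1 := by
    intro u; rw [coeff_one]; split_ifs <;> simp
  have hpow : ∀ p k u, ν (coeff u (L p ^ k)) ≤ b p ^ k := by
    intro p k
    induction k with
    | zero => simpa using hone
    | succ k ih => rw [pow_succ, pow_succ]; exact hmul _ _ _ _ (pow_nonneg (hb0 p) _) (hb0 p) ih (hb p)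
  have hprod : ∀ (J : σ →₀ ℕ) (s : Finset σ) u, ν (coeff u (∏ p ∈ s, L p ^ J p)) ≤ ∏ p ∈ s, b p ^ J p := by
    intro J s
    induction s using Finset.induction_on with
    | empty => simpa using hone
    | insert a t ha ih =>
      rw [Finset.prod_insert ha, Finset.prod_insert ha]
      exact hmul _ _ _ _ (pow_nonneg (hb0 _) _) (Finset.prod_nonneg fun p _ => pow_nonneg (hb0 p) _) (hpow _ _) ih
  rw [P.as_sum, map_sum, coeff_sum]
  refine na_sum ν hna _ _ hM0 fun J hJ => ?_
  rw [coe_eval₂Hom, eval₂_monomial, Finsupp.prod_fintype _ _ (by simp), RingHom.comp_apply, coeff_C_mul, map_mul,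
    ← one_mul M]
  exact mul_le_mul (hν _) ((hprod J _ u).trans (hM J (mem_support_iff.1 hJ))) (ν.nonneg _) zero_le_one
end
section
variable {K : Type*} [Field K] [NumberField K] {m n N : ℕ}
noncomputable def Ll (A : Matrix (Fin n) (Fin n) ℤ) (i1 : Fin n) (F : Fin m → Fin N → Fin n → K) (p : Fin m × Fin n) :
    MvPolynomial (Fin m × Option (Fin N)) K :=
  ∑ k, C (∑ j, (A p.2 j : K) * F p.1 k j) * X (p.1, some k) + C (A p.2 i1 : K) * X (p.1, none)
lemma Th_sb (A : Matrix (Fin n) (Fin n) ℤ) (hA : A * A = 1) (i1 : Fin n) (F : Fin m → Fin N → Fin n → K)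
    (P : MvPolynomial (Fin m × Fin n) ℤ) :
    Th i1 F P = eval₂Hom (C.comp (Int.castRingHom K)) (Ll A i1 F) (sb A P) := by
  have hL : ∀ p, Ll A i1 F p = ∑ j, C (A p.2 j : K) * Thl i1 F (p.1, j) := by
    intro p
    simp only [Ll, Thl, mul_add, Finset.sum_add_distrib]
    congr 1
    · simp only [Finset.mul_sum, map_sum, Finset.sum_mul]
      rw [Finset.sum_comm]
      simp only [C_mul, mul_assoc]
    · simp
  have h : (Th i1 F : MvPolynomial (Fin m × Fin n) ℤ →+* MvPolynomial (Fin m × Option (Fin N)) K) =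
      (eval₂Hom (C.comp (Int.castRingHom K)) (Ll A i1 F)).comp (sb A).toRingHom := by
    refine MvPolynomial.ringHom_ext (fun a => by simp) fun p => ?_
    have h1 : (sb A).toRingHom (X p) = lf A p := by simp [sb]
    rw [RingHom.comp_apply, h1]
    simp only [Th, lf, coe_eval₂Hom, eval₂_X, eval₂_sum, eval₂_mul, eval₂_C, hL, RingHom.comp_apply]
    simp only [Finset.mul_sum, ← mul_assoc]
    rw [Finset.sum_comm]
    simp only [← Finset.sum_mul]
    have h2 : ∀ j, ∑ i, (C ((Int.castRingHom K) (A p.2 i)) * C (A i j : K) : MvPolynomial (Fin m × Option (Fin N)) K) = if p.2 = j then 1 else 0 := by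
      intro j
      have := congrFun (congrFun hA p.2) j
      rw [Matrix.mul_apply, Matrix.one_apply] at this
      rw [← Finset.sum_congr rfl (fun i _ => C_mul), ← map_sum]
      have h3 : ∑ i, (Int.castRingHom K) (A p.2 i) * (A i j : K) = ((∑ i, A p.2 i * A i j : ℤ) : K) := by push_cast; rfl
      rw [h3, this]
      split_ifs <;> simp
    simp only [h2, ite_mul, one_mul, zero_mul, Finset.sum_ite_eq, Finset.mem_univ, if_true]
  rw [h]; rfl
end
open MvPolynomial Height
section
variable {K : Type*} [Field K] [NumberField K] {m n N q : ℕ}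
lemma pv_le_abs (v : Pl K) (a : ℤ) : pv v (a : K) ≤ |(a : ℝ)| := by
  rcases v with v | v
  · exact (pv_int_inf v a).le
  · rcases eq_or_ne a 0 with rfl | h
    · simp
    · exact (pv_int v a).trans (by exact_mod_cast Int.one_le_abs h)
lemma theta_bound (hn : 1 ≤ n) (J : Fin m → Fin n → ℝ) (hJ0 : ∀ h i, 0 ≤ J h i) (r hh : Fin m → ℝ) (hr : ∀ h, 0 < r h)
    (hJs : ∀ h, ∑ i, J h i = r h) (ε R Λ : ℝ) (hε : 0 ≤ ε) (hε1 : ε ≤ 1) (hR : 0 ≤ R)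
    (hr1 : ∀ h, R ≤ r h * hh h) (hr2 : ∀ h, r h * hh h ≤ (1 + ε) * R) (c : Fin n → ℝ) (hc : ∀ i, |c i| ≤ Λ)
    (hθ : ∀ i, m * (1 / n - ε) ≤ ∑ h, J h i / r h) (hΛ : 0 ≤ Λ) :
    ∑ h, ∑ i, J h i * (hh h * (c i + ε)) ≤ R * m * (1 / n * ∑ i, c i + ε * (2 * n * Λ + Λ + 2)) := by
  have hn0 : (0 : ℝ) < n := by exact_mod_cast hn
  have hθs : ∑ i, ∑ h, J h i / r h = m := by
    rw [Finset.sum_comm]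
    have : ∀ h, ∑ i, J h i / r h = 1 := by
      intro h; rw [← Finset.sum_div, hJs, div_self (hr h).ne']
    simp [this]
  have h1 : ∀ h i, J h i * (hh h * (c i + ε)) ≤ J h i / r h * (R * (c i + ε) + ε * R * (Λ + 1)) := by
    intro h i
    have e1 : J h i * (hh h * (c i + ε)) = J h i / r h * (r h * hh h * (c i + ε)) := by
      have := (hr h).ne'; field_simp
    rw [e1]
    refine mul_le_mul_of_nonneg_left ?_ (div_nonneg (hJ0 h i) (hr h).le)
    have h2 := abs_le.1 (hc i)
    have h3 : (r h * hh h - R) * (c i + ε) ≤ (ε * R) * (Λ + 1) := by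
      calc _ ≤ (r h * hh h - R) * (Λ + 1) := mul_le_mul_of_nonneg_left (by linarith) (by linarith [hr1 h])
        _ ≤ _ := mul_le_mul_of_nonneg_right (by linarith [hr2 h]) (by linarith)
    linarith
  have h2 : ∑ i, c i * ∑ h, J h i / r h ≤ m * (1 / n * ∑ i, c i + 2 * n * Λ * ε) := by
    have h3 : ∀ i, c i * ∑ h, J h i / r h ≤ Λ * (∑ h, J h i / r h) + (c i - Λ) * (m * (1 / n - ε)) := by
      intro i
      have := mul_le_mul_of_nonpos_left (hθ i) (show c i - Λ ≤ 0 by linarith [(abs_le.1 (hc i)).2])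
      linarith
    refine (Finset.sum_le_sum fun i _ => h3 i).trans ?_
    rw [Finset.sum_add_distrib, ← Finset.mul_sum, hθs, ← Finset.sum_mul, Finset.sum_sub_distrib]
    simp only [Finset.sum_const, Finset.card_univ, Fintype.card_fin, nsmul_eq_mul]
    have h4 : -(∑ i, c i) ≤ n * Λ := by
      rw [← Finset.sum_neg_distrib]
      refine (Finset.sum_le_card_nsmul _ _ Λ fun i _ => by linarith [(abs_le.1 (hc i)).1]).trans ?_
      simp
    have h5 : Λ * m + (∑ i, c i - n * Λ) * (m * (1 / n - ε)) = m * (1 / n * ∑ i, c i + n * Λ * ε + ε * (-(∑ i, c i))) := by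
      field_simp; ring
    rw [h5]
    refine mul_le_mul_of_nonneg_left ?_ (Nat.cast_nonneg m)
    have := mul_le_mul_of_nonneg_left h4 hε
    linarith
  refine (Finset.sum_le_sum fun h _ => Finset.sum_le_sum fun i _ => h1 h i).trans ?_
  rw [Finset.sum_comm]
  have h6 : ∑ i, ∑ h, J h i / r h * (R * (c i + ε) + ε * R * (Λ + 1)) =
      R * (∑ i, c i * ∑ h, J h i / r h) + R * ε * (Λ + 2) * ∑ i, ∑ h, J h i / r h := by
    rw [Finset.mul_sum, Finset.mul_sum, ← Finset.sum_add_distrib]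
    refine Finset.sum_congr rfl fun i _ => ?_
    rw [← Finset.sum_mul]; ring
  rw [h6, hθs]
  have := mul_le_mul_of_nonneg_left h2 hR
  linarith
theorem core (hn : 1 ≤ n) (A : Fin q → Matrix (Fin n) (Fin n) ℤ) (hA : ∀ k, A k * A k = 1)
    (T : Finset (Pl K)) (hT : ∀ v, Sum.inl v ∈ T) (kk : Pl K → Fin q) (c : Pl K → Fin n → ℝ) (Λ a : ℝ)
    (hc : ∀ v ∈ T, ∀ i, |c v i| ≤ Λ) (hΛ : 0 ≤ Λ) (ha : ∀ k i j, |(A k i j : ℝ)| ≤ a) (ha0 : 1 ≤ a)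
    (i1 : Fin n) (ε R B : ℝ) (hε : 0 ≤ ε) (hε1 : ε ≤ 1) (hR : 0 ≤ R) (hm : 1 ≤ m)
    (r : Fin m → ℕ) (hr : ∀ h, 1 ≤ r h) (hh : Fin m → ℝ) (hhp : ∀ h, 0 ≤ hh h)
    (hr1 : ∀ h, R ≤ r h * hh h) (hr2 : ∀ h, r h * hh h ≤ (1 + ε) * R)
    (P : MvPolynomial (Fin m × Fin n) ℤ)
    (hhom : ∀ e, coeff e P ≠ 0 → ∀ h, ∑ i, e (h, i) = r h)
    (hB : ∀ k, L1 nuZ (sb (A k) P) ≤ Real.exp B)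
    (hθ : ∀ k e, coeff e (sb (A k) P) ≠ 0 → ∀ i, m * (1 / n - ε) ≤ ∑ h, (e (h, i) : ℝ) / r h)
    (F : Fin m → Fin N → Fin n → K) (Av : Fin m → Pl K → ℝ)
    (hFT : ∀ h, ∀ v ∈ T, ∀ k i, pv v (∑ j, (A (kk v) i j : K) * F h k j) ≤ Real.exp (hh h * (c v i + ε)))
    (hAs : ∀ h, (Function.support (Av h)).Finite) (hA0 : ∀ h v, 0 ≤ Av h v)
    (hF : ∀ h, ∀ v ∉ T, ∀ k i, pv v (F h k i) ≤ Real.exp (Av h v))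
    (hAsum : ∀ h, ∑ᶠ v, wt v * Av h v ≤ ε * hh h)
    (u) (hu : coeff u (Th i1 F P) ≠ 0) (hus : ∑ h, (u (h, none) : ℝ) * (r h : ℝ)⁻¹ ≤ ε) :
    0 ≤ (∑ v ∈ T, wt v) * (B + (∑ h, (r h : ℝ)) * Real.log (N + a)) +
      R * m * (1 / n * (∑ v ∈ T, wt v * ∑ i, c v i) + (∑ v ∈ T, wt v) * ε * (2 * n * Λ + 3 * Λ + 2) + 2 * ε) := by
  classical
  have hm1 : (1 : ℝ) ≤ m := by exact_mod_cast hm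
  have hrp : ∀ h, (0 : ℝ) < r h := fun h => by exact_mod_cast hr h
  have haN : 0 < (N : ℝ) + a := by positivity
  set g : Pl K → ℝ := fun v => B + (∑ h, (r h : ℝ)) * Real.log (N + a) + R * m * (1 / n * ∑ i, c v i + ε * (2 * n * Λ + 3 * Λ + 2)) with hg
  have hT1 : ∀ v ∈ T, Real.log (pv v (coeff u (Th i1 F P))) ≤ g v := by
    intro v hv
    let ρ : Fin m × Option (Fin N) → ℝ := fun t => if t.2 = none then Real.exp (-(Λ * hh t.1)) else 1
    have hρ : ∀ t, 0 ≤ ρ t := by intro t; simp only [ρ]; split_ifs <;> positivity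
    have hb := local_bound (pv v) ρ (pv_le_abs v) hρ (Ll (A (kk v)) i1 F) (fun t => (N + a) * Real.exp (hh t.1 * (c v t.2 + ε))) (by
      rintro ⟨h, i⟩
      refine (Lw_add _ _ hρ _ _).trans ?_
      rw [add_mul]
      refine add_le_add ?_ ?_
      · refine (Lw_sum _ _ hρ _ _).trans ((Finset.sum_le_card_nsmul _ _ (Real.exp (hh h * (c v i + ε))) fun k _ => ?_).trans (by simp))
        refine (Lw_mul _ _ hρ _ _).trans ?_
        rw [Lw_C, Lw_X]
        simp only [ρ, reduceCtorEq, if_false, mul_one]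
        exact hFT h v hv k i
      · refine (Lw_mul _ _ hρ _ _).trans ?_
        rw [Lw_C, Lw_X]
        simp only [ρ, if_true]
        refine mul_le_mul ((pv_le_abs v _).trans (ha _ _ _)) (Real.exp_le_exp.2 ?_) (Real.exp_nonneg _) (by linarith)
        have h1 := (abs_le.1 (hc v hv i)).1
        have := mul_le_mul_of_nonneg_left (show -Λ ≤ c v i + ε by linarith) (hhp h)
        linarith)
      (sb (A (kk v)) P) (Real.exp ((∑ h, (r h : ℝ)) * Real.log (N + a) + R * m * (1 / n * ∑ i, c v i + ε * (2 * n * Λ + Λ + 2)))) (by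
        intro J hJ
        have hJh := sb_hom (A (kk v)) r P hhom J hJ
        simp only [mul_pow]
        rw [Finset.prod_mul_distrib, Real.exp_add]
        refine mul_le_mul (le_of_eq ?_) ?_ (Finset.prod_nonneg fun _ _ => by positivity) (Real.exp_nonneg _)
        · rw [Finset.prod_pow_eq_pow_sum, Fintype.sum_prod_type, Finset.sum_congr rfl (fun h _ => hJh h), mul_comm, ← Real.rpow_def_of_pos haN, ← Nat.cast_sum, Real.rpow_natCast]
        · simp only [← Real.exp_nat_mul]
          rw [← Real.exp_sum, Fintype.sum_prod_type]
          refine Real.exp_le_exp.2 ?_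
          refine theta_bound hn (fun h i => (J (h, i) : ℝ)) (fun _ _ => Nat.cast_nonneg _) (fun h => (r h : ℝ)) hh hrp ?_ ε R Λ hε hε1 hR hr1 hr2 (c v) (hc v hv) (hθ _ J hJ) hΛ
          intro h; exact_mod_cast hJh h) u
    rw [← Th_sb _ (hA _)] at hb
    have hw : Real.exp (-(2 * Λ * R * m * ε)) ≤ wm ρ u := by
      rw [wm, Finsupp.prod_fintype _ _ (by simp), Fintype.prod_prod_type]
      simp only [Fintype.prod_option, ρ, if_true, reduceCtorEq, if_false, one_pow, Finset.prod_const_one, mul_one, ← Real.exp_nat_mul]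
      rw [← Real.exp_sum]
      refine Real.exp_le_exp.2 ?_
      have h1 : ∀ h, (u (h, none) : ℝ) * (r h : ℝ)⁻¹ * (-(Λ * (2 * R))) ≤ (u (h, none) : ℝ) * -(Λ * hh h) := by
        intro h
        have e1 : (u (h, none) : ℝ) * -(Λ * hh h) = (u (h, none) : ℝ) * (r h : ℝ)⁻¹ * (-(Λ * (r h * hh h))) := by
          have := (hrp h).ne'; field_simp
        rw [e1]
        refine mul_le_mul_of_nonneg_left (neg_le_neg (mul_le_mul_of_nonneg_left ?_ hΛ)) (mul_nonneg (Nat.cast_nonneg _) (inv_nonneg.2 (hrp h).le))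
        refine (hr2 h).trans (mul_le_mul_of_nonneg_right (by linarith) hR)
      refine le_trans ?_ (Finset.sum_le_sum fun h _ => h1 h)
      rw [← Finset.sum_mul]
      have h2 : 0 ≤ Λ * (2 * R) := by positivity
      have h3 := mul_le_mul_of_nonneg_right hus h2
      have h4 : Λ * (2 * R) * ε * 1 ≤ Λ * (2 * R) * ε * m := mul_le_mul_of_nonneg_left hm1 (by positivity)
      linarith
    have hpos : 0 < pv v (coeff u (Th i1 F P)) := (pv v).pos hu
    have h5 : pv v (coeff u (Th i1 F P)) * Real.exp (-(2 * Λ * R * m * ε)) ≤ Real.exp B * Real.exp ((∑ h, (r h : ℝ)) * Real.log (N + a) + R * m * (1 / n * ∑ i, c v i + ε * (2 * n * Λ + Λ + 2))) :=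
      (mul_le_mul_of_nonneg_left hw hpos.le).trans (hb.trans (mul_le_mul_of_nonneg_right (hB _) (Real.exp_nonneg _)))
    have h6 := Real.log_le_log (by positivity) h5
    rw [Real.log_mul hpos.ne' (Real.exp_ne_zero _), ← Real.exp_add, Real.log_exp, Real.log_exp] at h6
    simp only [hg]; linarith
  have hT2 : ∀ v ∉ T, Real.log (pv v (coeff u (Th i1 F P))) ≤ ∑ h, (r h : ℝ) * Av h v := by
    intro v hv
    rcases v with v | v
    · exact absurd (hT v) hv
    rw [Real.log_le_iff_le_exp ((pv _).pos hu)]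
    refine local_bound_na _ (isNA v) (pv_int v) (Thl i1 F) (fun t => Real.exp (Av t.1 (Sum.inr v))) (fun _ => Real.exp_nonneg _) ?_ P _ (Real.exp_nonneg _) ?_ u
    · rintro ⟨h, i⟩ e
      have h1 : (1 : ℝ) ≤ Real.exp (Av h (Sum.inr v)) := Real.one_le_exp (hA0 _ _)
      rw [Thl, coeff_add]
      refine (isNA v _ _).trans (max_le ?_ ?_)
      · rw [coeff_sum]
        refine na_sum _ (isNA v) _ _ (Real.exp_nonneg _) fun k _ => ?_
        rw [coeff_C_mul, coeff_X, mul_ite, mul_one, mul_zero]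
        split_ifs
        · exact hF h _ hv k i
        · simp [Real.exp_nonneg]
      · split_ifs
        · rw [coeff_X]; split_ifs
          · simpa using h1
          · simp [Real.exp_nonneg]
        · simp [Real.exp_nonneg]
    · intro J hJ
      simp only [← Real.exp_nat_mul]
      rw [← Real.exp_sum, Fintype.sum_prod_type]
      refine Real.exp_le_exp.2 (le_of_eq (Finset.sum_congr rfl fun h _ => ?_))
      dsimp only
      rw [← Finset.sum_mul, ← hhom J hJ h]; push_cast; rfl
  have hs1 : ∀ h, (Function.support fun v => wt v * ((r h : ℝ) * Av h v)).Finite := fun h =>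
    (hAs h).subset fun v hv => by
      simp only [Function.mem_support] at hv ⊢
      intro h0; exact hv (by rw [h0]; simp)
  have hs2 : (Function.support fun v => ∑ h, (r h : ℝ) * Av h v).Finite := by
    refine (Set.finite_iUnion hAs).subset fun v hv => ?_
    by_contra hn
    simp only [Set.mem_iUnion, Function.mem_support, not_exists, not_not] at hn
    exact hv (by simp [hn])
  have hs3 : (Function.support fun v => if v ∈ T then g v else 0).Finite :=
    T.finite_toSet.subset fun v hv => by by_contra hn; exact hv (if_neg hn)
  have hfin := prod_ineq hu (fun v => (if v ∈ T then g v else 0) + ∑ h, (r h : ℝ) * Av h v) ((hs3.union hs2).subset (Function.support_add _ _)) (by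
    intro v
    have h0 : 0 ≤ ∑ h, (r h : ℝ) * Av h v := Finset.sum_nonneg fun h _ => mul_nonneg (hrp h).le (hA0 _ _)
    split_ifs with hv
    · linarith [hT1 v hv]
    · linarith [hT2 v hv])
  have hsplit : ∑ᶠ v, wt v * ((if v ∈ T then g v else 0) + ∑ h, (r h : ℝ) * Av h v) =
      ∑ v ∈ T, wt v * g v + ∑ h, (r h : ℝ) * ∑ᶠ v, wt v * Av h v := by
    simp only [mul_add, Finset.mul_sum]
    rw [finsum_add_distrib (hs3.subset fun v hv => right_ne_zero_of_mul hv) (by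
      refine hs2.subset fun v hv => ?_
      simp only [Function.mem_support, ← Finset.mul_sum] at hv ⊢
      exact right_ne_zero_of_mul hv)]
    congr 1
    · rw [finsum_eq_sum_of_support_subset _ (s := T) (fun v hv => by by_contra hn; exact hv (by simp at hn; simp [hn]))]
      exact Finset.sum_congr rfl fun v hv => by simp [hv]
    · rw [finsum_sum_comm _ _ (fun h _ => hs1 h)]
      refine Finset.sum_congr rfl fun h _ => ?_
      rw [← smul_eq_mul (r h : ℝ), smul_finsum]
      exact finsum_congr fun v => by simp only [smul_eq_mul]; ring
  rw [hsplit] at hfin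
  have h7 : ∑ h, (r h : ℝ) * ∑ᶠ v, wt v * Av h v ≤ R * m * (2 * ε) := by
    have : ∀ h, (r h : ℝ) * ∑ᶠ v, wt v * Av h v ≤ 2 * R * ε := by
      intro h
      calc _ ≤ (r h : ℝ) * (ε * hh h) := mul_le_mul_of_nonneg_left (hAsum h) (hrp h).le
        _ = ε * (r h * hh h) := by ring
        _ ≤ ε * (2 * R) := mul_le_mul_of_nonneg_left ((hr2 h).trans (mul_le_mul_of_nonneg_right (by linarith) hR)) hε
        _ = _ := by ring
    refine (Finset.sum_le_card_nsmul _ _ _ fun h _ => this h).trans (le_of_eq ?_)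
    simp; ring
  have h8 : ∑ v ∈ T, wt v * g v = (∑ v ∈ T, wt v) * (B + (∑ h, (r h : ℝ)) * Real.log (N + a) + R * m * (ε * (2 * n * Λ + 3 * Λ + 2))) + R * m * (1 / n) * ∑ v ∈ T, wt v * ∑ i, c v i := by
    rw [Finset.sum_mul, Finset.mul_sum, ← Finset.sum_add_distrib]
    exact Finset.sum_congr rfl fun v _ => by simp only [hg]; ring
  rw [h8] at hfin
  linarith
end
open MvPolynomial Height
section
variable {K : Type*} [Field K] [NumberField K] {n q : ℕ}
theorem roth_machine (hn : 1 ≤ n) (A : Fin q → Matrix (Fin n) (Fin n) ℤ) (hA : ∀ k, A k * A k = 1)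
    (T : Finset (Pl K)) (hT : ∀ v, Sum.inl v ∈ T) (kk : Pl K → Fin q) (c : Pl K → Fin n → ℝ)
    (hc : ∑ v ∈ T, wt v * ∑ i, c v i < 0) (c0 : ℝ) (hc0 : 0 < c0) (i1 p : Fin n) (hp : p ≠ i1) (N : ℕ) :
    ∃ ε > (0 : ℝ), ∃ H0 : ℝ, ∀ (h : ℝ) (x : Fin n → K) (F : Fin N → Fin n → K) (Av : Pl K → ℝ),
      x i1 ≠ 0 → c0 * h ≤ logHeight₁ (-(x p / x i1)) →
      (∀ a, ∑ i, x i * a i = 0 → a ∈ Submodule.span K (Set.range F)) →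
      (∀ v ∈ T, ∀ k i, pv v (∑ j, (A (kk v) i j : K) * F k j) ≤ Real.exp (h * (c v i + ε))) →
      (Function.support Av).Finite → (∀ v, 0 ≤ Av v) →
      (∀ v ∉ T, ∀ k i, pv v (F k i) ≤ Real.exp (Av v)) →
      ∑ᶠ v, wt v * Av v ≤ ε * h → h < H0 := by
  classical
  obtain ⟨Λ, hΛ, hcΛ⟩ : ∃ Λ, 0 ≤ Λ ∧ ∀ v ∈ T, ∀ i, |c v i| ≤ Λ := by
    refine ⟨∑ v ∈ T, ∑ i, |c v i|, by positivity, fun v hv i => ?_⟩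
    exact (Finset.single_le_sum (f := fun i => |c v i|) (fun _ _ => abs_nonneg _) (Finset.mem_univ i)).trans
      (Finset.single_le_sum (f := fun v => ∑ i, |c v i|) (fun _ _ => by positivity) hv)
  obtain ⟨a, ha0, ha⟩ : ∃ a : ℝ, 1 ≤ a ∧ ∀ k i j, |(A k i j : ℝ)| ≤ a := by
    refine ⟨1 + ∑ k, ∑ i, ∑ j, |(A k i j : ℝ)|, le_add_of_nonneg_right (by positivity), fun k i j => ?_⟩
    refine le_trans ?_ (le_add_of_nonneg_left zero_le_one)
    exact ((Finset.single_le_sum (f := fun j => |(A k i j : ℝ)|) (fun _ _ => abs_nonneg _) (Finset.mem_univ j)).trans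
      (Finset.single_le_sum (f := fun i => ∑ j, |(A k i j : ℝ)|) (fun _ _ => by positivity) (Finset.mem_univ i))).trans
      (Finset.single_le_sum (f := fun k => ∑ i, ∑ j, |(A k i j : ℝ)|) (fun _ _ => by positivity) (Finset.mem_univ k))
  have hn0 : (0 : ℝ) < n := by exact_mod_cast hn
  set W := ∑ v ∈ T, wt v with hW
  have hW0 : 0 ≤ W := Finset.sum_nonneg fun v _ => (wt_pos v).le
  set η := -(1 / n * ∑ v ∈ T, wt v * ∑ i, c v i) with hη
  have hη0 : 0 < η := by
    rw [hη, ← mul_neg]; exact mul_pos (by positivity) (by linarith)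
  set E0 := W * (2 * n * Λ + 3 * Λ + 2) + 2 with hE0
  have hE0p : 0 < E0 := by positivity
  obtain ⟨ε, hε, hε1, hεE⟩ : ∃ ε : ℝ, 0 < ε ∧ ε ≤ 1 ∧ E0 * ε ≤ η / 4 := by
    refine ⟨min 1 (η / 4 / E0), by positivity, min_le_left _ _, ?_⟩
    rw [mul_comm, ← le_div_iff₀ hE0p]; exact min_le_right _ _
  obtain ⟨m, hm, D, hD, hP⟩ := aux_poly n q hn A ε hε
  have hm1 : (1 : ℝ) ≤ m := by exact_mod_cast hm
  obtain ⟨C, hC1, σ, hσ, hroth⟩ := roth_lemma K m ε hε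
  have hlog : 0 ≤ Real.log (N + a) := Real.log_nonneg (by have : (0 : ℝ) ≤ N := Nat.cast_nonneg _; linarith)
  set H0 := 1 + C * (2 * m * D + 2) / c0 + 8 * W * (D + Real.log (N + a)) / η with hH0
  have hH1 : 1 ≤ H0 := by
    have h1 : 0 ≤ C * (2 * m * D + 2) / c0 := by positivity
    have h2 : 0 ≤ 8 * W * (D + Real.log (N + a)) / η := by positivity
    linarith
  have hHa : C * (2 * m * D + 2) ≤ H0 * c0 := by
    rw [← div_le_iff₀ hc0]
    have h2 : 0 ≤ 8 * W * (D + Real.log (N + a)) / η := by positivity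
    linarith
  have hHb : 8 * W * (D + Real.log (N + a)) ≤ H0 * η := by
    rw [← div_le_iff₀ hη0]
    have h1 : 0 ≤ C * (2 * m * D + 2) / c0 := by positivity
    linarith
  refine ⟨ε, hε, ?_⟩
  by_contra hcon
  push Not at hcon
  set L := 1 + 2 / σ with hL
  have hL1 : 1 ≤ L := by rw [hL]; exact le_add_of_nonneg_right (by positivity)
  choose hf xf Ff Af d1 d2 d3 d4 d5 d6 d7 d8 d9 using hcon
  let g : ℕ → ℝ := fun k => Nat.rec H0 (fun _ y => L * hf y) k
  have hg1 : ∀ k, g (k + 1) = L * hf (g k) := fun k => rfl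
  have hg0 : ∀ k, H0 ≤ g k := by
    intro k
    induction k with
    | zero => exact le_refl _
    | succ k ih =>
      rw [hg1]
      have := d9 (g k)
      nlinarith
  have hgm : ∀ k, g k ≤ hf (g k) := fun k => d9 _
  have hfp : ∀ k, 0 < hf (g k) := fun k => by linarith [hgm k, hg0 k]
  have hfL : ∀ k, L * hf (g k) ≤ hf (g (k + 1)) := fun k => by rw [← hg1]; exact hgm (k + 1)
  have hmono : Monotone fun k => hf (g k) := monotone_nat_of_le_succ fun k => by
    have := hfL k; have := hfp k; nlinarith
  let id' : Fin m → ℕ := fun h => m - 1 - h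
  let hh : Fin m → ℝ := fun h => hf (g (id' h))
  have hhp : ∀ h, 0 < hh h := fun h => hfp _
  have hhH : ∀ h, H0 ≤ hh h := fun h => (hg0 _).trans (hgm _)
  set R := hf (g m) / ε with hR
  have hRp : 0 < R := div_pos (hfp _) hε
  have hRh : ∀ h, hh h ≤ ε * R := by
    intro h
    rw [hR, mul_div_cancel₀ _ hε.ne']
    exact hmono (by simp only [id']; omega)
  let r : Fin m → ℕ := fun h => ⌈R / hh h⌉₊
  have hr1 : ∀ h, R ≤ r h * hh h := fun h => by
    rw [← div_le_iff₀ (hhp h)]; exact Nat.le_ceil _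
  have hr2 : ∀ h, r h * hh h ≤ (1 + ε) * R := fun h => by
    have h1 : (r h : ℝ) < R / hh h + 1 := Nat.ceil_lt_add_one (div_pos hRp (hhp h)).le
    have h2 := mul_lt_mul_of_pos_right h1 (hhp h)
    rw [add_mul, div_mul_cancel₀ _ (hhp h).ne'] at h2
    linarith [hRh h]
  have hr0 : ∀ h, 1 ≤ r h := fun h => Nat.one_le_ceil_iff.2 (div_pos hRp (hhp h))
  have hr3 : ∀ h, (r h : ℝ) * H0 ≤ 2 * R := fun h => by
    have h1 : (r h : ℝ) * H0 ≤ r h * hh h := mul_le_mul_of_nonneg_left (hhH h) (Nat.cast_nonneg _)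
    have h2 : (1 + ε) * R ≤ 2 * R := mul_le_mul_of_nonneg_right (by linarith) hRp.le
    linarith [hr2 h]
  have hH0p : 0 < H0 := by linarith
  have hrs : (∑ h, (r h : ℝ)) * H0 ≤ 2 * m * R := by
    rw [Finset.sum_mul]
    refine (Finset.sum_le_card_nsmul _ _ _ fun h _ => hr3 h).trans (le_of_eq ?_)
    simp; ring
  have hrs0 : 0 ≤ ∑ h, (r h : ℝ) := Finset.sum_nonneg fun h _ => Nat.cast_nonneg _
  obtain ⟨P, hP0, hhom, hPB, hPk⟩ := hP r hr0
  let x : Fin m → Fin n → K := fun h => xf (g (id' h))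
  let F : Fin m → Fin N → Fin n → K := fun h => Ff (g (id' h))
  obtain ⟨u, hu, hus⟩ := nonvan i1 p hp r P hP0 hhom x (fun h => d1 _) F (fun h => d3 _) (fun h => (r h : ℝ)⁻¹) ε (by
    intro Q hQ hQd hQ1
    refine hroth r (fun h => -(x h p / x h i1)) Q (D * ∑ h, (r h : ℝ)) (2 * R / H0) hQ hQd hr0 ?_ (by positivity) (hQ1.trans hPB) ?_ ?_
    · intro h h' hlt
      have h1 : L * hh h' ≤ hh h := by
        refine (hfL (id' h')).trans (hmono (a := id' h' + 1) (b := id' h) ?_)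
        simp only [id']; have := h.2; have := h'.2; have : (h : ℕ) < h' := hlt; omega
      have h2 : (r h : ℝ) * (L * hh h') ≤ 2 * R := (mul_le_mul_of_nonneg_left h1 (Nat.cast_nonneg _)).trans
        ((hr2 h).trans (mul_le_mul_of_nonneg_right (by linarith) hRp.le))
      have h3 : (r h : ℝ) * (2 / σ * hh h') ≤ 2 * (r h' * hh h') := by
        refine le_trans (mul_le_mul_of_nonneg_left (mul_le_mul_of_nonneg_right ?_ (hhp h').le) (Nat.cast_nonneg _)) (h2.trans (by linarith [hr1 h']))
        rw [hL]; linarith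
      have h4 : (r h : ℝ) * (2 / σ * hh h') = 2 * (r h / σ * hh h') := by ring
      rw [h4] at h3
      have h5 := le_of_mul_le_mul_right (le_of_mul_le_mul_left h3 two_pos) (hhp h')
      rw [div_le_iff₀ hσ] at h5
      linarith
    · intro h; rw [le_div_iff₀ hH0p]; exact hr3 h
    · intro h
      have h1 : r h * (c0 * hh h) ≤ r h * logHeight₁ (-(x h p / x h i1)) := mul_le_mul_of_nonneg_left (d2 _) (Nat.cast_nonneg _)
      refine le_trans ?_ h1
      have h2 : c0 * R ≤ r h * (c0 * hh h) := by
        have := mul_le_mul_of_nonneg_left (hr1 h) hc0.le; linarith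
      refine le_trans ?_ h2
      have h3 : ∑ h, (r h : ℝ) ≤ 2 * m * R / H0 := by rwa [le_div_iff₀ hH0p]
      calc C * (D * ∑ h, (r h : ℝ) + 2 * R / H0) ≤ C * (D * (2 * m * R / H0) + 2 * R / H0) := by gcongr
        _ = C * (2 * m * D + 2) * (R / H0) := by ring
        _ ≤ H0 * c0 * (R / H0) := mul_le_mul_of_nonneg_right hHa (by positivity)
        _ = c0 * R := by field_simp)
  have hfin := core hn A hA T hT kk c Λ a hcΛ hΛ ha ha0 i1 ε R (D * ∑ h, (r h : ℝ)) hε.le hε1 hRp.le hm r hr0 hh (fun h => (hhp h).le) hr1 hr2 P hhom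
    (fun k => (hPk k).1) (fun k => (hPk k).2) F (fun h => Af (g (id' h))) (fun h => d4 _) (fun h => d5 _) (fun h => d6 _) (fun h => d7 _) (fun h => d8 _) u hu hus
  have h1 : W * (D * ∑ h, (r h : ℝ) + (∑ h, (r h : ℝ)) * Real.log (N + a)) ≤ R * m * (η / 4) := by
    have h3 : ∑ h, (r h : ℝ) ≤ 2 * m * R / H0 := by rwa [le_div_iff₀ hH0p]
    calc _ = (8 * W * (D + Real.log (N + a))) * (∑ h, (r h : ℝ)) / 8 := by ring
      _ ≤ (H0 * η) * (2 * m * R / H0) / 8 := by gcongr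
      _ = _ := by field_simp; ring
  have h2 : R * m * (1 / n * (∑ v ∈ T, wt v * ∑ i, c v i) + W * ε * (2 * n * Λ + 3 * Λ + 2) + 2 * ε) ≤ R * m * (-η + η / 4) := by
    refine mul_le_mul_of_nonneg_left ?_ (by positivity)
    rw [hE0] at hεE
    linarith
  have h4 : 0 < R * m * η := by positivity
  rw [← hW] at hfin
  linarith
end
section
variable {M : Type*} [AddCommGroup M]
structure IsNm (nm : M → ℝ) : Prop where
  hz : ∀ (k : ℤ) z, nm (k • z) = |(k : ℝ)| * nm z
  ha : ∀ x y, nm (x + y) ≤ nm x + nm y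
namespace IsNm
variable {nm : M → ℝ} (H : IsNm nm)
lemma zero (H : IsNm nm) : nm 0 = 0 := by simpa using H.hz 0 0
lemma neg (H : IsNm nm) (z) : nm (-z) = nm z := by simpa using H.hz (-1) z
lemma nonneg (H : IsNm nm) (z) : 0 ≤ nm z := by
  have := H.ha z (-z); rw [H.neg, add_neg_cancel, H.zero] at this; linarith
lemma sub (H : IsNm nm) (x y) : nm (x - y) ≤ nm x + nm y := by
  rw [sub_eq_add_neg, ← H.neg y]; exact H.ha _ _
lemma sum (H : IsNm nm) {ι : Type*} (s : Finset ι) (f : ι → M) : nm (∑ i ∈ s, f i) ≤ ∑ i ∈ s, nm (f i) := by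
  classical
  induction s using Finset.induction_on with
  | empty => simp [H.zero]
  | insert a t ha ih => rw [Finset.sum_insert ha, Finset.sum_insert ha]; exact (H.ha _ _).trans (by gcongr)
lemma hn (H : IsNm nm) (k : ℕ) (z) : nm (k • z) = k * nm z := by
  have := H.hz k z; simpa using this
end IsNm
variable (nm : M → ℝ) (B : Submodule ℤ M)
noncomputable def qn (q : M ⧸ B) : ℝ := sInf {y | ∃ (k : ℕ) (z : M), 0 < k ∧ B.mkQ z = k • q ∧ y = nm z / k}
variable {nm} (H : IsNm nm)
lemma qn_le (H : IsNm nm) {q : M ⧸ B} {k : ℕ} {z : M} (hk : 0 < k) (h : B.mkQ z = k • q) : qn nm B q ≤ nm z / k :=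
  csInf_le ⟨0, by rintro _ ⟨k, z, _, _, rfl⟩; exact div_nonneg (H.nonneg _) (Nat.cast_nonneg _)⟩ ⟨k, z, hk, h, rfl⟩
lemma qn_mk_le (H : IsNm nm) (z : M) : qn nm B (B.mkQ z) ≤ nm z := by
  simpa using qn_le B H (q := B.mkQ z) (z := z) one_pos (by simp)
lemma qn_ne (nm : M → ℝ) (B : Submodule ℤ M) (q : M ⧸ B) : {y | ∃ (k : ℕ) (z : M), 0 < k ∧ B.mkQ z = k • q ∧ y = nm z / k}.Nonempty := by
  obtain ⟨z, rfl⟩ := B.mkQ_surjective q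
  exact ⟨_, 1, z, one_pos, by simp, rfl⟩
lemma le_qn {q : M ⧸ B} {a : ℝ} (h : ∀ (k : ℕ) z, 0 < k → B.mkQ z = k • q → a ≤ nm z / k) : a ≤ qn nm B q :=
  le_csInf (qn_ne nm B q) (by rintro _ ⟨k, z, hk, hz, rfl⟩; exact h k z hk hz)
lemma qn_lt {q : M ⧸ B} {a : ℝ} (h : qn nm B q < a) : ∃ (k : ℕ) (z : M), 0 < k ∧ B.mkQ z = k • q ∧ nm z / k < a := by
  obtain ⟨_, ⟨k, z, hk, hz, rfl⟩, hlt⟩ := exists_lt_of_csInf_lt (qn_ne nm B q) h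
  exact ⟨k, z, hk, hz, hlt⟩
lemma qn_isNm (H : IsNm nm) : IsNm (qn nm B) := by
  have h0 : ∀ q, 0 ≤ qn nm B q := fun q => le_qn B fun k z _ _ => div_nonneg (H.nonneg _) (Nat.cast_nonneg _)
  constructor
  · intro l q
    apply le_antisymm
    · rcases eq_or_ne l 0 with rfl | hl
      · simpa [H.zero] using qn_le B H (q := (0 : ℤ) • q) (z := 0) one_pos (by simp)
      have hl' : 0 < |(l : ℝ)| := abs_pos.2 (by exact_mod_cast hl)
      rw [← div_le_iff₀' hl']
      refine le_qn B fun k z hk hz => ?_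
      rw [div_le_iff₀' hl']
      have := qn_le B H (q := l • q) (z := l • z) hk (by rw [map_smul, hz, smul_comm])
      rw [H.hz] at this
      rwa [mul_div_assoc] at this
    · rcases lt_trichotomy l 0 with hl | rfl | hl
      · refine le_qn B fun k z hk hz => ?_
        have hl2 : ((l.natAbs : ℕ) : ℤ) = -l := by omega
        have h3 : (l.natAbs : ℝ) = |(l : ℝ)| := by rw [Nat.cast_natAbs, Int.cast_abs]
        have hlp : 0 < |(l : ℝ)| := abs_pos.2 (by exact_mod_cast hl.ne)
        have := qn_le B H (q := q) (z := -z) (k := k * l.natAbs) (Nat.mul_pos hk (Int.natAbs_pos.2 hl.ne)) (by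
          rw [map_neg, hz, mul_smul, ← natCast_zsmul q, hl2, neg_smul, smul_neg])
        rw [H.neg] at this; push_cast at this; rw [h3, ← div_div, le_div_iff₀' hlp] at this
        exact this
      · simpa using h0 _
      · refine le_qn B fun k z hk hz => ?_
        have hl2 : ((l.natAbs : ℕ) : ℤ) = l := by omega
        have h3 : (l.natAbs : ℝ) = |(l : ℝ)| := by rw [Nat.cast_natAbs, Int.cast_abs]
        have hlp : 0 < |(l : ℝ)| := abs_pos.2 (by exact_mod_cast hl.ne')
        have := qn_le B H (q := q) (z := z) (k := k * l.natAbs) (Nat.mul_pos hk (Int.natAbs_pos.2 hl.ne')) (by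
          rw [hz, mul_smul, ← natCast_zsmul q, hl2])
        push_cast at this; rw [h3, ← div_div, le_div_iff₀' hlp] at this
        exact this
  · intro p q
    refine le_of_forall_pos_lt_add fun ε hε => ?_
    obtain ⟨k, z, hk, hz, hlt⟩ := qn_lt B (show qn nm B p < qn nm B p + ε / 2 by linarith)
    obtain ⟨l, y, hl, hy, hlt'⟩ := qn_lt B (show qn nm B q < qn nm B q + ε / 2 by linarith)
    have h1 := qn_le B H (q := p + q) (k := k * l) (z := l • z + k • y) (by positivity) (by
      simp only [map_add, map_nsmul, hz, hy, smul_add, smul_smul]; rw [mul_comm l k])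
    have h2 := H.ha (l • z) (k • y)
    rw [H.hn, H.hn] at h2
    have hk' : (0 : ℝ) < k := by exact_mod_cast hk
    have hl' : (0 : ℝ) < l := by exact_mod_cast hl
    have h3 : nm (l • z + k • y) / ((k * l : ℕ) : ℝ) ≤ nm z / k + nm y / l := by
      rw [div_le_iff₀ (by positivity)]
      refine h2.trans (le_of_eq ?_)
      push_cast; field_simp
    linarith
lemma int_round (l : ℤ) (k : ℕ) (hk : 0 < k) : ∃ l' : ℤ, |((l - k * l' : ℤ) : ℝ)| ≤ k / 2 := by
  refine ⟨round ((l : ℝ) / k), ?_⟩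
  have hk' : (0 : ℝ) < k := by exact_mod_cast hk
  have := abs_sub_round ((l : ℝ) / k)
  have h2 : ((l - k * round ((l : ℝ) / k) : ℤ) : ℝ) = k * ((l : ℝ) / k - round ((l : ℝ) / k)) := by
    push_cast; field_simp
  rw [h2, abs_mul, abs_of_pos hk']
  nlinarith
theorem latT (N0 : ℕ) : ∃ C : ℝ, 1 ≤ C ∧ ∀ (M : Type) [AddCommGroup M] [Module.Finite ℤ M] (nm : M → ℝ) (H : IsNm nm) (μ : ℝ)
    (hμ : 0 < μ) (hpos : ∀ z, z ≠ 0 → μ ≤ nm z) (hr : Module.finrank ℤ M ≤ N0),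
    ∃ (e : Fin N0 → M) (t : Fin N0 → M →ₗ[ℤ] ℤ), (∀ z, z = ∑ k, t k z • e k) ∧ ∀ k z, |(t k z : ℝ)| * nm (e k) ≤ C * nm z := by
  induction N0 with
  | zero =>
    refine ⟨1, le_refl _, fun M _ _ nm H μ hμ hpos hr => ⟨0, 0, fun z => ?_, fun k => k.elim0⟩⟩
    have htf : Module.IsTorsionFree ℤ M := by
      refine Module.IsTorsionFree.of_smul_eq_zero fun k z h => ?_
      by_contra hcon
      push Not at hcon
      have h1 := H.hz k z
      rw [h, H.zero] at h1
      have h2 := hpos z hcon.2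
      have h3 : 0 < |(k : ℝ)| := abs_pos.2 (by exact_mod_cast hcon.1)
      have := mul_pos h3 (lt_of_lt_of_le hμ h2)
      linarith
    have := Module.finrank_eq_zero_iff_of_free (R := ℤ) (M := M) |>.1 (by omega)
    exact Subsingleton.elim _ _
  | succ N0 ih =>
    obtain ⟨C', hC', ih⟩ := ih
    refine ⟨1 + 7 * (N0 + 1) * C', le_add_of_nonneg_right (by positivity), fun M _ _ nm H μ hμ hpos hr => ?_⟩
    by_cases htriv : Subsingleton M
    · refine ⟨0, 0, fun z => Subsingleton.elim _ _, fun k z => ?_⟩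
      simpa [H.zero] using mul_nonneg (by positivity : 0 ≤ 1 + 7 * ((N0 : ℝ) + 1) * C') (H.nonneg z)
    rw [not_subsingleton_iff_nontrivial] at htriv
    have hne : (nm '' {z | z ≠ 0}).Nonempty := by
      obtain ⟨z, hz⟩ := exists_ne (0 : M); exact ⟨_, z, hz, rfl⟩
    have hbd : BddBelow (nm '' {z | z ≠ 0}) := ⟨μ, by rintro _ ⟨z, hz, rfl⟩; exact hpos z hz⟩
    set m0 := sInf (nm '' {z | z ≠ 0}) with hm0
    have hm0p : 0 < m0 := lt_of_lt_of_le hμ (le_csInf hne (by rintro _ ⟨z, hz, rfl⟩; exact hpos z hz))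
    have hm0le : ∀ z, z ≠ 0 → m0 ≤ nm z := fun z hz => csInf_le hbd ⟨z, hz, rfl⟩
    obtain ⟨_, ⟨b, hb, rfl⟩, hbm⟩ := exists_lt_of_csInf_lt hne (show m0 < 1.5 * m0 by linarith)
    set B := Submodule.span ℤ {b} with hB
    have hround : ∀ (z z' : M) (k : ℕ), 0 < k → B.mkQ z' = k • B.mkQ z → ∃ l' : ℤ, nm (z + l' • b) ≤ nm z' / k + nm b / 2 := by
      intro z z' k hk hz
      have h1 : z' - k • z ∈ B := by
        rw [← Submodule.ker_mkQ B, LinearMap.mem_ker, map_sub, hz, map_nsmul, sub_self]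
      obtain ⟨l, hl⟩ := Submodule.mem_span_singleton.1 h1
      obtain ⟨l', hl'⟩ := int_round l k hk
      refine ⟨l', ?_⟩
      have hk' : (0 : ℝ) < k := by exact_mod_cast hk
      have h2 : k • (z + l' • b) = z' - (l - k * l' : ℤ) • b := by
        rw [sub_smul, hl, mul_smul, smul_add, natCast_zsmul]; abel
      have h3 := H.sub z' ((l - k * l' : ℤ) • b)
      rw [← h2, H.hn, H.hz] at h3
      have h4 := mul_le_mul_of_nonneg_right hl' (H.nonneg b)
      have h5 : (k : ℝ) * nm (z + l' • b) ≤ k * (nm z' / k + nm b / 2) := by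
        rw [mul_add, mul_div_cancel₀ _ hk'.ne']; linarith
      exact le_of_mul_le_mul_left h5 hk'
    have hqpos : ∀ q : M ⧸ B, q ≠ 0 → m0 / 4 ≤ qn nm B q := by
      intro q hq
      by_contra hcon
      push Not at hcon
      obtain ⟨k, z', hk, hz', hlt⟩ := qn_lt B hcon
      obtain ⟨z, rfl⟩ := B.mkQ_surjective q
      obtain ⟨l', hl'⟩ := hround z z' k hk hz'
      have hne0 : z + l' • b ≠ 0 := by
        intro h0
        apply hq
        have : z = -(l' • b) := eq_neg_of_add_eq_zero_left h0
        rw [← LinearMap.mem_ker, Submodule.ker_mkQ, this]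
        exact neg_mem (Submodule.smul_mem _ _ (Submodule.mem_span_singleton_self b))
      have := hm0le _ hne0
      linarith
    have hlift : ∀ q : M ⧸ B, ∃ e, B.mkQ e = q ∧ nm e ≤ 7 * qn nm B q := by
      intro q
      rcases eq_or_ne q 0 with rfl | hq
      · exact ⟨0, by simp, by rw [H.zero]; have := (qn_isNm B H).nonneg 0; linarith⟩
      obtain ⟨z, rfl⟩ := B.mkQ_surjective q
      have hqp := hqpos _ hq
      obtain ⟨k, z', hk, hz', hlt⟩ := qn_lt B (show qn nm B (B.mkQ z) < qn nm B (B.mkQ z) + m0 / 2 by linarith)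
      obtain ⟨l', hl'⟩ := hround z z' k hk hz'
      refine ⟨z + l' • b, ?_, by linarith⟩
      have hb0 : B.mkQ b = 0 := by
        rw [← LinearMap.mem_ker, Submodule.ker_mkQ]; exact Submodule.mem_span_singleton_self b
      rw [map_add, map_smul, hb0, smul_zero, add_zero]
    have htf : Module.IsTorsionFree ℤ M := by
      refine Module.IsTorsionFree.of_smul_eq_zero fun k z h => ?_
      by_contra hcon
      push Not at hcon
      have h1 := H.hz k z
      rw [h, H.zero] at h1
      have h2 := hpos z hcon.2
      have h3 : 0 < |(k : ℝ)| := abs_pos.2 (by exact_mod_cast hcon.1)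
      have := mul_pos h3 (lt_of_lt_of_le hμ h2)
      linarith
    let eqv := LinearEquiv.toSpanNonzeroSingleton ℤ M b hb
    have hfr : Module.finrank ℤ (M ⧸ B) ≤ N0 := by
      have h1 := Submodule.finrank_quotient_add_finrank B
      have h2 : Module.finrank ℤ B = 1 := by
        rw [← eqv.finrank_eq]; simp
      omega
    obtain ⟨eb, tb, hdec, hbound⟩ := ih (M ⧸ B) (qn nm B) (qn_isNm B H) (m0 / 4) (by positivity) hqpos hfr
    choose lft hl1 hl2 using hlift
    let pr : M →ₗ[ℤ] M := LinearMap.id - ∑ k, ((tb k).comp B.mkQ).smulRight (lft (eb k))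
    have hpr : ∀ z, pr z = z - ∑ k, tb k (B.mkQ z) • lft (eb k) := fun z => by simp [pr]
    have hprB : ∀ z, pr z ∈ B := by
      intro z
      rw [← Submodule.ker_mkQ B, LinearMap.mem_ker, hpr, map_sub, map_sum]
      simp only [map_smul, hl1]
      rw [← hdec, sub_self]
    let t0 : M →ₗ[ℤ] ℤ := eqv.symm.toLinearMap.comp (pr.codRestrict B hprB)
    have ht0 : ∀ z, t0 z • b = pr z := by
      intro z
      have h1 : eqv (t0 z) = pr.codRestrict B hprB z := by simp [t0]
      have h2 := congrArg Subtype.val h1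
      simpa [eqv] using h2
    have hbd2 : ∀ k z, |(tb k (B.mkQ z) : ℝ)| * nm (lft (eb k)) ≤ 7 * C' * nm z := by
      intro k z
      calc _ ≤ |(tb k (B.mkQ z) : ℝ)| * (7 * qn nm B (eb k)) := by gcongr; exact hl2 _
        _ = 7 * (|(tb k (B.mkQ z) : ℝ)| * qn nm B (eb k)) := by ring
        _ ≤ 7 * (C' * qn nm B (B.mkQ z)) := mul_le_mul_of_nonneg_left (hbound k (B.mkQ z)) (by norm_num)
        _ ≤ 7 * (C' * nm z) := by gcongr; exact qn_mk_le B H z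
        _ = _ := by ring
    refine ⟨Fin.cons b (fun k => lft (eb k)), Fin.cons t0 (fun k => (tb k).comp B.mkQ), fun z => ?_, fun k z => ?_⟩
    · rw [Fin.sum_univ_succ]
      simp only [Fin.cons_zero, Fin.cons_succ, ht0, hpr, LinearMap.comp_apply]
      abel
    · have hN := H.nonneg z
      refine Fin.cases ?_ (fun k => ?_) k
      · simp only [Fin.cons_zero]
        rw [← H.hz, ht0, hpr]
        refine (H.sub _ _).trans ?_
        have : nm (∑ k, tb k (B.mkQ z) • lft (eb k)) ≤ N0 * (7 * C' * nm z) := by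
          refine (H.sum _ _).trans ((Finset.sum_le_card_nsmul _ _ (7 * C' * nm z) fun k _ => ?_).trans (by simp))
          rw [H.hz]; exact hbd2 k z
        have h7 : 0 ≤ 7 * C' * nm z := by positivity
        nlinarith
      · simp only [Fin.cons_succ, LinearMap.comp_apply]
        refine (hbd2 k z).trans ?_
        have h7 : 0 ≤ 7 * C' * nm z := by positivity
        have h8 : 0 ≤ (N0 : ℝ) * (7 * C' * nm z) := by positivity
        nlinarith
end
section
variable {K : Type*} [Field K] [NumberField K]
lemma pv_oint (v : FinitePlace K) (a : 𝓞 K) : pv (Sum.inr v) (a : K) ≤ 1 := by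
  rw [pv_inr, ← v.norm_embedding_eq]
  exact FinitePlace.norm_le_one K _ a
lemma loc_int (v : FinitePlace K) (a b : 𝓞 K) (hb : b ≠ 0) (h : v (a : K) ≤ v (b : K)) :
    ∃ s c : 𝓞 K, v (s : K) = 1 ∧ a * s = b * c := by
  have hb' : (b : K) ≠ 0 := by simpa using hb
  have h1 : v ((a : K) / b) ≤ 1 := by
    rw [map_div₀]; exact div_le_one_of_le₀ h (apply_nonneg v _)
  rw [← v.norm_embedding_eq, FinitePlace.norm_embedding'] at h1
  have h2 : (v.maximalIdeal).valuation K ((a : K) / b) ≤ 1 := by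
    rw [← (WithZeroMulInt.toNNReal_strictMono (RingOfIntegers.HeightOneSpectrum.one_lt_absNorm_nnreal v.maximalIdeal)).le_iff_le]
    rw [map_one]; exact_mod_cast h1
  obtain ⟨c, s, hcs⟩ := v.maximalIdeal.exists_primeCompl_mul_eq_of_integer _ h2
  refine ⟨s, c, ?_, ?_⟩
  · rw [← v.norm_embedding_eq]
    exact (FinitePlace.norm_eq_one_iff_notMem K _ _).2 s.2
  · apply RingOfIntegers.coe_injective
    field_simp at hcs
    simpa using hcs
lemma exists_tau (w : InfinitePlace K) : ∃ u : 𝓞 K, 0 < w (u : K) ∧ ∀ w' : InfinitePlace K, w' ≠ w → w' (u : K) < w (u : K) := by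
  obtain ⟨u, hu⟩ := NumberField.Units.dirichletUnitTheorem.exists_unit K w
  have hu0 : ((u : 𝓞 K) : K) ≠ 0 := by simp
  have hlt : ∀ w' : InfinitePlace K, w' ≠ w → w' ((u : 𝓞 K) : K) < 1 := fun w' h =>
    (Real.log_neg_iff (InfinitePlace.pos_iff.2 hu0)).1 (hu w' h)
  refine ⟨u, InfinitePlace.pos_iff.2 hu0, fun w' h => (hlt w' h).trans_le ?_⟩
  by_contra hcon
  push Not at hcon
  have hall : ∀ v : InfinitePlace K, v ((u : 𝓞 K) : K) < 1 := fun v => by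
    by_cases hv : v = w
    · rw [hv]; exact hcon
    · exact hlt v hv
  have h1 := InfinitePlace.prod_eq_abs_norm ((u : 𝓞 K) : K)
  rw [show |(Algebra.norm ℚ) ((u : 𝓞 K) : K)| = 1 from NumberField.isUnit_iff_norm.1 u.isUnit] at h1
  have h2 : ∏ v : InfinitePlace K, v ((u : 𝓞 K) : K) ^ v.mult < 1 := by
    rw [← Finset.prod_const_one (s := (Finset.univ : Finset (InfinitePlace K)))]
    refine Finset.prod_lt_prod_of_nonempty (fun v _ => pow_pos (InfinitePlace.pos_iff.2 hu0) _) (fun v _ => ?_) Finset.univ_nonempty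
    exact pow_lt_one₀ (apply_nonneg v _) (hall v) v.mult_ne_zero
  rw [h1] at h2; norm_num at h2
variable (K) in
abbrev JJ := Module.Free.ChooseBasisIndex ℤ (𝓞 K)
variable (K) in
lemma exists_round : ∃ C : ℝ, 0 < C ∧ ∀ y : K, ∃ y' : 𝓞 K, ∀ v : InfinitePlace K, v (y' - y) ≤ C := by
  classical
  refine ⟨1 + ∑ v : InfinitePlace K, ∑ j : JJ K, v (integralBasis K j), by positivity, fun y => ?_⟩
  refine ⟨∑ j, round ((integralBasis K).repr y j) • RingOfIntegers.basis K j, fun v => ?_⟩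
  have h1 : ((∑ j, round ((integralBasis K).repr y j) • RingOfIntegers.basis K j : 𝓞 K) : K) - y =
      ∑ j, (((round ((integralBasis K).repr y j) : ℚ) - (integralBasis K).repr y j : ℚ) : K) * integralBasis K j := by
    rw [Finset.sum_congr rfl fun j _ => show (((round ((integralBasis K).repr y j) : ℚ) - (integralBasis K).repr y j : ℚ) : K) * integralBasis K j =
      (round ((integralBasis K).repr y j) : K) * integralBasis K j - (integralBasis K).repr y j • integralBasis K j by
        rw [Rat.smul_def]; push_cast; ring, Finset.sum_sub_distrib, (integralBasis K).sum_repr y]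
    simp [zsmul_eq_mul]
  rw [h1]
  have h2 : ∑ j : JJ K, v (integralBasis K j) ≤ ∑ v : InfinitePlace K, ∑ j : JJ K, v (integralBasis K j) :=
    Finset.single_le_sum (f := fun v : InfinitePlace K => ∑ j : JJ K, v (integralBasis K j)) (fun v _ => Finset.sum_nonneg fun j _ => apply_nonneg v _) (Finset.mem_univ v)
  refine ((pv (Sum.inl v)).sum_le _ _).trans (le_trans (Finset.sum_le_sum fun j _ => ?_) (h2.trans (by linarith)))
  rw [pv_inl]
  rw [map_mul]
  refine mul_le_of_le_one_left (apply_nonneg v _) ?_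
  have h3 := abs_sub_round ((integralBasis K).repr y j)
  rw [← v.norm_embedding_eq, map_ratCast, Complex.norm_ratCast]
  rw [abs_sub_comm] at h3
  have h4 := h3.trans (by norm_num : (1 / 2 : ℚ) ≤ 1)
  exact_mod_cast h4
section
variable {W : Type*} [AddCommGroup W] [Module (𝓞 K) W]
noncomputable def trF (t : W →ₗ[ℤ] ℤ) (z : W) : K := ∑ j : JJ K, (t (RingOfIntegers.basis K j • z) : K) * (integralBasis K).traceDual j
lemma trF_add (t : W →ₗ[ℤ] ℤ) (y z : W) : (trF t (y + z) : K) = trF t y + trF t z := by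
  simp [trF, ← Finset.sum_add_distrib, add_mul]
lemma trF_tr (t : W →ₗ[ℤ] ℤ) (z : W) (a : 𝓞 K) : Algebra.trace ℚ K ((a : K) * trF t z) = t (a • z) := by
  have h1 : a = ∑ i, (RingOfIntegers.basis K).repr a i • RingOfIntegers.basis K i := ((RingOfIntegers.basis K).sum_repr a).symm
  have h2 : ∀ i, Algebra.trace ℚ K (integralBasis K i * trF t z) = t (RingOfIntegers.basis K i • z) := by
    intro i
    classical
    have : ∀ j, integralBasis K i * ((t (RingOfIntegers.basis K j • z) : K) * (integralBasis K).traceDual j) =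
      ((t (RingOfIntegers.basis K j • z) : ℚ)) • (integralBasis K i * (integralBasis K).traceDual j) := by
      intro j; rw [Rat.smul_def]; push_cast; ring
    rw [trF, Finset.mul_sum, map_sum]
    simp_rw [this, map_smul, Module.Basis.trace_mul_traceDual]
    simp
  conv_lhs => rw [h1]
  conv_rhs => rw [h1]
  simp only [Finset.sum_smul, map_sum, Finset.sum_mul]
  push_cast
  refine Finset.sum_congr rfl fun i _ => ?_
  have : ((RingOfIntegers.basis K).repr a i • ((RingOfIntegers.basis K i : 𝓞 K) : K)) * trF t z =
    ((RingOfIntegers.basis K).repr a i : ℚ) • (integralBasis K i * trF t z) := by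
    rw [Rat.smul_def, integralBasis_apply, zsmul_eq_mul, mul_assoc]; push_cast; rfl
  rw [this, map_smul, h2, smul_assoc, LinearMap.map_smul t]
  simp
lemma trF_ext {x y : K} (h : ∀ a : 𝓞 K, Algebra.trace ℚ K ((a : K) * x) = Algebra.trace ℚ K ((a : K) * y)) : x = y := by
  apply (integralBasis K).traceDual.repr.injective
  ext j
  rw [Module.Basis.traceDual_repr_apply, Module.Basis.traceDual_repr_apply, Algebra.traceForm_apply, Algebra.traceForm_apply, mul_comm x, mul_comm y, integralBasis_apply]
  exact h _
lemma trF_smul (t : W →ₗ[ℤ] ℤ) (a : 𝓞 K) (z : W) : (trF t (a • z) : K) = a * trF t z := by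
  apply trF_ext
  intro b
  rw [trF_tr, ← mul_assoc, smul_smul, ← trF_tr]
  push_cast; rfl
lemma trF_zero {t : W →ₗ[ℤ] ℤ} {z : W} (h : (trF t z : K) = 0) : t z = 0 := by
  have := trF_tr (K := K) t z 1
  rw [h, mul_zero, map_zero, one_smul] at this
  exact_mod_cast this.symm
end
end
section
variable {K : Type*} [Field K]
lemma dav {ι : Type*} [Fintype ι] [DecidableEq ι] (ν : AbsoluteValue K ℝ) (Vs : ℕ → Submodule K (ι → K)) (ρ : ℕ → ℝ) (hρ : ∀ j, 0 < ρ j)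
    (hanti : Antitone ρ) (hmono : Monotone Vs) (m : ℕ) : (∀ k ≤ m, Module.finrank K (Vs k) ≤ k + 1) → ∀ (I : Finset ι), I.card = m + 1 → ∀ (C : ℝ), 0 ≤ C → 
    (∀ z ∈ Vs m, ∀ i, ν (z i) ≤ C * ∑ l ∈ I, ν (z l)) → ∃ w : ι → ℝ, (∀ i ∈ I, ∃ j ≤ m, w i = ρ j) ∧
      ∑ i ∈ I, Real.log (w i) = ∑ j ∈ Finset.range (m + 1), Real.log (ρ j) ∧
      ∀ j ≤ m, ∀ z ∈ Vs j, ∀ i, ρ j * ν (z i) ≤ 2 ^ m * C * ∑ l ∈ I, w l * ν (z l) := by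
  induction m with
  | zero =>
    intro _ I hI C hC h
    obtain ⟨i0, rfl⟩ := Finset.card_eq_one.1 hI
    refine ⟨fun _ => ρ 0, fun i _ => ⟨0, le_refl _, rfl⟩, by simp, fun j hj z hz i => ?_⟩
    obtain rfl : j = 0 := by omega
    have := h z hz i
    simp only [Finset.sum_singleton] at this ⊢
    have h2 := mul_le_mul_of_nonneg_left this (hρ 0).le
    linarith
  | succ m ih =>
    intro hV I hI C hC h
    obtain ⟨r, hr0, hr⟩ : ∃ r : I → K, r ≠ 0 ∧ ∀ z ∈ Vs m, ∑ i : I, z i * r i = 0 := by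
      let res : (ι → K) →ₗ[K] (I → K) := LinearMap.funLeft K K Subtype.val
      have hlt : (Vs m).map res < ⊤ := by
        apply Submodule.lt_top_of_finrank_lt_finrank
        refine (Submodule.finrank_map_le _ _).trans_lt ?_
        have := hV m (by omega)
        rw [Module.finrank_fintype_fun_eq_card, Fintype.card_coe]; omega
      obtain ⟨f, hf0, hf⟩ := Submodule.exists_le_ker_of_lt_top _ hlt
      refine ⟨fun i => f (Pi.single i 1), fun h0 => hf0 ?_, fun z hz => ?_⟩
      · refine LinearMap.pi_ext' fun i => LinearMap.ext_ring ?_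
        simpa using congrFun h0 i
      · have := hf (Submodule.mem_map_of_mem hz)
        rw [LinearMap.mem_ker, LinearMap.pi_apply_eq_sum_univ] at this
        rw [← this]
        refine Finset.sum_congr rfl fun i _ => ?_
        simp only [res, LinearMap.funLeft_apply, smul_eq_mul]
        congr 2
        ext j; simp [Pi.single_apply, eq_comm]
    have hne : (Finset.univ : Finset I).Nonempty := by
      by_contra hcon
      rw [Finset.not_nonempty_iff_eq_empty, Finset.univ_eq_empty_iff] at hcon
      exact hr0 (Subsingleton.elim _ _)
    obtain ⟨i0, -, hmax⟩ := Finset.exists_max_image Finset.univ (fun i => ν (r i)) hne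
    have hpos : 0 < ν (r i0) := by
      obtain ⟨i1, hi1⟩ := Function.ne_iff.1 hr0
      exact (ν.pos hi1).trans_le (hmax i1 (Finset.mem_univ _))
    have hi0 := i0.2
    have hrem : ∀ z ∈ Vs m, ν (z i0) ≤ ∑ l ∈ I.erase i0, ν (z l) := by
      intro z hz
      have h1 := hr z hz
      have h2 : z i0 * r i0 = -∑ i ∈ Finset.univ.erase i0, z i * r i := by
        rw [← Finset.add_sum_erase _ _ (Finset.mem_univ i0)] at h1
        exact eq_neg_of_add_eq_zero_left h1
      have h3 : ν (z i0) * ν (r i0) ≤ (∑ l ∈ I.erase i0, ν (z l)) * ν (r i0) := by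
        rw [← map_mul, h2, ν.map_neg]
        refine (ν.sum_le _ _).trans ?_
        have h4 : ∑ l ∈ I.erase i0, ν (z l) = ∑ i ∈ Finset.univ.erase i0, ν (z i) := by
          symm
          refine Finset.sum_bij (fun (i : I) _ => (i : ι)) ?_ ?_ ?_ ?_
          · intro a ha; simp at ha ⊢; exact ha
          · intro a _ b _ hab; exact Subtype.ext hab
          · intro b hb
            obtain ⟨hb1, hb2⟩ := Finset.mem_erase.1 hb
            exact ⟨⟨b, hb2⟩, by simp; intro h; exact hb1 (by rw [← h]), rfl⟩
          · intros; rfl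
        rw [h4, Finset.sum_mul]
        refine Finset.sum_le_sum fun i _ => ?_
        rw [map_mul]
        exact mul_le_mul_of_nonneg_left (hmax i (Finset.mem_univ _)) (ν.nonneg _)
      exact le_of_mul_le_mul_right h3 hpos
    have hs0 : ∀ z : ι → K, 0 ≤ ∑ l ∈ I.erase i0, ν (z l) := fun z => Finset.sum_nonneg fun l _ => ν.nonneg _
    have hsum : ∀ f : ι → ℝ, ∑ l ∈ I, f l = f i0 + ∑ l ∈ I.erase i0, f l := fun f => (Finset.add_sum_erase I f hi0).symm
    obtain ⟨w', hw1, hw2, hw3⟩ := ih (fun k hk => hV k (by omega)) (I.erase i0) (by rw [Finset.card_erase_of_mem hi0]; omega) (2 * C) (by positivity) (by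
      intro z hz i
      refine (h z (hmono (Nat.le_succ m) hz) i).trans ?_
      rw [hsum fun l => ν (z l)]
      have := mul_le_mul_of_nonneg_left (hrem z hz) hC
      linarith)
    have hupd : ∀ f : ι → ℝ → ℝ, ∑ l ∈ I.erase i0, f l (Function.update w' (i0 : ι) (ρ (m + 1)) l) = ∑ l ∈ I.erase i0, f l (w' l) := fun f =>
      Finset.sum_congr rfl fun l hl => by rw [Function.update_of_ne (Finset.ne_of_mem_erase hl)]
    have hw : ∀ i ∈ I, ∃ j ≤ m + 1, Function.update w' (i0 : ι) (ρ (m + 1)) i = ρ j := by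
      intro i hi
      by_cases hii : i = i0
      · exact ⟨m + 1, le_refl _, by rw [hii, Function.update_self]⟩
      · obtain ⟨j, hj, hj'⟩ := hw1 i (Finset.mem_erase.2 ⟨hii, hi⟩)
        exact ⟨j, by omega, by rw [Function.update_of_ne hii, hj']⟩
    refine ⟨Function.update w' (i0 : ι) (ρ (m + 1)), hw, ?_, fun j hj z hz i => ?_⟩
    · rw [hsum, hupd fun l x => Real.log x, hw2, Finset.sum_range_succ _ (m + 1), Function.update_self, add_comm]
    · rcases Nat.lt_or_ge m j with hjm | hjm
      · obtain rfl : j = m + 1 := by omega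
        have h1 := mul_le_mul_of_nonneg_left (h z hz i) (hρ (m + 1)).le
        refine h1.trans ?_
        have h2 : ρ (m + 1) * ∑ l ∈ I, ν (z l) ≤ ∑ l ∈ I, Function.update w' (i0 : ι) (ρ (m + 1)) l * ν (z l) := by
          rw [Finset.mul_sum]
          refine Finset.sum_le_sum fun l hl => ?_
          obtain ⟨j, hj, hj'⟩ := hw l hl
          rw [hj']
          exact mul_le_mul_of_nonneg_right (hanti hj) (ν.nonneg _)
        have h3 : (0 : ℝ) ≤ ρ (m + 1) * ∑ l ∈ I, ν (z l) := mul_nonneg (hρ _).le (Finset.sum_nonneg fun l _ => ν.nonneg _)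
        calc _ = C * (ρ (m + 1) * ∑ l ∈ I, ν (z l)) := by ring
          _ ≤ C * ∑ l ∈ I, Function.update w' (i0 : ι) (ρ (m + 1)) l * ν (z l) := mul_le_mul_of_nonneg_left h2 hC
          _ ≤ _ := by
            refine mul_le_mul_of_nonneg_right ?_ (h3.trans h2)
            exact le_mul_of_one_le_left hC (one_le_pow₀ (by norm_num))
      · refine (hw3 j hjm z hz i).trans ?_
        rw [hsum, hupd fun l x => x * ν (z l), Function.update_self, pow_succ, show (2 : ℝ) ^ m * 2 * C = 2 ^ m * (2 * C) by ring]
        refine mul_le_mul_of_nonneg_left ?_ (by positivity)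
        have := mul_nonneg (hρ (m + 1)).le (ν.nonneg (z i0))
        linarith
end
section
variable {K : Type*} [Field K] [NumberField K] {m : ℕ}
def cz {ι : Type*} (z : ι → 𝓞 K) : ι → K := fun i => (z i : K)
def LL {ι : Type*} [Fintype ι] (X : ι → 𝓞 K) : Submodule (𝓞 K) (ι → 𝓞 K) where
  carrier := {z | ∑ i, X i * z i = 0}
  zero_mem' := by simp
  add_mem' := by
    intro a b ha hb
    simp only [Set.mem_setOf_eq, Pi.add_apply, mul_add, Finset.sum_add_distrib] at *
    rw [ha, hb, add_zero]
  smul_mem' := by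
    intro c a ha
    simp only [Set.mem_setOf_eq, Pi.smul_apply, smul_eq_mul, mul_left_comm _ c, ← Finset.mul_sum] at *
    rw [ha, mul_zero]
lemma mem_LL {ι : Type*} [Fintype ι] {X z : ι → 𝓞 K} : z ∈ LL X ↔ ∑ i, X i * z i = 0 := Iff.rfl
noncomputable def xp {ι : Type*} [Fintype ι] (x : ι → K) : (ι → K) →ₗ[K] K := Fintype.linearCombination K x
lemma xp_apply {ι : Type*} [Fintype ι] (x z : ι → K) : xp x z = ∑ i, z i * x i := by
  simp [xp, Fintype.linearCombination_apply]
lemma mem_LL' {ι : Type*} [Fintype ι] {X z : ι → 𝓞 K} : z ∈ LL X ↔ cz z ∈ LinearMap.ker (xp (cz X)) := by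
  rw [mem_LL, LinearMap.mem_ker, xp_apply, ← RingOfIntegers.coe_eq_zero_iff]
  simp [cz, mul_comm]
lemma xp_rank (x : Fin (m + 2) → K) (hx : x 0 ≠ 0) : Module.finrank K (LinearMap.ker (xp x)) = m + 1 := by
  have h1 := (xp x).finrank_range_add_finrank_ker
  have h2 : LinearMap.range (xp x) = ⊤ := by
    rw [LinearMap.range_eq_top]
    intro y
    exact ⟨Pi.single 0 (y / x 0), by rw [xp_apply]; simp [Pi.single_apply, hx]⟩
  rw [h2, finrank_top, Module.finrank_self, Module.finrank_fintype_fun_eq_card, Fintype.card_fin] at h1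
  omega
noncomputable def wn {ι : Type*} [Fintype ι] (w : InfinitePlace K → ι → ℝ) (z : ι → K) : ℝ := ∑ v : InfinitePlace K, ∑ i, w v i * v (z i)
lemma clear_den {ι : Type*} [Finite ι] (y : ι → K) : ∃ D : 𝓞 K, D ≠ 0 ∧ ∃ z : ι → 𝓞 K, ∀ i, (z i : K) = D * y i := by
  obtain ⟨b, hb⟩ := IsLocalization.exist_integer_multiples_of_finite (nonZeroDivisors (𝓞 K)) y
  refine ⟨b, nonZeroDivisors.coe_ne_zero b, ?_⟩
  choose z hz using hb
  exact ⟨z, fun i => (hz i).trans (Algebra.smul_def _ _)⟩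
lemma nat_min {α : Type*} (f : α → ℕ) (P : α → Prop) (h : ∃ y, P y) : ∃ z, P z ∧ ∀ y, P y → f z ≤ f y := by
  obtain ⟨z, hz, hmin⟩ := (measure f).wf.has_min {y | P y} h
  exact ⟨z, hz, fun y hy => not_lt.1 (hmin y hy)⟩
lemma nat_seq {α : Type*} (a : α) (f : α → α) : ∃ V : ℕ → α, V 0 = a ∧ ∀ k, V (k + 1) = f (V k) :=
  ⟨fun k => f^[k] a, rfl, fun k => Function.iterate_succ_apply' f k a⟩
lemma flag (X : Fin (m + 2) → 𝓞 K) (hX : ∀ i, X i ≠ 0) (hs : ∑ i, X i = 0) : ∃ (Vs : ℕ → Submodule K (Fin (m + 2) → K)) (g : ℕ → Fin (m + 2) → 𝓞 K),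
    Vs 0 = Submodule.span K {1} ∧ g 0 = 1 ∧ (∀ k, g k ∈ LL X) ∧ (∀ k, Vs k = Submodule.span K ((fun j => cz (g j)) '' Set.Iic k)) ∧ Monotone Vs ∧
    (∀ k ≤ m, Module.finrank K (Vs k) = k + 1) ∧ Vs m = LinearMap.ker (xp (cz X)) ∧
    (∀ k < m, cz (g (k + 1)) ∉ Vs k) ∧
    (∀ k < m, ∀ z ∈ LL X, cz z ∉ Vs k → ⌊wn 1 (cz (g (k + 1)))⌋₊ ≤ ⌊wn 1 (cz z)⌋₊) := by
  classical
  have hnx : ∀ V : Submodule K (Fin (m + 2) → K), ∃ z ∈ LL X, (∃ y ∈ LL X, cz y ∉ V) → cz z ∉ V ∧ ∀ y ∈ LL X, cz y ∉ V → ⌊wn 1 (cz z)⌋₊ ≤ ⌊wn 1 (cz y)⌋₊ := by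
    intro V
    by_cases h : ∃ y ∈ LL X, cz y ∉ V
    · obtain ⟨z, hz, hmin⟩ := nat_min (fun y : Fin (m + 2) → 𝓞 K => ⌊wn 1 (cz y)⌋₊) (fun y => y ∈ LL X ∧ cz y ∉ V) h
      exact ⟨z, hz.1, fun _ => ⟨hz.2, fun y hy hy' => hmin y ⟨hy, hy'⟩⟩⟩
    · exact ⟨0, zero_mem _, fun h' => absurd h' h⟩
  choose nx hnx1 hnx2 using hnx
  obtain ⟨Vs, hV0, hVs⟩ := nat_seq (Submodule.span K {(1 : Fin (m + 2) → K)}) (fun V => V ⊔ Submodule.span K {cz (nx V)})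
  have hgex : ∃ g : ℕ → Fin (m + 2) → 𝓞 K, g 0 = 1 ∧ ∀ k, g (k + 1) = nx (Vs k) := ⟨fun k => Nat.casesOn k 1 (fun k => nx (Vs k)), rfl, fun k => rfl⟩
  obtain ⟨g, hg0, hg⟩ := hgex
  have hgL : ∀ k, g k ∈ LL X := by
    intro k
    cases k with
    | zero => rw [mem_LL]; simpa [hg0] using hs
    | succ k => rw [hg]; exact hnx1 _
  have hspan : ∀ k, Vs k = Submodule.span K ((fun j => cz (g j)) '' Set.Iic k) := by
    intro k
    induction k with
    | zero =>
      have : Set.Iic 0 = {0} := by ext; simp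
      rw [this, Set.image_singleton]
      rw [hV0, hg0]; congr 2
    | succ k ih =>
      have : Set.Iic (k + 1) = insert (k + 1) (Set.Iic k) := by ext; simp; omega
      rw [hVs, this, Set.image_insert_eq, Submodule.span_insert, ← ih, hg, sup_comm]
  have hmono : Monotone Vs := monotone_nat_of_le_succ fun k => by rw [hVs]; exact le_sup_left
  have hle : ∀ k, Vs k ≤ LinearMap.ker (xp (cz X)) := by
    intro k
    rw [hspan, Submodule.span_le]
    rintro _ ⟨j, _, rfl⟩
    exact mem_LL'.1 (hgL j)
  have hXr := xp_rank (cz X) (by simpa [cz] using hX 0)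
  have hrk : ∀ k : ℕ, Module.finrank K (Vs k) ≤ k + 1 := by
    intro k
    rw [hspan]
    have h1 : (fun j => cz (g j)) '' Set.Iic k = (((Finset.Iic k).image fun j => cz (g j) : Finset (Fin (m + 2) → K)) : Set _) := by simp
    rw [h1]
    exact (finrank_span_finset_le_card _).trans (Finset.card_image_le.trans (by simp))
  have hex : ∀ k < m, ∃ y ∈ LL X, cz y ∉ Vs k := by
    intro k hk
    have hlt : Vs k < LinearMap.ker (xp (cz X)) := by
      refine lt_of_le_of_ne (hle k) fun h => ?_
      have := hrk k
      rw [h, hXr] at this; omega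
    obtain ⟨y, hy, hy'⟩ := SetLike.exists_of_lt hlt
    obtain ⟨D, hD, z, hz⟩ := clear_den y
    have hD' : (D : K) ≠ 0 := by simpa using hD
    have hzy : cz z = (D : K) • y := by ext i; simp [cz, hz]
    refine ⟨z, ?_, ?_⟩
    · rw [mem_LL', hzy]; exact Submodule.smul_mem _ _ hy
    · rw [hzy, Submodule.smul_mem_iff _ hD']; exact hy'
  have hnot : ∀ k < m, cz (g (k + 1)) ∉ Vs k := fun k hk => by rw [hg]; exact (hnx2 (Vs k) (hex k hk)).1
  have hrk2 : ∀ k ≤ m, Module.finrank K (Vs k) = k + 1 := by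
    intro k
    induction k with
    | zero =>
      intro _
      rw [hV0]
      exact finrank_span_singleton (by intro h; simpa using congrFun h 0)
    | succ k ih =>
      intro hk
      have h1 := ih (by omega)
      have : Vs k < Vs (k + 1) := by
        refine lt_of_le_of_ne (hmono (Nat.le_succ k)) fun h => hnot k (by omega) ?_
        rw [h, hVs, hg]; exact Submodule.mem_sup_right (Submodule.mem_span_singleton_self _)
      have h2 := Submodule.finrank_lt_finrank_of_lt this
      have h3 := hrk (k + 1)
      omega
  refine ⟨Vs, g, hV0, hg0, hgL, hspan, hmono, hrk2, ?_, hnot, fun k hk => by rw [hg]; exact (hnx2 (Vs k) (hex k hk)).2⟩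
  exact Submodule.eq_of_le_of_finrank_eq (hle m) (by rw [hrk2 m le_rfl, hXr])
end
section
variable {K : Type*} [Field K] [NumberField K] {m : ℕ}
lemma le_wn {ι : Type*} [Fintype ι] {w : InfinitePlace K → ι → ℝ} (hw : ∀ v i, 0 ≤ w v i) (z : ι → K) (v i) : w v i * v (z i) ≤ wn w z := by
  have h1 : ∀ v i, 0 ≤ w v i * v (z i) := fun v i => mul_nonneg (hw v i) (apply_nonneg v _)
  exact (Finset.single_le_sum (f := fun i => w v i * v (z i)) (fun i _ => h1 v i) (Finset.mem_univ i)).trans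
    (Finset.single_le_sum (f := fun v => ∑ i, w v i * v (z i)) (fun v _ => Finset.sum_nonneg fun i _ => h1 v i) (Finset.mem_univ v))
lemma le_wn1 {ι : Type*} [Fintype ι] (z : ι → K) (v : InfinitePlace K) (i) : v (z i) ≤ wn 1 z := by
  simpa using le_wn (w := 1) (fun _ _ => zero_le_one) z v i
noncomputable def dM (G : Fin (m + 1) → Fin (m + 2) → K) : (Fin (m + 2) → K) →ₗ[K] K :=
  (Matrix.detRowAlternating (R := K) (n := Fin (m + 2))).toMultilinearMap.toLinearMap (Fin.cons 0 G) 0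
lemma dM_apply (G : Fin (m + 1) → Fin (m + 2) → K) (y) : dM G y = Matrix.det (Matrix.of (Fin.cons y G)) := by
  simp only [dM, MultilinearMap.toLinearMap_apply]
  rw [Fin.update_cons_zero]
  rfl
lemma det_le (ν : AbsoluteValue K ℝ) (A : Matrix (Fin (m + 2)) (Fin (m + 2)) K) (b : Fin (m + 2) → ℝ) (h : ∀ i j, ν (A i j) ≤ b i) :
    ν A.det ≤ (m + 2).factorial * ∏ i, b i := by
  rw [Matrix.det_apply]
  refine (ν.sum_le _ _).trans ((Finset.sum_le_card_nsmul _ _ (∏ i, b i) fun σ _ => ?_).trans (by simp [Fintype.card_perm]))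
  have : ν (Equiv.Perm.sign σ • ∏ i, A (σ i) i) = ν (∏ i, A (σ i) i) := by
    rcases Int.units_eq_one_or (Equiv.Perm.sign σ) with h | h <;> simp [h]
  rw [this, map_prod, ← Equiv.prod_comp σ b]
  exact Finset.prod_le_prod (fun i _ => ν.nonneg _) fun i _ => h _ _
lemma hadamard (x : Fin (m + 2) → K) (hx : ∀ i, x i ≠ 0) (g : Fin (m + 1) → Fin (m + 2) → 𝓞 K)
    (hspan : Submodule.span K (Set.range fun j => cz (g j)) = LinearMap.ker (xp x)) (iv : Pl K → Fin (m + 2)) (hsup : (Function.support fun v => wt v * Real.log (pv v (x (iv v)))).Finite)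
    (hpos : ∀ j, 0 < wn 1 (cz (g j))) :
    ∑ᶠ v, wt v * Real.log (pv v (x (iv v))) ≤ Module.finrank ℚ K * (Real.log ((m + 2).factorial) + ∑ j, Real.log (wn 1 (cz (g j)))) := by
  classical
  set G : Fin (m + 1) → Fin (m + 2) → K := fun j => cz (g j) with hG
  have hLI : LinearIndependent K G := by
    rw [linearIndependent_iff_card_eq_finrank_span, Set.finrank, hspan, xp_rank x (hx 0), Fintype.card_fin]
  have hker : ∀ y ∈ LinearMap.ker (xp x), dM G y = 0 := by
    intro y hy
    rw [dM_apply]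
    by_contra hne
    have h1 := (Matrix.linearIndependent_rows_iff_isUnit (A := Matrix.of (Fin.cons y G))).2 ((Matrix.isUnit_iff_isUnit_det _).2 (isUnit_iff_ne_zero.2 hne))
    have h2 := (linearIndependent_finCons (x := y) (v := G)).1 h1
    exact h2.2 (by rw [hspan]; exact hy)
  set M : Fin (m + 2) → K := fun k => dM G (Pi.single k 1) with hM
  have hMx : ∀ i k, x k * M i = x i * M k := by
    intro i k
    have := hker (x k • Pi.single i 1 - x i • Pi.single k 1) (by
      rw [LinearMap.mem_ker, map_sub, map_smul, map_smul, xp_apply, xp_apply]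
      simp [Pi.single_apply, mul_comm])
    rw [map_sub, map_smul, map_smul, smul_eq_mul, smul_eq_mul, sub_eq_zero] at this
    exact this
  have hM0 : M 0 ≠ 0 := by
    simp only [hM, dM_apply]
    have h1 : LinearIndependent K (Fin.cons (Pi.single 0 1) G : Fin (m + 2) → Fin (m + 2) → K) := by
      rw [linearIndependent_finCons]
      refine ⟨hLI, ?_⟩
      rw [hspan, LinearMap.mem_ker, xp_apply]
      simpa [Pi.single_apply] using hx 0
    exact ((Matrix.isUnit_iff_isUnit_det _).1 ((Matrix.linearIndependent_rows_iff_isUnit (A := Matrix.of (Fin.cons (Pi.single 0 1) G))).1 h1)).ne_zero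
  set c := M 0 / x 0 with hc
  have hc0 : c ≠ 0 := div_ne_zero hM0 (hx 0)
  have hMc : ∀ k, M k = c * x k := by
    intro k; rw [hc, div_mul_eq_mul_div, eq_div_iff (hx 0), mul_comm, hMx k 0, mul_comm]
  set B := (m + 2).factorial * ∏ j, wn 1 (cz (g j)) with hB
  have hBp : 0 < B := mul_pos (by positivity) (Finset.prod_pos fun j _ => hpos j)
  have hfin : ∀ (v : FinitePlace K) k, pv (Sum.inr v) (M k) ≤ 1 := by
    intro v k
    have h1 : M k = ((Matrix.det (Matrix.of (Fin.cons (Pi.single k 1) g : Fin (m + 2) → Fin (m + 2) → 𝓞 K)) : 𝓞 K) : K) := by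
      simp only [hM, dM_apply]
      have := (RingHom.map_det (algebraMap (𝓞 K) K) (Matrix.of (Fin.cons (Pi.single k 1) g : Fin (m + 2) → Fin (m + 2) → 𝓞 K)))
      refine Eq.trans ?_ this.symm
      congr 1
      ext i j
      refine Fin.cases ?_ (fun i => ?_) i
      · simp [Pi.single_apply, RingHom.mapMatrix_apply, apply_ite]
      · simp [hG, cz, RingHom.mapMatrix_apply]
    rw [h1]; exact pv_oint v _
  have hinf : ∀ (v : InfinitePlace K) k, pv (Sum.inl v) (M k) ≤ B := by
    intro v k
    simp only [hM, dM_apply]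
    refine (det_le _ _ (Fin.cons 1 fun j => wn 1 (cz (g j))) fun i j => ?_).trans (le_of_eq ?_)
    · refine Fin.cases ?_ (fun i => ?_) i
      · simp only [Matrix.of_apply, Fin.cons_zero, Pi.single_apply]
        split_ifs <;> simp
      · simp only [Matrix.of_apply, Fin.cons_succ, hG]
        exact le_wn1 _ v j
    · rw [Fin.prod_univ_succ]; simp [hB]
  have h1 : ∑ᶠ v, wt v * Real.log (pv v (x (iv v))) = ∑ᶠ v, wt v * Real.log (pv v (M (iv v))) := by
    have h2 : ∀ v : Pl K, wt v * Real.log (pv v (M (iv v))) = wt v * Real.log (pv v c) + wt v * Real.log (pv v (x (iv v))) := by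
      intro v
      rw [hMc, map_mul, Real.log_mul ((pv v).pos hc0).ne' ((pv v).pos (hx _)).ne', mul_add]
    rw [finsum_congr h2, finsum_add_distrib (supp_log hc0) hsup, prodf hc0, zero_add]
  have hMne : ∀ k, M k ≠ 0 := fun k => by rw [hMc]; exact mul_ne_zero hc0 (hx k)
  rw [h1]
  have hsB : (Function.support fun v : Pl K => wt v * (v.elim (fun _ => Real.log B) (fun _ => 0))).Finite := by
    refine (Set.finite_range Sum.inl).subset fun v hv => ?_
    rcases v with v | v
    · exact ⟨v, rfl⟩
    · simp at hv
  have h3 : ∑ᶠ v : Pl K, wt v * (v.elim (fun _ => Real.log B) (fun _ => 0)) = Module.finrank ℚ K * Real.log B := by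
    rw [finsum_pl _ hsB]
    simp only [Sum.elim_inl, Sum.elim_inr, mul_zero, finsum_zero, add_zero]
    rw [← Finset.sum_mul, sum_wt_inf]
  have h4 : Real.log B = Real.log ((m + 2).factorial) + ∑ j, Real.log (wn 1 (cz (g j))) := by
    rw [hB, Real.log_mul (by positivity) (Finset.prod_pos fun j _ => hpos j).ne', Real.log_prod (fun j _ => (hpos j).ne')]
  rw [← h4, ← h3]
  refine fsum_le ?_ ?_ fun v => mul_le_mul_of_nonneg_left ?_ (wt_pos v).le
  · refine (Set.finite_iUnion fun k => pv_finite (hMne k)).subset fun v hv => Set.mem_iUnion.2 ⟨iv v, fun h => hv ?_⟩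
    simp [h]
  · exact hsB
  · rcases v with v | v
    · exact Real.log_le_log ((pv _).pos (hMne _)) (hinf v _)
    · exact Real.log_nonpos ((pv _).nonneg _) (hfin v _)
end
section
variable {K : Type*} [Field K] [NumberField K] {m : ℕ}
lemma wn_one_pos (K : Type*) [Field K] [NumberField K] (m : ℕ) : 0 < wn 1 (1 : Fin (m + 2) → K) := by
  simp only [wn, Pi.one_apply, map_one, mul_one, Finset.sum_const, nsmul_eq_mul]
  have : 0 < Fintype.card (InfinitePlace K) := Fintype.card_pos
  have h2 : (Finset.univ : Finset (InfinitePlace K)).card = Fintype.card (InfinitePlace K) := rfl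
  rw [h2]; simp only [Finset.card_univ, Fintype.card_fin]
  positivity
lemma weights (K : Type*) [Field K] [NumberField K] (m : ℕ) (hm : 1 ≤ m) : ∃ C : ℝ, 1 ≤ C ∧ ∀ (X : Fin (m + 2) → 𝓞 K) (hX : ∀ i, X i ≠ 0) (hs : ∑ i, X i = 0)
    (iv : Pl K → Fin (m + 2)) (hiv : ∀ v i, pv v (X i : K) ≤ pv v (X (iv v) : K)) (h L : ℝ) (hh : h = ∑ᶠ v, wt v * Real.log (pv v (X (iv v) : K)))
    (hL1 : 1 ≤ L) (hLh : L ≤ Real.exp h) (hL : ∀ z ∈ LL X, cz z ∉ Submodule.span K {1} → L ≤ wn 1 (cz z)),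
    ∃ w : InfinitePlace K → Fin (m + 2) → ℝ, (∀ v, w v (iv (Sum.inl v)) = 0) ∧ (∀ v i, 0 ≤ w v i) ∧
      (∀ v i, i ≠ iv (Sum.inl v) → Real.exp (-h) ≤ w v i ∧ w v i ≤ 2 / L) ∧
      (∀ z ∈ LL X, cz z ∉ Submodule.span K {1} → 1 ≤ C * wn w (cz z)) ∧
      ∑ v : InfinitePlace K, wt (Sum.inl v : Pl K) * ∑ i ∈ Finset.univ.erase (iv (Sum.inl v)), Real.log (w v i) ≤ - h - Real.log L + C := by
  classical
  set d : ℝ := ((Module.finrank ℚ K : ℕ) : ℝ) with hd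
  have hd1 : 1 ≤ d := by
    have : 0 < Module.finrank ℚ K := Module.finrank_pos
    rw [hd]; exact_mod_cast this
  set C1 : ℝ := d * (Real.log ((m + 2).factorial) + |Real.log (wn 1 (1 : Fin (m + 2) → K))| + m * Real.log 2) + Real.log 2 with hC1
  have hl2 : 0 < Real.log 2 := Real.log_pos (by norm_num)
  have hlf : 0 ≤ Real.log ((m + 2).factorial) := Real.log_natCast_nonneg _
  have hC1' : Real.log 2 ≤ C1 := by
    have : 0 ≤ d * (Real.log ((m + 2).factorial) + |Real.log (wn 1 (1 : Fin (m + 2) → K))| + m * Real.log 2) := by positivity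
    linarith
  refine ⟨max 1 (max ((m + 2) * 2 ^ m) C1), le_max_left _ _, ?_⟩
  intro X hX hs iv hiv h L hh hL1 hLh hL
  obtain ⟨Vs, g, hV0, hg0, hgL, hVs, hmono, hfr, hVm, hgn, hgmin⟩ := flag X hX hs
  have hmin : ∀ j, 1 ≤ j → j ≤ m → ∀ z ∈ LL X, cz z ∉ Vs (j - 1) → ⌊wn 1 (cz (g j))⌋₊ ≤ ⌊wn 1 (cz z)⌋₊ := by
    intro j h1 h2 z hz hzn
    have := hgmin (j - 1) (by omega) z hz hzn
    rwa [Nat.sub_add_cancel h1] at this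
  have hgj : ∀ j, 1 ≤ j → j ≤ m → cz (g j) ∉ Vs (j - 1) := by
    intro j h1 h2
    have := hgn (j - 1) (by omega)
    rwa [Nat.sub_add_cancel h1] at this
  have hnc : ∀ j, 1 ≤ j → j ≤ m → L ≤ wn 1 (cz (g j)) := by
    intro j h1 h2
    refine hL _ (hgL j) fun hc => hgj j h1 h2 (hmono (Nat.zero_le _) ?_)
    rw [hV0]; exact hc
  obtain ⟨μ, hμ⟩ : ∃ μ : ℕ → ℝ, ∀ j, μ j = (⌊wn 1 (cz (g j))⌋₊ : ℝ) := ⟨_, fun j => rfl⟩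
  have hμle : ∀ j, 1 ≤ j → j ≤ m → 1 ≤ μ j ∧ wn 1 (cz (g j)) / 2 ≤ μ j := by
    intro j h1 h2
    have h3 : 1 ≤ ⌊wn 1 (cz (g j))⌋₊ := Nat.le_floor (by simpa using hL1.trans (hnc j h1 h2)) 
    have h4 := Nat.lt_floor_add_one (wn 1 (cz (g j)))
    have h5 : (1:ℝ) ≤ ⌊wn 1 (cz (g j))⌋₊ := by exact_mod_cast h3
    rw [hμ]; exact ⟨h5, by linarith⟩
  have hμmono : ∀ i j, 1 ≤ i → i ≤ j → j ≤ m → μ i ≤ μ j := by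
    intro i j h1 h2 h3
    rw [hμ, hμ]
    rcases h2.eq_or_lt with rfl | h2
    · exact le_rfl
    exact_mod_cast hmin i h1 (by omega) _ (hgL j) fun hc => hgj j (by omega) h3 (hmono (by omega) hc)
  obtain ⟨cl, hcl⟩ : ∃ cl : ℕ → ℕ, ∀ j, cl j = max 1 (min j m) := ⟨_, fun j => rfl⟩
  have hcl1 : ∀ j, 1 ≤ cl j := fun j => by rw [hcl]; exact le_max_left _ _
  have hclm : ∀ j, cl j ≤ m := fun j => by rw [hcl]; omega
  have hclj : ∀ j, 1 ≤ j → j ≤ m → cl j = j := fun j _ _ => by rw [hcl]; omega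
  obtain ⟨r, hr⟩ : ∃ r : ℕ → ℝ, ∀ j, r j = min (μ (cl j)) (Real.exp h) := ⟨_, fun j => rfl⟩
  have hr1 : ∀ j, 1 ≤ r j := fun j => by
    rw [hr]; exact le_min (hμle _ (hcl1 j) (hclm j)).1 (hL1.trans hLh)
  have hrL : ∀ j, L / 2 ≤ r j := fun j => by
    rw [hr]
    refine le_min ?_ ?_
    · linarith [(hμle _ (hcl1 j) (hclm j)).2, hnc _ (hcl1 j) (hclm j)]
    · linarith
  have hrp : ∀ j, 0 < r j := fun j => zero_lt_one.trans_le (hr1 j)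
  have hrmono : Monotone r := fun i j hij => by
    rw [hr, hr]
    refine min_le_min (hμmono _ _ (hcl1 i) ?_ (hclm j)) le_rfl
    rw [hcl, hcl]; omega
  have hx0 : ∀ i, (X i : K) ≠ 0 := fun i => by simpa using hX i
  have hdav : ∀ v : InfinitePlace K, ∃ w : Fin (m + 2) → ℝ, (∀ i ∈ Finset.univ.erase (iv (Sum.inl v)), ∃ j ≤ m, w i = (r j)⁻¹) ∧
      ∑ i ∈ Finset.univ.erase (iv (Sum.inl v)), Real.log (w i) = ∑ j ∈ Finset.range (m + 1), Real.log ((r j)⁻¹) ∧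
      ∀ j ≤ m, ∀ z ∈ Vs j, ∀ i, (r j)⁻¹ * pv (Sum.inl v : Pl K) (z i) ≤ 2 ^ m * 1 * ∑ l ∈ Finset.univ.erase (iv (Sum.inl v)), w l * pv (Sum.inl v : Pl K) (z l) := by
    intro v
    refine dav (pv (Sum.inl v : Pl K)) Vs (fun j => (r j)⁻¹) (fun j => inv_pos.2 (hrp j)) (fun i j hij => inv_anti₀ (hrp i) (hrmono hij)) hmono m (fun k hk => (hfr k hk).le) _ ?_ 1 zero_le_one ?_
    · rw [Finset.card_erase_of_mem (Finset.mem_univ _)]; simp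
    · intro z hz i
      rw [one_mul]
      by_cases hi : i = iv (Sum.inl v)
      · rw [hVm, LinearMap.mem_ker, xp_apply, ← Finset.add_sum_erase _ _ (Finset.mem_univ (iv (Sum.inl v)))] at hz
        have hp : 0 < pv (Sum.inl v : Pl K) (X (iv (Sum.inl v)) : K) := (pv _).pos (hx0 _)
        refine le_of_mul_le_mul_right ?_ hp
        have h1 : z (iv (Sum.inl v)) * (X (iv (Sum.inl v)) : K) = - ∑ l ∈ Finset.univ.erase (iv (Sum.inl v)), z l * (X l : K) := eq_neg_of_add_eq_zero_left hz
        rw [hi, ← map_mul, h1, AbsoluteValue.map_neg, Finset.sum_mul]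
        refine ((pv _).sum_le _ _).trans (Finset.sum_le_sum fun l _ => ?_)
        rw [map_mul]
        exact mul_le_mul_of_nonneg_left (hiv _ _) ((pv _).nonneg _)
      · exact Finset.single_le_sum (f := fun l => pv (Sum.inl v : Pl K) (z l)) (fun l _ => (pv _).nonneg _) (Finset.mem_erase.2 ⟨hi, Finset.mem_univ _⟩)
  choose w0 hw0 hw1 hw2 using hdav
  have hwp : ∀ v, ∀ i ∈ Finset.univ.erase (iv (Sum.inl v)), 0 < w0 v i := by
    intro v i hi
    obtain ⟨j, _, hj⟩ := hw0 v i hi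
    rw [hj]; exact inv_pos.2 (hrp j)
  have hmem : ∀ v i, i ≠ iv (Sum.inl v) → i ∈ Finset.univ.erase (iv (Sum.inl v)) := fun v i hi => Finset.mem_erase.2 ⟨hi, Finset.mem_univ _⟩
  obtain ⟨w, hw⟩ : ∃ w : InfinitePlace K → Fin (m + 2) → ℝ, ∀ v i, w v i = if i = iv (Sum.inl v) then 0 else w0 v i := ⟨_, fun v i => rfl⟩
  have hwne : ∀ v i, i ≠ iv (Sum.inl v) → w v i = w0 v i := fun v i hi => by rw [hw, if_neg hi]
  refine ⟨w, fun v => by rw [hw, if_pos rfl], fun v i => ?_, fun v i hi => ?_, fun z hz hzn => ?_, ?_⟩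
  · rw [hw]; split_ifs with hi
    · exact le_rfl
    · exact (hwp v i (hmem v i hi)).le
  · rw [hwne v i hi]
    obtain ⟨j, _, hj⟩ := hw0 v i (hmem v i hi)
    rw [hj, Real.exp_neg]
    refine ⟨inv_anti₀ (hrp j) ?_, ?_⟩
    · rw [hr]; exact min_le_right _ _
    · rw [← inv_div]; exact inv_anti₀ (by positivity) (hrL j)
  · have hex : ∃ j, cz z ∈ Vs j := ⟨m, by rw [hVm]; exact mem_LL'.1 hz⟩
    obtain ⟨j, hj, hjm⟩ : ∃ j, cz z ∈ Vs j ∧ ∀ i < j, cz z ∉ Vs i := ⟨Nat.find hex, Nat.find_spec hex, fun i hi => Nat.find_min hex hi⟩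
    have hj1 : 1 ≤ j := by
      by_contra hc
      obtain rfl : j = 0 := by omega
      exact hzn (hV0 ▸ hj)
    have hjm' : j ≤ m := by
      by_contra hc
      exact hjm m (by omega) (by rw [hVm]; exact mem_LL'.1 hz)
    have hwz : 0 ≤ wn 1 (cz z) := (zero_le_one.trans hL1).trans (hL z hz hzn)
    have h1 : r j ≤ wn 1 (cz z) := by
      rw [hr, hclj j hj1 hjm', hμ]
      refine (min_le_left _ _).trans (le_trans ?_ (Nat.floor_le hwz))
      exact_mod_cast hmin j hj1 hjm' z hz (hjm _ (by omega))
    have h2 : (r j)⁻¹ * wn 1 (cz z) ≤ ((m + 2) * 2 ^ m) * wn w (cz z) := by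
      simp only [wn, Finset.mul_sum]
      refine Finset.sum_le_sum fun v _ => ?_
      refine (Finset.sum_le_card_nsmul _ _ (2 ^ m * ∑ i, w v i * v (cz z i)) fun i _ => ?_).trans (le_of_eq ?_)
      · have := hw2 v j hjm' (cz z) hj i
        rw [mul_one] at this
        simp only [Pi.one_apply, one_mul]
        refine this.trans (mul_le_mul_of_nonneg_left (le_of_eq ?_) (by positivity))
        rw [← Finset.add_sum_erase _ _ (Finset.mem_univ (iv (Sum.inl v))), hw, if_pos rfl, zero_mul, zero_add]
        exact Finset.sum_congr rfl fun l hl => by rw [hwne v l (Finset.ne_of_mem_erase hl)]; rfl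
      · rw [Finset.card_univ, Fintype.card_fin, nsmul_eq_mul, ← Finset.mul_sum]; push_cast; ring
    have h3 : 1 ≤ (r j)⁻¹ * wn 1 (cz z) := by rw [inv_mul_eq_div, one_le_div (hrp j)]; exact h1
    have hwn : 0 ≤ wn w (cz z) := by
      have := h3.trans h2
      by_contra hc
      push Not at hc
      have : ((m + 2) * 2 ^ m) * wn w (cz z) ≤ 0 := mul_nonpos_of_nonneg_of_nonpos (by positivity) hc.le
      linarith
    exact h3.trans (h2.trans (mul_le_mul_of_nonneg_right ((le_max_left _ _).trans (le_max_right _ _)) hwn))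
  · have h1 : ∀ v : InfinitePlace K, ∑ i ∈ Finset.univ.erase (iv (Sum.inl v)), Real.log (w v i) = - ∑ j ∈ Finset.range (m + 1), Real.log (r j) := by
      intro v
      rw [← Finset.sum_neg_distrib]
      simp only [← Real.log_inv]
      rw [← hw1 v]
      exact Finset.sum_congr rfl fun l hl => by rw [hwne v l (Finset.ne_of_mem_erase hl)]
    simp only [h1]
    rw [← Finset.sum_mul, sum_wt_inf, ← hd, Finset.sum_range_succ']
    have hlr : ∀ j, 0 ≤ Real.log (r j) := fun j => Real.log_nonneg (hr1 j)
    have hlL : Real.log L - Real.log 2 ≤ Real.log (r 0) := by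
      rw [← Real.log_div (by positivity) (by norm_num)]; exact Real.log_le_log (by positivity) (hrL 0)
    have hC : C1 ≤ max 1 (max (((m:ℝ) + 2) * 2 ^ m) C1) := (le_max_right _ _).trans (le_max_right _ _)
    have hd0 : Real.log (r 0) ≤ d * Real.log (r 0) := le_mul_of_one_le_left (hlr 0) hd1
    suffices hmain : h - (C1 - Real.log 2) ≤ d * ∑ k ∈ Finset.range m, Real.log (r (k + 1)) by linarith
    by_cases hcase : ∃ k, k < m ∧ Real.exp h ≤ μ (k + 1)
    · obtain ⟨k, hk, hkh⟩ := hcase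
      have h2 : Real.log (r (k + 1)) = h := by
        rw [hr, hclj _ (by omega) (by omega), min_eq_right hkh, Real.log_exp]
      have h3 : h ≤ ∑ k ∈ Finset.range m, Real.log (r (k + 1)) := by
        rw [← h2]; exact Finset.single_le_sum (f := fun k => Real.log (r (k + 1))) (fun i _ => hlr _) (Finset.mem_range.2 hk)
      have h4 : ∑ k ∈ Finset.range m, Real.log (r (k + 1)) ≤ d * ∑ k ∈ Finset.range m, Real.log (r (k + 1)) := le_mul_of_one_le_left (Finset.sum_nonneg fun i _ => hlr _) hd1
      linarith
    · push Not at hcase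
      have h2 : ∀ k ∈ Finset.range m, Real.log (wn 1 (cz (g (k + 1)))) - Real.log 2 ≤ Real.log (r (k + 1)) := by
        intro k hk
        rw [Finset.mem_range] at hk
        have h5 := hnc (k + 1) (by omega) (by omega)
        rw [hr, hclj _ (by omega) (by omega), min_eq_left (hcase k hk).le, ← Real.log_div (by linarith) (by norm_num)]
        exact Real.log_le_log (by linarith) (hμle _ (by omega) (by omega)).2
      have h3 := Finset.sum_le_sum h2
      rw [Finset.sum_sub_distrib, Finset.sum_const, Finset.card_range, nsmul_eq_mul] at h3
      have hcz1 : cz (g 0) = 1 := by ext i; simp [cz, hg0]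
      have h4 := hadamard (cz X) hx0 (fun j => g j) (by
        rw [← hVm, hVs]
        congr 1
        ext y
        simp only [Set.mem_range, Set.mem_image, Set.mem_Iic]
        constructor
        · rintro ⟨j, rfl⟩; exact ⟨j, by omega, rfl⟩
        · rintro ⟨j, hj, rfl⟩; exact ⟨⟨j, by omega⟩, rfl⟩) iv (by
          refine (Set.finite_iUnion fun k => pv_finite (hx0 k)).subset fun v hv => Set.mem_iUnion.2 ⟨iv v, fun h => hv ?_⟩
          simp [cz, h]) (by
          intro j
          rcases j with ⟨j, hj⟩
          rcases j with _ | j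
          · simp only [hcz1]; exact wn_one_pos K m
          · exact zero_lt_one.trans_le (hL1.trans (hnc (j + 1) (by omega) (by omega))))
      have h5 : ∑ j : Fin (m + 1), Real.log (wn 1 (cz (g j))) = Real.log (wn 1 (1 : Fin (m + 2) → K)) + ∑ k ∈ Finset.range m, Real.log (wn 1 (cz (g (k + 1)))) := by
        rw [Fin.sum_univ_eq_sum_range (fun j => Real.log (wn 1 (cz (g j)))), Finset.sum_range_succ', hcz1, add_comm]
      rw [h5] at h4
      change (∑ᶠ v, wt v * Real.log (pv v (X (iv v) : K))) ≤ _ at h4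
      rw [← hh, ← hd] at h4
      have h6 := le_abs_self (Real.log (wn 1 (1 : Fin (m + 2) → K)))
      have h7 : d * (Real.log ((m + 2).factorial) + (Real.log (wn 1 (1 : Fin (m + 2) → K)) + ∑ k ∈ Finset.range m, Real.log (wn 1 (cz (g (k + 1)))))) ≤
        d * (Real.log ((m + 2).factorial) + |Real.log (wn 1 (1 : Fin (m + 2) → K))| + m * Real.log 2 + ∑ k ∈ Finset.range m, Real.log (r (k + 1))) :=
        mul_le_mul_of_nonneg_left (by linarith) (by linarith)
      rw [hC1]
      rw [mul_add _ _ (∑ k ∈ Finset.range m, Real.log (r (k + 1)))] at h7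
      linarith
end
section
variable {K : Type} [Field K] [NumberField K] {m : ℕ}
lemma wn_add_le {ι : Type*} [Fintype ι] {w : InfinitePlace K → ι → ℝ} (hw : ∀ v i, 0 ≤ w v i) (y z : ι → K) : wn w (y + z) ≤ wn w y + wn w z := by
  simp only [wn, ← Finset.sum_add_distrib, ← mul_add]
  exact Finset.sum_le_sum fun v _ => Finset.sum_le_sum fun i _ => mul_le_mul_of_nonneg_left ((pv (Sum.inl v : Pl K)).add_le _ _) (hw v i)
lemma wn_isNm {X : Fin (m + 2) → 𝓞 K} {w : InfinitePlace K → Fin (m + 2) → ℝ} (hw : ∀ v i, 0 ≤ w v i) : IsNm fun z : LL X => wn w (cz z.1) := by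
  constructor
  · intro k z
    have h1 : ∀ v : InfinitePlace K, v (k : K) = |(k : ℝ)| := fun v => pv_int_inf v k
    simp only [wn, Finset.mul_sum]
    refine Finset.sum_congr rfl fun v _ => Finset.sum_congr rfl fun i _ => ?_
    have : cz (k • z).1 i = (k : K) * cz z.1 i := by simp [cz]
    rw [this, map_mul, h1]; ring
  · intro x y
    have : cz (x + y).1 = cz x.1 + cz y.1 := by ext i; simp [cz]
    change wn w (cz (x + y).1) ≤ _
    rw [this]; exact wn_add_le hw _ _
def BB (X : Fin (m + 2) → 𝓞 K) : Submodule ℤ (LL X) where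
  carrier := {z | cz z.1 ∈ Submodule.span K {(1 : Fin (m + 2) → K)}}
  zero_mem' := by
    have : cz (0 : Fin (m + 2) → 𝓞 K) = 0 := by ext i; simp [cz]
    simp [this]
  add_mem' := by
    intro a b ha hb
    have : cz (a + b).1 = cz a.1 + cz b.1 := by ext i; simp [cz]
    simp only [Set.mem_setOf_eq] at *
    rw [this]; exact Submodule.add_mem _ ha hb
  smul_mem' := by
    intro k a ha
    have : cz (k • a).1 = (k : K) • cz a.1 := by ext i; simp [cz]
    simp only [Set.mem_setOf_eq] at *
    rw [this]; exact Submodule.smul_mem _ _ ha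
lemma mem_BB {X : Fin (m + 2) → 𝓞 K} {z : LL X} : z ∈ BB X ↔ cz z.1 ∈ Submodule.span K {(1 : Fin (m + 2) → K)} := Iff.rfl
lemma lat_fun (K : Type) [Field K] [NumberField K] (m : ℕ) : ∃ C : ℝ, 1 ≤ C ∧ ∃ N0 : ℕ, ∀ (X : Fin (m + 2) → 𝓞 K) (hs : ∑ i, X i = 0)
    (w : InfinitePlace K → Fin (m + 2) → ℝ) (hw : ∀ v i, 0 ≤ w v i) (Cw : ℝ) (hCw : 1 ≤ Cw)
    (hmin : ∀ z ∈ LL X, cz z ∉ Submodule.span K {1} → 1 ≤ Cw * wn w (cz z)) (hsm : ∀ v i, C * Cw * w v i ≤ 1),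
    ∃ t : Fin N0 → LL X →ₗ[ℤ] ℤ, (∀ k z, z ∈ BB X → t k z = 0) ∧ (∀ z, (∀ k, t k z = 0) → z ∈ BB X) ∧
      ∀ k z, |(t k z : ℝ)| ≤ C * Cw * wn w (cz z.1) := by
  classical
  obtain ⟨Cr, hCr, hround⟩ := exists_round K
  set N0 := Module.finrank ℤ (Fin (m + 2) → 𝓞 K) with hN0
  obtain ⟨C1, hC1, hlat⟩ := latT N0
  set P : ℝ := wn 1 (1 : Fin (m + 2) → K) with hP
  have hPp : 0 < P := wn_one_pos K m
  refine ⟨2 * C1 + 2 * (Cr * P), by nlinarith [mul_pos hCr hPp], N0, fun X hs w hw Cw hCw hmin hsm => ?_⟩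
  have H := wn_isNm (X := X) hw
  have hone : (1 : Fin (m + 2) → 𝓞 K) ∈ LL X := by rw [mem_LL]; simpa using hs
  have hpos : ∀ q : LL X ⧸ BB X, q ≠ 0 → 1 / (2 * Cw) ≤ qn (fun z : LL X => wn w (cz z.1)) (BB X) q := by
    intro q hq
    obtain ⟨p, rfl⟩ := (BB X).mkQ_surjective q
    refine le_qn _ fun k z hk hz => ?_
    have hk' : (k : K) ≠ 0 := by exact_mod_cast hk.ne'
    rw [← map_nsmul, ← sub_eq_zero, ← map_sub, ← LinearMap.mem_ker, Submodule.ker_mkQ, mem_BB, Submodule.mem_span_singleton] at hz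
    obtain ⟨b, hb⟩ := hz
    have hpn : p ∉ BB X := fun h => hq (by rw [← LinearMap.mem_ker, Submodule.ker_mkQ]; exact h)
    obtain ⟨y, hy⟩ := hround (b / k)
    have e1 : ∀ i, ((p.1 + y • (1 : Fin (m + 2) → 𝓞 K)) i : K) = (z.1 i : K) / k + (y - b / k) := by
      intro i
      have h2 : b = (z.1 i : K) - k * (p.1 i : K) := by
        have := congrFun hb i
        simpa [cz] using this
      have h3 : ((p.1 + y • (1 : Fin (m + 2) → 𝓞 K)) i : K) = (p.1 i : K) + y := by simp
      rw [h3, h2]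
      field_simp
      ring
    have h1 := hmin (p.1 + y • 1) ((LL X).add_mem p.2 ((LL X).smul_mem y hone)) (fun hc => hpn (by
      rw [mem_BB]
      rw [Submodule.mem_span_singleton] at hc ⊢
      obtain ⟨a, ha⟩ := hc
      refine ⟨a - y, funext fun i => ?_⟩
      have := congrFun ha i
      simp [cz] at this ⊢
      rw [this]; ring))
    have e2 : cz (p.1 + y • (1 : Fin (m + 2) → 𝓞 K)) = (fun i => (z.1 i : K) / k) + fun _ => (y - b / k) := by
      ext i; exact e1 i
    rw [e2] at h1
    have h2 : wn w (fun i => (z.1 i : K) / k) = wn w (cz z.1) / k := by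
      simp only [wn, Finset.sum_div]
      refine Finset.sum_congr rfl fun v _ => Finset.sum_congr rfl fun i _ => ?_
      have : v (k : K) = k := by
        have := pv_int_inf v (k : ℤ); simpa using this
      rw [map_div₀, this]; simp only [cz]; ring
    have h3 : Cw * wn w (fun _ : Fin (m + 2) => ((y : K) - b / k)) ≤ 1 / 2 := by
      have h4 : ∀ v i, Cw * (w v i * v ((y : K) - b / k)) ≤ 1 / (2 * P) := by
        intro v i
        rw [le_div_iff₀ (by positivity)]
        have h5 : Cw * (w v i * v ((y : K) - b / k)) ≤ Cw * (w v i * Cr) := by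
          have := hy v; have := hw v i; gcongr
        have h6 := hsm v i
        have h7 : 0 ≤ 2 * C1 * Cw * w v i := by have := hw v i; positivity
        have h8 : 0 ≤ 2 * P := by positivity
        nlinarith [mul_le_mul_of_nonneg_right h5 h8]
      have h5 : Cw * wn w (fun _ : Fin (m + 2) => ((y : K) - b / k)) ≤ (1 / (2 * P)) * P := by
        generalize 1 / (2 * P) = Q at h4 ⊢
        simp only [hP, wn, Finset.mul_sum]
        refine Finset.sum_le_sum fun v _ => Finset.sum_le_sum fun i _ => ?_
        simpa using h4 v i
      refine h5.trans (le_of_eq ?_)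
      field_simp
    have h4 := mul_le_mul_of_nonneg_left (wn_add_le hw (fun i => (z.1 i : K) / k) (fun _ => ((y : K) - b / k))) (by linarith : 0 ≤ Cw)
    rw [mul_add, h2] at h4
    rw [div_le_iff₀ (by positivity)]
    change 1 ≤ wn w (cz z.1) / k * (2 * Cw)
    linarith
  haveI : Module.Finite ℤ (LL X) := Module.Finite.trans (𝓞 K) _
  have hr : Module.finrank ℤ (LL X ⧸ BB X) ≤ N0 := by
    refine (Submodule.finrank_quotient_le (BB X)).trans ?_
    exact LinearMap.finrank_le_finrank_of_injective (f := (LL X).subtype.restrictScalars ℤ) Subtype.val_injective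
  obtain ⟨e, t, ht, hb⟩ := hlat (LL X ⧸ BB X) _ (qn_isNm (BB X) H) (1 / (2 * Cw)) (by positivity) hpos hr
  refine ⟨fun k => if e k = 0 then 0 else (t k).comp (BB X).mkQ, fun k z hz => ?_, fun z hz => ?_, fun k z => ?_⟩
  · dsimp only
    split_ifs with h
    · rfl
    · have : (BB X).mkQ z = 0 := by rw [← LinearMap.mem_ker, Submodule.ker_mkQ]; exact hz
      rw [LinearMap.comp_apply, this, map_zero]
  · have h1 : (BB X).mkQ z = 0 := by
      rw [ht ((BB X).mkQ z)]
      refine Finset.sum_eq_zero fun k _ => ?_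
      have := hz k
      dsimp only at this
      split_ifs at this with h
      · rw [h, smul_zero]
      · rw [LinearMap.comp_apply] at this
        rw [this, zero_smul]
    rwa [← LinearMap.mem_ker, Submodule.ker_mkQ] at h1
  · have hn0 := H.nonneg z
    dsimp only at hn0 ⊢
    have hc : 2 * C1 * Cw * wn w (cz z.1) ≤ (2 * C1 + 2 * (Cr * P)) * Cw * wn w (cz z.1) := by
      have : 0 ≤ 2 * (Cr * P) * Cw * wn w (cz z.1) := by positivity
      linarith
    refine le_trans ?_ hc
    split_ifs with h
    · simp; positivity
    · rw [LinearMap.comp_apply]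
      have h1 := hb k ((BB X).mkQ z)
      have h2 := hpos (e k) h
      have h3 := qn_mk_le (BB X) H z
      have h4 : |(t k ((BB X).mkQ z) : ℝ)| * (1 / (2 * Cw)) ≤ C1 * wn w (cz z.1) :=
        (mul_le_mul_of_nonneg_left h2 (abs_nonneg _)).trans (h1.trans (mul_le_mul_of_nonneg_left h3 (by linarith)))
      rw [mul_one_div, div_le_iff₀ (by positivity)] at h4
      linarith
end
section
variable {K : Type} [Field K] [NumberField K] {m : ℕ}
noncomputable def e2 (X : Fin (m + 2) → 𝓞 K) (i l : Fin (m + 2)) (s c : 𝓞 K) (h : X i * s = X l * c) : LL X :=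
  ⟨s • Pi.single i 1 - c • Pi.single l 1, by
    rw [mem_LL]; simp [Pi.single_apply, mul_sub, Finset.sum_sub_distrib, h]⟩
lemma e2_apply (X : Fin (m + 2) → 𝓞 K) (i l : Fin (m + 2)) (s c : 𝓞 K) (h : X i * s = X l * c) (j) :
    (e2 X i l s c h).1 j = (if j = i then s else 0) - (if j = l then c else 0) := by
  simp [e2, Pi.single_apply]
lemma coords (X : Fin (m + 2) → 𝓞 K) (hX : ∀ i, X i ≠ 0) (t : LL X →ₗ[ℤ] ℤ) :
    ∃ a : Fin (m + 2) → K, (∀ z : LL X, trF t z = ∑ i, (X i : K) * a i * (z.1 i : K)) ∧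
      ∀ i l s c h, trF t (e2 X i l s c h) = (X i : K) * s * (a i - a l) := by
  have hx0 : ∀ i, (X i : K) ≠ 0 := fun i => by simpa using hX i
  obtain ⟨F, hF⟩ : ∃ F : LL X →ₗ[𝓞 K] K, ∀ z, F z = trF t z :=
    ⟨{ toFun := trF t, map_add' := trF_add t, map_smul' := fun a z => by rw [trF_smul, Algebra.smul_def]; rfl }, fun z => rfl⟩
  have key : ∀ z : LL X, trF t z = ∑ i, (X i : K) * (F (e2 X i 0 (X 0) (X i) (mul_comm _ _)) / (X 0 * X i)) * (z.1 i : K) := by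
    intro z
    have h1 : X 0 • z = ∑ i, z.1 i • e2 X i 0 (X 0) (X i) (mul_comm _ _) := by
      apply Subtype.ext
      funext j
      rw [Submodule.coe_smul, Submodule.coe_sum, Finset.sum_apply]
      simp only [Submodule.coe_smul, Pi.smul_apply, e2_apply, smul_eq_mul, mul_sub, Finset.sum_sub_distrib]
      simp only [mul_ite, mul_zero, Finset.sum_ite_eq, Finset.mem_univ, if_true]
      have h2 := mem_LL.1 z.2
      by_cases hj : j = 0
      · simp only [hj, if_true]
        rw [show ∑ i, z.1 i * X i = 0 by rw [← h2]; exact Finset.sum_congr rfl fun i _ => mul_comm _ _]; ring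
      · simp [hj, mul_comm]
    have h2 := congrArg F h1
    rw [map_smul, map_sum, Algebra.smul_def, hF] at h2
    simp only [map_smul, Algebra.smul_def] at h2
    apply mul_left_cancel₀ (hx0 0)
    refine h2.trans ?_
    rw [Finset.mul_sum]
    refine Finset.sum_congr rfl fun i _ => ?_
    have := hx0 0; have := hx0 i
    field_simp
  refine ⟨_, key, fun i l s c h => ?_⟩
  rw [key]
  generalize (fun i => F (e2 X i 0 (X 0) (X i) (mul_comm _ _)) / ((X 0 : K) * X i)) = a at *
  simp only [e2_apply]
  have h' : (X i : K) * s = X l * c := by exact_mod_cast congrArg (algebraMap (𝓞 K) K) h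
  have : ∀ b : Fin (m + 2) → K, ∑ j, (X j : K) * b j * (((if j = i then s else 0) - (if j = l then c else 0) : 𝓞 K) : K) = X i * s * (b i - b l) := by
    intro b
    have h3 : ∀ j, (X j : K) * b j * (((if j = i then s else 0) - (if j = l then c else 0) : 𝓞 K) : K) = (if j = i then (X j : K) * b j * s else 0) - (if j = l then (X j : K) * b j * c else 0) := by
      intro j; split_ifs <;> simp [mul_sub]
    simp only [h3, Finset.sum_sub_distrib, Finset.sum_ite_eq', Finset.mem_univ, if_true]
    rw [mul_sub]; nth_rewrite 2 [h']; ring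
  exact this _
lemma one_le_prodR {ι : Type*} (s : Finset ι) (f : ι → ℝ) (h : ∀ i ∈ s, 1 ≤ f i) : 1 ≤ ∏ i ∈ s, f i := by
  simpa using Finset.prod_le_prod (s := s) (f := fun _ => (1:ℝ)) (g := f) (fun _ _ => zero_le_one) h
noncomputable def cdf (v : Pl K) : ℝ := ∏ j : JJ K, max 1 (pv v ((integralBasis K).traceDual j))
lemma cdf_ge (v : Pl K) : 1 ≤ cdf v := one_le_prodR _ _ fun j _ => le_max_left _ _
lemma le_cdf (v : Pl K) (j) : pv v ((integralBasis K).traceDual j) ≤ cdf v := by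
  classical
  rw [cdf, ← Finset.mul_prod_erase _ _ (Finset.mem_univ j)]
  have h1 : 1 ≤ ∏ j ∈ Finset.univ.erase j, max 1 (pv v ((integralBasis K).traceDual j)) := one_le_prodR _ _ fun j _ => le_max_left _ _
  exact (le_max_right 1 _).trans (le_mul_of_one_le_right (by positivity) h1)
variable (K) in
lemma cdf_finite : {v : Pl K | cdf v ≠ 1}.Finite := by
  refine (Set.finite_iUnion fun j => pv_finite ((integralBasis K).traceDual.ne_zero j)).subset fun v hv => ?_
  by_contra hc
  simp only [Set.mem_iUnion, Set.mem_setOf_eq, not_exists, not_not] at hc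
  exact hv (by simp [cdf, hc])
lemma trF_fin {W : Type*} [AddCommGroup W] [Module (𝓞 K) W] (t : W →ₗ[ℤ] ℤ) (z : W) (v : FinitePlace K) : pv (Sum.inr v) (trF t z : K) ≤ cdf (Sum.inr v : Pl K) := by
  refine na_sum _ (isNA v) _ _ (by linarith [cdf_ge (Sum.inr v : Pl K)]) fun j _ => ?_
  rw [map_mul]
  exact (mul_le_of_le_one_left ((pv _).nonneg _) (pv_int v _)).trans (le_cdf _ j)
lemma lim_bound {ι : Type*} [Fintype ι] [DecidableEq ι] (v : ι) (u A : ι → ℝ) (hu : ∀ i, 0 ≤ u i) (hv : 0 < u v) (hlt : ∀ i, i ≠ v → u i < u v) (x : ℝ)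
    (h : ∀ N : ℕ, u v ^ N * x ≤ ∑ i, u i ^ N * A i) : x ≤ A v := by
  have h1 : Filter.Tendsto (fun N : ℕ => ∑ i, (u i / u v) ^ N * A i) Filter.atTop (nhds (∑ i, if i = v then A i else 0)) := by
    refine tendsto_finset_sum _ fun i _ => ?_
    by_cases hi : i = v
    · simp [hi, div_self hv.ne']
    · rw [if_neg hi]
      have := (tendsto_pow_atTop_nhds_zero_of_lt_one (div_nonneg (hu i) hv.le) ((div_lt_one hv).2 (hlt i hi))).mul_const (A i)
      simpa using this
  rw [Finset.sum_ite_eq' _ v, if_pos (Finset.mem_univ _)] at h1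
  refine ge_of_tendsto' h1 fun N => ?_
  have h2 : ∑ i, (u i / u v) ^ N * A i = (∑ i, u i ^ N * A i) / u v ^ N := by
    rw [Finset.sum_div]; refine Finset.sum_congr rfl fun i _ => ?_
    rw [div_pow]; ring
  rw [h2, le_div_iff₀ (pow_pos hv N), mul_comm]
  exact h N
lemma inf_bound (X : Fin (m + 2) → 𝓞 K) (hX : ∀ i, X i ≠ 0) (w : InfinitePlace K → Fin (m + 2) → ℝ) (hw : ∀ v i, 0 ≤ w v i) (C : ℝ) (hC : 0 ≤ C) (t : LL X →ₗ[ℤ] ℤ)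
    (ht : ∀ z, |(t z : ℝ)| ≤ C * wn w (cz z.1)) (a : Fin (m + 2) → K)
    (ha : ∀ i l s c h, trF t (e2 X i l s c h) = (X i : K) * s * (a i - a l)) (v : InfinitePlace K) (i l : Fin (m + 2)) (hil : i ≠ l) (hl : w v l = 0) :
    v (a i - a l) * v (X i : K) ≤ (C * ∑ j : JJ K, ∑ v' : InfinitePlace K, v' (integralBasis K j) * v ((integralBasis K).traceDual j)) * w v i := by
  classical
  set Q : ℝ := ∑ j : JJ K, ∑ v' : InfinitePlace K, v' (integralBasis K j) * v ((integralBasis K).traceDual j) with hQ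
  have hQ0 : 0 ≤ Q := Finset.sum_nonneg fun j _ => Finset.sum_nonneg fun v' _ => mul_nonneg (apply_nonneg _ _) (apply_nonneg _ _)
  have hx0 : ∀ i, (X i : K) ≠ 0 := fun i => by simpa using hX i
  obtain ⟨u, hu0, hu⟩ := exists_tau v
  have h1 := lim_bound v (fun v' => v' (u : K)) (fun v' => C * Q * (w v' i * v' (X l : K) + w v' l * v' (X i : K))) (fun _ => apply_nonneg _ _) hu0 (fun v' h => hu v' h)
    (v (X i : K) * v (X l : K) * v (a i - a l)) (by
    intro N
    have e : X i * (u ^ N * X l) = X l * (u ^ N * X i) := by ring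
    set z := e2 X i l (u ^ N * X l) (u ^ N * X i) e with hz
    have h2 : v (trF t z : K) = v (u : K) ^ N * (v (X i : K) * v (X l : K) * v (a i - a l)) := by
      rw [hz, ha]; push_cast; rw [map_mul, map_mul, map_mul, map_pow]; ring
    rw [← h2]
    have hzc : ∀ j, w v j * 0 ≤ 0 := fun j => by simp
    set A : InfinitePlace K → ℝ := fun v' => w v' i * v' (X l : K) + w v' l * v' (X i : K) with hA
    have hA0 : ∀ v', 0 ≤ A v' := fun v' => add_nonneg (mul_nonneg (hw _ _) (apply_nonneg _ _)) (mul_nonneg (hw _ _) (apply_nonneg _ _))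
    have hwz : ∀ j : JJ K, wn w (cz (RingOfIntegers.basis K j • z).1) = ∑ v' : InfinitePlace K, v' (integralBasis K j) * (v' (u : K) ^ N * A v') := by
      intro j
      refine Finset.sum_congr rfl fun v' _ => ?_
      have h3 : ∀ p, w v' p * v' (cz (RingOfIntegers.basis K j • z).1 p) = v' (integralBasis K j) * v' (u : K) ^ N * ((if p = i then w v' i * v' (X l : K) else 0) + (if p = l then w v' l * v' (X i : K) else 0)) := by
        intro p
        have h4 : cz (RingOfIntegers.basis K j • z).1 p = integralBasis K j * (z.1 p : K) := by
          simp [cz, integralBasis_apply]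
        rw [h4, hz, e2_apply, map_mul]
        by_cases hp : p = i
        · subst hp
          simp only [if_true, if_neg hil, sub_zero, add_zero]; push_cast; rw [map_mul, map_pow]; ring
        · by_cases hp2 : p = l
          · subst hp2
            simp only [if_neg hp, if_true, zero_sub, zero_add]; push_cast
            rw [show v' (-((u : K) ^ N * (X i : K))) = v' ((u : K) ^ N * (X i : K)) from (pv (Sum.inl v' : Pl K)).map_neg _, map_mul, map_pow]; ring
          · simp [hp, hp2]
      rw [Finset.sum_congr rfl fun p _ => h3 p, ← Finset.mul_sum, Finset.sum_add_distrib]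
      simp only [Finset.sum_ite_eq', Finset.mem_univ, if_true, hA]
      ring
    have h3 : v (trF t z : K) ≤ ∑ j : JJ K, (C * ∑ v' : InfinitePlace K, v' (integralBasis K j) * (v' (u : K) ^ N * A v')) * v ((integralBasis K).traceDual j) := by
      refine ((pv (Sum.inl v : Pl K)).sum_le _ _).trans (Finset.sum_le_sum fun j _ => ?_)
      rw [map_mul]
      refine mul_le_mul_of_nonneg_right ?_ ((pv _).nonneg _)
      have := ht (RingOfIntegers.basis K j • z)
      rw [hwz] at this
      refine le_trans (le_of_eq ?_) this
      exact pv_int_inf v _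
    refine h3.trans ?_
    rw [← Finset.sum_congr rfl fun v' _ => show C * (Q * (v' (u : K) ^ N * A v')) = v' (u : K) ^ N * (C * Q * A v') by ring, ← Finset.mul_sum, ← Finset.mul_sum]
    rw [← Finset.sum_congr rfl fun j _ => show C * ((∑ v' : InfinitePlace K, v' (integralBasis K j) * (v' (u : K) ^ N * A v')) * v ((integralBasis K).traceDual j)) = _ by ring, ← Finset.mul_sum]
    refine mul_le_mul_of_nonneg_left ?_ hC
    rw [hQ, Finset.sum_mul]
    refine Finset.sum_le_sum fun j _ => ?_
    rw [← Finset.sum_mul, mul_right_comm]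
    refine mul_le_mul_of_nonneg_right ?_ (apply_nonneg _ _)
    rw [Finset.mul_sum]
    refine Finset.sum_le_sum fun v' _ => ?_
    exact mul_le_mul_of_nonneg_right (Finset.single_le_sum (f := fun v' : InfinitePlace K => v' (integralBasis K j)) (fun _ _ => apply_nonneg _ _) (Finset.mem_univ v')) (mul_nonneg (pow_nonneg (apply_nonneg _ _) _) (hA0 _)))
  simp only [hl, zero_mul, add_zero] at h1
  have hp : 0 < v (X l : K) := InfinitePlace.pos_iff.2 (hx0 l)
  refine le_of_mul_le_mul_right ?_ hp
  linarith
end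
theorem E_main (K : Type) [Field K] [NumberField K] (m : ℕ) (hm : 1 ≤ m) : ∃ C : ℝ, 1 ≤ C ∧ ∃ N0 : ℕ, ∀ (X : Fin (m + 2) → 𝓞 K) (hX : ∀ i, X i ≠ 0) (hs : ∑ i, X i = 0)
    (iv : Pl K → Fin (m + 2)) (hiv : ∀ v i, pv v (X i : K) ≤ pv v (X (iv v) : K)) (h L : ℝ) (hh : h = ∑ᶠ v, wt v * Real.log (pv v (X (iv v) : K)))
    (hL1 : C ≤ L) (hLh : L ≤ Real.exp h) (hL : ∀ z ∈ LL X, cz z ∉ Submodule.span K {1} → L ≤ wn 1 (cz z)),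
    ∃ (w : InfinitePlace K → Fin (m + 2) → ℝ) (a : Fin N0 → Fin (m + 2) → K),
      (∀ v i, i ≠ iv (Sum.inl v) → Real.exp (-h) ≤ w v i ∧ w v i ≤ 1) ∧
      ∑ v : InfinitePlace K, wt (Sum.inl v : Pl K) * ∑ i ∈ Finset.univ.erase (iv (Sum.inl v)), Real.log (w v i) ≤ - h - Real.log L + C ∧
      (∀ k, ∑ i, (X i : K) * a k i = 0) ∧
      (∀ z : Fin (m + 2) → K, ∑ i, (X i : K) * z i = 0 → (∀ k, ∑ i, (X i : K) * a k i * z i = 0) → z ∈ Submodule.span K {(1 : Fin (m + 2) → K)}) ∧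
      (∀ k (v : InfinitePlace K) i, i ≠ iv (Sum.inl v) → pv (Sum.inl v : Pl K) (a k i - a k (iv (Sum.inl v))) * pv (Sum.inl v : Pl K) (X i) ≤ C * w v i) ∧
      (∀ k (v : FinitePlace K) i l, pv (Sum.inr v : Pl K) (X i) ≤ pv (Sum.inr v : Pl K) (X l) → pv (Sum.inr v : Pl K) (a k i - a k l) * pv (Sum.inr v : Pl K) (X i) ≤ cdf (Sum.inr v : Pl K)) := by
  classical
  obtain ⟨Cw, hCw, hwt⟩ := weights K m hm
  obtain ⟨Cl, hCl, N0, hlat⟩ := lat_fun K m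
  set Q : InfinitePlace K → ℝ := fun v => ∑ j : JJ K, ∑ v' : InfinitePlace K, v' (integralBasis K j) * v ((integralBasis K).traceDual j) with hQ
  have hQ0 : ∀ v, 0 ≤ Q v := fun v => Finset.sum_nonneg fun j _ => Finset.sum_nonneg fun v' _ => mul_nonneg (apply_nonneg _ _) (apply_nonneg _ _)
  have hS : 0 ≤ ∑ v, Q v := Finset.sum_nonneg fun v _ => hQ0 v
  have hclw : 1 ≤ Cl * Cw := one_le_mul_of_one_le_of_one_le hCl hCw
  refine ⟨2 * (Cl * Cw) + Cw + Cl * Cw * ∑ v, Q v, by nlinarith [mul_nonneg (zero_le_one.trans hclw) hS], N0, ?_⟩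
  have h0 : 0 ≤ Cl * Cw * ∑ v, Q v := mul_nonneg (by linarith) hS
  intro X hX hs iv hiv h L hh hL1 hLh hL
  have hx0 : ∀ i, (X i : K) ≠ 0 := fun i => by simpa using hX i
  have hL2 : 2 * (Cl * Cw) ≤ L := by linarith
  have hLp : 0 < L := by linarith
  obtain ⟨w, hw0, hw1, hw2, hw3, hw4⟩ := hwt X hX hs iv hiv h L hh (by linarith) hLh hL
  have hw2' : ∀ v i, Cl * Cw * w v i ≤ 1 := by
    intro v i
    by_cases hi : i = iv (Sum.inl v)
    · rw [hi, hw0]; simp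
    · refine (mul_le_mul_of_nonneg_left (hw2 v i hi).2 (by linarith)).trans ?_
      rw [← mul_div_assoc, div_le_one hLp]; linarith
  obtain ⟨t, ht1, ht2, ht3⟩ := hlat X hs w hw1 Cw hCw hw3 hw2'
  choose a ha1 ha2 using fun k => coords X hX (t k)
  refine ⟨w, a, fun v i hi => ⟨(hw2 v i hi).1, ?_⟩, by linarith, fun k => ?_, fun z hz hza => ?_, fun k v i hi => ?_, fun k v i l hil => ?_⟩
  · have := hw2' v i
    have h3 := le_mul_of_one_le_left (hw1 v i) hclw
    linarith
  · have hone : (1 : Fin (m + 2) → 𝓞 K) ∈ LL X := by rw [mem_LL]; simpa using hs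
    have h1 := ha1 k ⟨1, hone⟩
    simp only [Pi.one_apply, map_one, mul_one] at h1
    rw [← h1]
    refine Finset.sum_eq_zero fun j _ => ?_
    rw [ht1 k _ ?_]
    · simp
    · rw [mem_BB, Submodule.mem_span_singleton]
      exact ⟨RingOfIntegers.basis K j, by ext i; simp [cz]⟩
  · obtain ⟨D, hD, y, hy⟩ := clear_den z
    have hD' : (D : K) ≠ 0 := by simpa using hD
    have hyL : y ∈ LL X := by
      rw [mem_LL', LinearMap.mem_ker, xp_apply]
      simp only [cz, hy]
      rw [← mul_zero (D : K), ← hz, Finset.mul_sum]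
      exact Finset.sum_congr rfl fun i _ => by ring
    have h1 := ht2 ⟨y, hyL⟩ fun k => trF_zero (K := K) (by
      rw [ha1]
      simp only [hy]
      rw [← mul_zero (D : K), ← hza k, Finset.mul_sum]
      exact Finset.sum_congr rfl fun i _ => by ring)
    rw [mem_BB] at h1
    have h2 : z = (D : K)⁻¹ • cz y := by
      ext i; simp only [Pi.smul_apply, cz, hy, smul_eq_mul]; field_simp
    rw [h2]; exact Submodule.smul_mem _ _ h1
  · have := inf_bound X hX w hw1 (Cl * Cw) (by linarith) (t k) (ht3 k) (a k) (ha2 k) v i _ hi (hw0 v)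
    refine le_trans this (mul_le_mul_of_nonneg_right ?_ (hw1 v i))
    have h1 : Q v ≤ ∑ v, Q v := Finset.single_le_sum (fun v _ => hQ0 v) (Finset.mem_univ v)
    have h2 := mul_le_mul_of_nonneg_left h1 (by linarith : 0 ≤ Cl * Cw)
    change Cl * Cw * Q v ≤ _
    linarith
  · obtain ⟨s, c, hs1, hsc⟩ := loc_int v (X i) (X l) (hX l) hil
    have h1 := trF_fin (t k) (e2 X i l s c hsc) v
    rw [ha2, map_mul, map_mul] at h1
    have h2 : pv (Sum.inr v : Pl K) (s : K) = 1 := hs1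
    rw [h2, mul_one, mul_comm] at h1
    exact h1
section
variable {K : Type} [Field K] [NumberField K] {ι : Type} [Fintype ι]
noncomputable def oS (T : Finset (Pl K)) (x : K) : ℝ :=
  open Classical in ∑ᶠ v : Pl K, wt v * (if v ∈ T then 0 else |Real.log (pv v x)|)
lemma oS_supp (T : Finset (Pl K)) {x : K} (hx : x ≠ 0) : open Classical in (Function.support fun v : Pl K => wt v * (if v ∈ T then 0 else |Real.log (pv v x)|)).Finite := by
  refine (pv_finite hx).subset fun v hv h => hv ?_
  simp [h]
lemma oS_mul (T : Finset (Pl K)) {x y : K} (hx : x ≠ 0) (hy : y ≠ 0) : oS T (x * y) ≤ oS T x + oS T y := by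
  rw [oS, oS, oS, ← finsum_add_distrib (oS_supp T hx) (oS_supp T hy)]
  refine fsum_le (oS_supp T (mul_ne_zero hx hy)) (((oS_supp T hx).union (oS_supp T hy)).subset (Function.support_add _ _)) fun v => ?_
  rw [← mul_add]
  refine mul_le_mul_of_nonneg_left ?_ (wt_pos v).le
  split_ifs
  · simp
  · rw [map_mul, Real.log_mul ((pv v).pos hx).ne' ((pv v).pos hy).ne']; exact abs_add_le _ _
lemma oS_inv (T : Finset (Pl K)) (x : K) : oS T x⁻¹ = oS T x := by
  simp only [oS, map_inv₀, Real.log_inv, abs_neg]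
lemma oS_div (T : Finset (Pl K)) {x y : K} (hx : x ≠ 0) (hy : y ≠ 0) : oS T (x / y) ≤ oS T x + oS T y := by
  rw [div_eq_mul_inv, ← oS_inv T y]; exact oS_mul T hx (inv_ne_zero hy)
lemma oS_mono {T T' : Finset (Pl K)} (h : T ⊆ T') {x : K} (hx : x ≠ 0) : oS T' x ≤ oS T x := by
  refine fsum_le (oS_supp T' hx) (oS_supp T hx) fun v => mul_le_mul_of_nonneg_left ?_ (wt_pos v).le
  split_ifs with h1 h2 h2
  · exact le_rfl
  · exact abs_nonneg _
  · exact absurd (h h2) h1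
  · exact le_rfl
lemma oS_le (T : Finset (Pl K)) {x : K} (hx : x ≠ 0) : oS T x ≤ 2 * logHeight₁ x := by
  have h1 : 2 * logHeight₁ x = logHeight₁ x + logHeight₁ x⁻¹ := by rw [logHeight₁_inv]; ring
  rw [h1, logHeight_eq hx, logHeight_eq (inv_ne_zero hx), ← finsum_add_distrib (supp_posLog hx) (supp_posLog (inv_ne_zero hx))]
  refine fsum_le (oS_supp T hx) (((supp_posLog hx).union (supp_posLog (inv_ne_zero hx))).subset (Function.support_add _ _)) fun v => ?_
  rw [← mul_add]
  refine mul_le_mul_of_nonneg_left ?_ (wt_pos v).le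
  rw [map_inv₀]
  have h2 : Real.posLog (pv v x) = max 0 (Real.log (pv v x)) := rfl
  have h3 : Real.posLog (pv v x)⁻¹ = max 0 (- Real.log (pv v x)) := by rw [← Real.log_inv]; rfl
  rw [h2, h3]
  have := le_max_left 0 (Real.log (pv v x)); have := le_max_right 0 (Real.log (pv v x))
  have := le_max_left 0 (-Real.log (pv v x)); have := le_max_right 0 (-Real.log (pv v x))
  split_ifs
  · linarith
  · rw [abs_le]; constructor <;> linarith
lemma log_le_H (v : Pl K) {y : K} (hy : y ≠ 0) : Real.log (pv v y) ≤ logHeight₁ y := by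
  rw [logHeight_eq hy]
  have h1 : wt v * Real.posLog (pv v y) ≤ ∑ᶠ v : Pl K, wt v * Real.posLog (pv v y) :=
    single_le_finsum v (supp_posLog hy) fun v => mul_nonneg (wt_pos v).le Real.posLog_nonneg
  have h2 : Real.posLog (pv v y) ≤ wt v * Real.posLog (pv v y) := le_mul_of_one_le_left Real.posLog_nonneg (wt_ge v)
  exact (le_max_right _ _).trans (h2.trans h1)
lemma abs_log_le (v : Pl K) {y : K} (hy : y ≠ 0) : |Real.log (pv v y)| ≤ logHeight₁ y := by
  rw [abs_le]
  refine ⟨?_, log_le_H v hy⟩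
  have := log_le_H v (inv_ne_zero hy)
  rw [map_inv₀, Real.log_inv, logHeight₁_inv] at this
  linarith
lemma fsum_split (T : Finset (Pl K)) (f : Pl K → ℝ) (hf : (Function.support f).Finite) : open Classical in
    ∑ᶠ v, f v = ∑ v ∈ T, f v + ∑ᶠ v, (if v ∈ T then 0 else f v) := by
  classical
  have h1 : ∑ v ∈ T, f v = ∑ᶠ v, (if v ∈ T then f v else 0) := by
    rw [finsum_eq_sum_of_support_subset (s := T)]
    · exact Finset.sum_congr rfl fun v hv => by rw [if_pos hv]
    · intro v hv
      by_contra hc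
      exact hv (if_neg (by simpa using hc))
  rw [h1, ← finsum_add_distrib (hf.subset fun v hv h => hv (by simp [h])) (hf.subset fun v hv h => hv (by simp [h]))]
  refine finsum_congr fun v => ?_
  split_ifs <;> simp
lemma T_log (T : Finset (Pl K)) {y : K} (hy : y ≠ 0) : - ∑ v ∈ T, wt v * Real.log (pv v y) ≤ oS T y := by
  classical
  have h1 := fsum_split T _ (supp_log hy)
  rw [prodf hy] at h1
  have h2 : ∑ᶠ v, (if v ∈ T then 0 else wt v * Real.log (pv v y)) ≤ oS T y := by
    refine fsum_le ((supp_log hy).subset fun v hv h => hv (by simp [h])) (oS_supp T hy) fun v => ?_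
    split_ifs
    · simp
    · exact mul_le_mul_of_nonneg_left (le_abs_self _) (wt_pos v).le
  linarith
noncomputable def ph (x : ι → K) (iv : Pl K → ι) : ℝ := ∑ᶠ v, wt v * Real.log (pv v (x (iv v)))
lemma ph_supp {x : ι → K} (hx : ∀ i, x i ≠ 0) (iv : Pl K → ι) : (Function.support fun v => wt v * Real.log (pv v (x (iv v)))).Finite := by
  refine (Set.finite_iUnion fun k => pv_finite (hx k)).subset fun v hv => Set.mem_iUnion.2 ⟨iv v, fun h => hv ?_⟩
  simp [h]
lemma ph_scale {x y : ι → K} (hx : ∀ i, x i ≠ 0) (iv : Pl K → ι) {c : K} (hc : c ≠ 0) (hy : ∀ i, y i = c * x i) : ph y iv = ph x iv := by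
  have h2 : ∀ v : Pl K, wt v * Real.log (pv v (y (iv v))) = wt v * Real.log (pv v c) + wt v * Real.log (pv v (x (iv v))) := by
    intro v
    rw [hy, map_mul, Real.log_mul ((pv v).pos hc).ne' ((pv v).pos (hx _)).ne', mul_add]
  rw [ph, finsum_congr h2, finsum_add_distrib (supp_log hc) (ph_supp hx iv), prodf hc, zero_add, ph]
lemma H_le_ph {x : ι → K} (hx : ∀ i, x i ≠ 0) {iv : Pl K → ι} (hiv : ∀ v i, pv v (x i) ≤ pv v (x (iv v))) (i l : ι) : logHeight₁ (x i / x l) ≤ ph x iv := by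
  have hne : x i / x l ≠ 0 := div_ne_zero (hx i) (hx l)
  rw [logHeight_eq hne, ← ph_scale (y := fun i => (x l)⁻¹ * x i) hx iv (inv_ne_zero (hx l)) fun i => rfl]
  refine fsum_le (supp_posLog hne) (ph_supp (fun i => mul_ne_zero (inv_ne_zero (hx l)) (hx i)) iv) fun v => mul_le_mul_of_nonneg_left ?_ (wt_pos v).le
  have h1 : ∀ i, pv v ((x l)⁻¹ * x i) = pv v (x i) / pv v (x l) := fun i => by rw [map_mul, map_inv₀]; ring
  have hp := (pv v).pos (hx l)
  rw [h1]
  refine max_le (Real.log_nonneg ?_) ?_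
  · rw [one_le_div hp]; exact hiv v l
  · rw [map_div₀]
    refine Real.log_le_log (div_pos ((pv v).pos (hx i)) hp) ?_
    have := hiv v i; gcongr
lemma ph_le {x : ι → K} (hx : ∀ i, x i ≠ 0) (iv : Pl K → ι) (l : ι) : ph x iv ≤ ∑ i, logHeight₁ (x i / x l) := by
  have hne : ∀ i, x i / x l ≠ 0 := fun i => div_ne_zero (hx i) (hx l)
  rw [Finset.sum_congr rfl fun i _ => logHeight_eq (hne i), ← finsum_sum_comm _ _ (fun i _ => supp_posLog (hne i)),
    ← ph_scale (y := fun i => (x l)⁻¹ * x i) hx iv (inv_ne_zero (hx l)) fun i => rfl]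
  refine fsum_le (ph_supp (fun i => mul_ne_zero (inv_ne_zero (hx l)) (hx i)) iv) ?_ fun v => ?_
  · refine (Set.finite_iUnion fun k => pv_finite (hne k)).subset fun v hv => ?_
    by_contra hc
    simp only [Set.mem_iUnion, Set.mem_setOf_eq, not_exists, not_not] at hc
    exact hv (by simp [hc])
  · rw [← Finset.mul_sum]
    refine mul_le_mul_of_nonneg_left ?_ (wt_pos v).le
    refine le_trans ?_ (Finset.single_le_sum (f := fun i => Real.posLog (pv v (x i / x l))) (fun i _ => Real.posLog_nonneg) (Finset.mem_univ (iv v)))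
    dsimp only
    rw [inv_mul_eq_div]
    exact le_max_right _ _
lemma T_ph (T : Finset (Pl K)) {x : ι → K} (hx : ∀ i, x i ≠ 0) (iv : Pl K → ι) : ∑ v ∈ T, wt v * Real.log (pv v (x (iv v))) ≤ ph x iv + ∑ i, oS T (x i) := by
  classical
  have h1 := fsum_split T _ (ph_supp hx iv)
  have h2 : - ∑ᶠ v, (if v ∈ T then 0 else wt v * Real.log (pv v (x (iv v)))) ≤ ∑ i, oS T (x i) := by
    simp only [oS]
    rw [← finsum_sum_comm _ _ (fun i _ => oS_supp T (hx i)), ← finsum_neg_distrib]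
    refine fsum_le ((ph_supp hx iv).subset fun v hv h => hv (by simp [h])) ?_ fun v => ?_
    · refine (Set.finite_iUnion fun k => pv_finite (hx k)).subset fun v hv => ?_
      by_contra hc
      simp only [Set.mem_iUnion, Set.mem_setOf_eq, not_exists, not_not] at hc
      exact hv (by simp [hc])
    · split_ifs with h
      · simp
      · refine le_trans ?_ (Finset.single_le_sum (f := fun i => wt v * |Real.log (pv v (x i))|) (fun i _ => mul_nonneg (wt_pos v).le (abs_nonneg _)) (Finset.mem_univ (iv v)))
        rw [← mul_neg]
        exact mul_le_mul_of_nonneg_left (neg_le_abs _) (wt_pos v).le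
  rw [ph]
  linarith
end
open NumberField Height Filter
section
variable {J : Type} (U : Ultrafilter J)
lemma uex {α : Type*} [Finite α] {P : J → α → Prop} (h : ∀ᶠ j in U.1, ∃ a, P j a) : ∃ a, ∀ᶠ j in U.1, P j a := by
  by_contra hc
  push Not at hc
  obtain ⟨j, hj, a, ha⟩ := ((eventually_all.2 hc).and h).exists
  exact hj a ha
lemma ulim {f : J → ℝ} {B : ℝ} (h : ∀ᶠ j in U.1, |f j| ≤ B) : ∃ c, Tendsto f U (nhds c) := by
  obtain ⟨c, _, hc⟩ := (isCompact_Icc (a := -B) (b := B)).ultrafilter_le_nhds (U.map f) (by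
    rw [le_principal_iff]
    exact h.mono fun j hj => abs_le.1 hj)
  exact ⟨c, hc⟩
def pp {m : ℕ} (k : Fin (m + 2)) (i : Fin (m + 1)) : Fin (m + 2) := if i.succ = k then 0 else i.succ
lemma pp_ne {m : ℕ} (k : Fin (m + 2)) (i : Fin (m + 1)) : pp k i ≠ k := by
  unfold pp; split_ifs with h
  · rw [← h]; exact (Fin.succ_ne_zero i).symm
  · exact h
lemma sum_pp {m : ℕ} (k : Fin (m + 2)) (f : Fin (m + 2) → ℝ) : ∑ i, f (pp k i) = ∑ q, f q - f k := by
  rw [Fin.sum_univ_succ f]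
  refine Fin.cases ?_ (fun k => ?_) k
  · simp [pp, Fin.succ_ne_zero]
  · have : ∀ i, f (pp k.succ i) = f i.succ + if i = k then f 0 - f k.succ else 0 := by
      intro i; simp only [pp, Fin.succ_inj]; split_ifs with h
      · rw [h]; ring
      · ring
    simp only [this, Finset.sum_add_distrib, Finset.sum_ite_eq', Finset.mem_univ, if_true]
    ring
def AA {m : ℕ} (k : Fin (m + 2)) : Matrix (Fin (m + 1)) (Fin (m + 1)) ℤ :=
  Matrix.of fun i j => (if pp k i = j.succ then 1 else 0) - (if k = j.succ then 1 else 0)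
lemma AA_app {m : ℕ} {R : Type*} [CommRing R] (k : Fin (m + 2)) (i) (y : R) (b : Fin (m + 2) → R) :
    ∑ j, ((AA k i j : ℤ) : R) * (y * (b j.succ - b 0)) = y * (b (pp k i) - b k) := by
  have h1 : ∀ q : Fin (m + 2), ∑ j : Fin (m + 1), (if q = j.succ then 1 else 0 : R) * (y * (b j.succ - b 0)) = y * (b q - b 0) := by
    intro q
    refine Fin.cases ?_ (fun q => ?_) q
    · simp [(Fin.succ_ne_zero _).symm]
    · simp [Fin.succ_inj]
  have h2 : ∀ j, ((AA k i j : ℤ) : R) * (y * (b j.succ - b 0)) = (if pp k i = j.succ then 1 else 0 : R) * (y * (b j.succ - b 0)) - (if k = j.succ then 1 else 0 : R) * (y * (b j.succ - b 0)) := by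
    intro j; simp only [AA, Matrix.of_apply]; push_cast; ring
  rw [Finset.sum_congr rfl fun j _ => h2 j, Finset.sum_sub_distrib, h1, h1]; ring
lemma AA_sq {m : ℕ} (k : Fin (m + 2)) : AA k * AA k = 1 := by
  ext i l
  rw [Matrix.mul_apply]
  have h1 := AA_app (R := ℤ) k i 1 (Fin.cons 0 fun j => AA k j l)
  simp only [Fin.cons_succ, Fin.cons_zero, sub_zero, one_mul, Int.cast_id] at h1
  rw [h1]
  refine Fin.cases ?_ (fun k => ?_) k
  · simp [pp, AA, Fin.succ_ne_zero, (Fin.succ_ne_zero _).symm, Matrix.one_apply, Fin.succ_inj]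
  · by_cases hi : i = k
    · subst hi
      simp [pp, AA, (Fin.succ_ne_zero _).symm, Matrix.one_apply]
    · simp [pp, AA, hi, (Fin.succ_ne_zero _).symm, Matrix.one_apply]
variable {K : Type} [Field K] [NumberField K]
lemma span_of_ann {n N : ℕ} (F : Fin N → Fin n → K) (b : Fin n → K) (h : ∀ y : Fin n → K, (∀ k, ∑ i, y i * F k i = 0) → ∑ i, y i * b i = 0) : b ∈ Submodule.span K (Set.range F) := by
  by_contra hc
  obtain ⟨f, hf, hle⟩ := Submodule.exists_le_ker_of_notMem hc
  have h1 : ∀ z : Fin n → K, f z = ∑ i, f (Pi.single i 1) * z i := by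
    intro z
    conv_lhs => rw [← Finset.univ_sum_single z]
    rw [map_sum]
    refine Finset.sum_congr rfl fun i _ => ?_
    rw [show Pi.single i (z i) = z i • (Pi.single i 1 : Fin n → K) by ext l; simp [Pi.single_apply], map_smul, smul_eq_mul, mul_comm]
  refine hf ?_
  rw [h1]
  refine h _ fun k => ?_
  rw [← h1]
  exact hle (Submodule.subset_span ⟨k, rfl⟩)
end
section
variable {K : Type} [Field K] [NumberField K]
lemma datum (K : Type) [Field K] [NumberField K] (m : ℕ) (hm : 1 ≤ m) (T : Finset (Pl K)) (hT : ∀ v, Sum.inl v ∈ T) (hT' : ∀ v, cdf v ≠ 1 → v ∈ T) : ∃ C : ℝ, 1 ≤ C ∧ ∃ N0 : ℕ, ∀ (X : Fin (m + 2) → 𝓞 K) (hX : ∀ i, X i ≠ 0) (hs : ∑ i, X i = 0)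
    (iv : Pl K → Fin (m + 2)) (hiv : ∀ v i, pv v (X i : K) ≤ pv v (X (iv v) : K)) (h L : ℝ) (hh : h = ph (cz X) iv)
    (hL1 : C ≤ L) (hLh : L ≤ Real.exp h) (hL : ∀ z ∈ LL X, cz z ∉ Submodule.span K {1} → L ≤ wn 1 (cz z)),
    ∃ (F : Fin N0 → Fin (m + 1) → K) (g : Pl K → Fin (m + 2) → ℝ),
      (∀ v q, q ≠ iv v → |g v q| ≤ 2 * h) ∧
      ∑ v ∈ T, wt v * ∑ i, g v (pp (iv v) i) ≤ - Real.log L + C + 2 * ∑ q, oS T ((X q : K) / X 0) ∧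
      (∀ a : Fin (m + 1) → K, ∑ i, (X i.succ : K) * a i = 0 → a ∈ Submodule.span K (Set.range F)) ∧
      (∀ v k i, pv v (∑ j, ((AA (iv v) i j : ℤ) : K) * F k j) ≤ max C (cdf v) * Real.exp (g v (pp (iv v) i))) ∧
      (∀ v ∉ T, ∀ k i, pv v (F k i) ≤ Real.exp (∑ q, |Real.log (pv v ((X q : K) / X 0))|)) := by
  classical
  obtain ⟨C, hC, N0, hE⟩ := E_main K m hm
  refine ⟨C, hC, N0, fun X hX hs iv hiv h L hh hL1 hLh hL => ?_⟩
  obtain ⟨w, a, hw, hws, ha, hsp, hai, haf⟩ := hE X hX hs iv hiv h L hh hL1 hLh hL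
  have hx0 : ∀ i, (X i : K) ≠ 0 := fun i => by simpa using hX i
  have hd0 : ∀ i, (X i : K) / X 0 ≠ 0 := fun i => div_ne_zero (hx0 i) (hx0 0)
  have hph : ph (fun i => (X i : K) / X 0) iv = h := by
    rw [hh]; exact ph_scale hx0 iv (inv_ne_zero (hx0 0)) fun i => div_eq_inv_mul _ _
  have hH : ∀ v i, |Real.log (pv v ((X i : K) / X 0))| ≤ h := fun v i => (abs_log_le v (hd0 i)).trans (by
    rw [hh]; exact H_le_ph (x := cz X) hx0 hiv i 0)
  have key : ∀ (v : Pl K) (q : Fin (m + 2)) (y B : ℝ), y * pv v (X q : K) ≤ B → pv v (X 0 : K) * y ≤ B * Real.exp (- Real.log (pv v ((X q : K) / X 0))) := by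
    intro v q y B hy
    rw [Real.exp_neg, Real.exp_log ((pv v).pos (hd0 q)), map_div₀, inv_div]
    have h1 := (pv v).pos (hx0 q)
    rw [← mul_div_assoc, le_div_iff₀ h1]
    nlinarith [(pv v).pos (hx0 0)]
  have hwp : ∀ v i, i ≠ iv (Sum.inl v) → 0 < w v i := fun v i hi => (Real.exp_pos _).trans_le (hw v i hi).1
  refine ⟨fun k i => X 0 * (a k i.succ - a k 0), fun v q => (Sum.elim (fun v => Real.log (w v q)) (fun _ => 0) v) - Real.log (pv v ((X q : K) / X 0)), ?_, ?_, ?_, ?_, ?_⟩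
  · intro v q hq
    refine (abs_sub _ _).trans ?_
    have h1 : |Sum.elim (fun v => Real.log (w v q)) (fun _ => 0) v| ≤ h := by
      rcases v with v | v
      · have h2 := hw v q hq
        rw [Sum.elim_inl, abs_le]
        refine ⟨?_, (Real.log_nonpos (hwp v q hq).le h2.2).trans ((abs_nonneg _).trans (hH (Sum.inl v) q))⟩
        rw [Real.le_log_iff_exp_le (hwp v q hq)]; exact h2.1
      · simpa using (abs_nonneg _).trans (hH (Sum.inr v) q)
    linarith [hH v q]
  · have e1 : ∀ v : Pl K, wt v * ∑ i, ((Sum.elim (fun v' => Real.log (w v' (pp (iv v) i))) (fun _ => 0) v) - Real.log (pv v ((X (pp (iv v) i) : K) / X 0)))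
        = wt v * ∑ i, (Sum.elim (fun v' => Real.log (w v' (pp (iv v) i))) (fun _ => 0) v) - ∑ q, wt v * Real.log (pv v ((X q : K) / X 0)) + wt v * Real.log (pv v ((X (iv v) : K) / X 0)) := by
      intro v
      rw [Finset.sum_sub_distrib, sum_pp (iv v) fun q => Real.log (pv v ((X q : K) / X 0)), ← Finset.mul_sum]
      ring
    have e2 : ∑ v ∈ T, wt v * ∑ i, (Sum.elim (fun v' => Real.log (w v' (pp (iv v) i))) (fun _ => 0) v) ≤ - h - Real.log L + C := by
      refine le_trans (le_of_eq ?_) hws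
      rw [← Finset.sum_subset (s₁ := Finset.univ.map ⟨Sum.inl, Sum.inl_injective⟩) (fun v hv => ?_) (fun v hv hv' => ?_), Finset.sum_map]
      · refine Finset.sum_congr rfl fun v _ => ?_
        simp only [Function.Embedding.coeFn_mk, Sum.elim_inl]
        rw [sum_pp (iv (Sum.inl v)) fun q => Real.log (w v q), ← Finset.add_sum_erase _ _ (Finset.mem_univ (iv (Sum.inl v)))]
        ring
      · obtain ⟨v', _, rfl⟩ := Finset.mem_map.1 hv; exact hT v'
      · rcases v with v | v
        · exact absurd (Finset.mem_map.2 ⟨v, Finset.mem_univ _, rfl⟩) hv'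
        · simp
    have e3 := T_ph T hd0 iv
    have e4 : - ∑ v ∈ T, ∑ q, wt v * Real.log (pv v ((X q : K) / X 0)) ≤ ∑ q, oS T ((X q : K) / X 0) := by
      rw [Finset.sum_comm, ← Finset.sum_neg_distrib]
      exact Finset.sum_le_sum fun q _ => T_log T (hd0 q)
    have e5 : ∑ v ∈ T, wt v * ∑ i, ((Sum.elim (fun v' => Real.log (w v' (pp (iv v) i))) (fun _ => 0) v) - Real.log (pv v ((X (pp (iv v) i) : K) / X 0)))
       = ∑ v ∈ T, wt v * ∑ i, (Sum.elim (fun v' => Real.log (w v' (pp (iv v) i))) (fun _ => 0) v) - ∑ v ∈ T, ∑ q, wt v * Real.log (pv v ((X q : K) / X 0)) + ∑ v ∈ T, wt v * Real.log (pv v ((X (iv v) : K) / X 0)) := by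
      rw [← Finset.sum_sub_distrib, ← Finset.sum_add_distrib]
      refine Finset.sum_congr rfl fun v _ => ?_
      exact e1 v
    rw [e5]
    rw [hph] at e3
    linarith
  · intro b hb
    refine span_of_ann _ _ fun y hy => ?_
    have h1 := hsp (Fin.cons (- (∑ i, y i) / X 0) fun i => y i / X i.succ) (by
      rw [Fin.sum_univ_succ]
      simp only [Fin.cons_zero, Fin.cons_succ]
      rw [mul_div_cancel₀ _ (hx0 0), Finset.sum_congr rfl fun i _ => mul_div_cancel₀ _ (hx0 i.succ)]; simp) fun k => by
      rw [Fin.sum_univ_succ]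
      simp only [Fin.cons_zero, Fin.cons_succ]
      have h2 := hy k
      have h3 : ∀ i, y i * ((X 0 : K) * (a k i.succ - a k 0)) = X 0 * ((X i.succ : K) * a k i.succ * (y i / X i.succ)) - (X 0 * a k 0) * y i := by
        intro i
        have := hx0 i.succ
        field_simp
      rw [Finset.sum_congr rfl fun i _ => h3 i, Finset.sum_sub_distrib, ← Finset.mul_sum, ← Finset.mul_sum] at h2
      have h4 := hx0 0
      have h5 : (X 0 : K) * a k 0 * (-(∑ i, y i) / X 0) = - (a k 0 * ∑ i, y i) := by field_simp
      rw [h5]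
      apply mul_left_cancel₀ h4
      linear_combination h2
    obtain ⟨c, hc⟩ := Submodule.mem_span_singleton.1 h1
    have h6 : ∀ i, y i = c * X i.succ := by
      intro i
      have := congrFun hc i.succ
      simp only [Pi.smul_apply, Pi.one_apply, smul_eq_mul, mul_one, Fin.cons_succ] at this
      rw [this, div_mul_cancel₀ _ (hx0 _)]
    simp only [h6, mul_assoc]
    rw [← Finset.mul_sum, hb, mul_zero]
  · intro v k i
    rw [AA_app (iv v) i (X 0 : K) (a k), map_mul]
    have hne := pp_ne (iv v) i
    rcases v with v | v
    · refine (key _ _ _ _ (hai k v _ hne)).trans ?_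
      beta_reduce
      rw [Sum.elim_inl, sub_eq_add_neg, Real.exp_add, Real.exp_log (hwp _ _ hne), ← mul_assoc]
      gcongr
      · exact (hwp _ _ hne).le
      · exact le_max_left _ _
    · refine (key _ _ _ _ (haf k v _ _ (hiv _ _))).trans ?_
      beta_reduce
      rw [Sum.elim_inr, zero_sub]
      gcongr
      exact le_max_right _ _
  · intro v hv k i
    rcases v with v | v
    · exact absurd (hT v) hv
    have hcd : cdf (Sum.inr v : Pl K) = 1 := by by_contra hc; exact hv (hT' _ hc)
    rw [map_mul]
    have h1 : ∀ q, |Real.log (pv (Sum.inr v : Pl K) ((X q : K) / X 0))| ≤ ∑ q, |Real.log (pv (Sum.inr v : Pl K) ((X q : K) / X 0))| :=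
      fun q => Finset.single_le_sum (f := fun q => |Real.log (pv (Sum.inr v : Pl K) ((X q : K) / X 0))|) (fun _ _ => abs_nonneg _) (Finset.mem_univ q)
    rcases le_total (pv (Sum.inr v : Pl K) (X i.succ : K)) (pv (Sum.inr v : Pl K) (X 0 : K)) with hle | hle
    · refine (key _ _ _ _ (haf k v _ _ hle)).trans ?_
      rw [hcd, one_mul]
      exact Real.exp_le_exp.2 ((neg_le_abs _).trans (h1 _))
    · have h2 := haf k v _ _ hle
      rw [hcd, ← (pv _).map_neg, neg_sub, mul_comm] at h2
      exact h2.trans (Real.one_le_exp ((abs_nonneg _).trans (h1 0)))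
end
section
variable {K : Type} [Field K] [NumberField K]
lemma fsum_oS (T : Finset (Pl K)) {ι : Type} [Fintype ι] {y : ι → K} (hy : ∀ q, y q ≠ 0) : open Classical in (Function.support fun v => if v ∈ T then (0:ℝ) else ∑ q, |Real.log (pv v (y q))|).Finite ∧ ∑ᶠ v, wt v * (if v ∈ T then 0 else ∑ q, |Real.log (pv v (y q))|) = ∑ q, oS T (y q) := by
  classical
  constructor
  · refine (Set.finite_iUnion fun k => pv_finite (hy k)).subset fun v hv => ?_
    by_contra hc
    simp only [Set.mem_iUnion, Set.mem_setOf_eq, not_exists, not_not] at hc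
    exact hv (by simp [hc])
  · simp only [oS]
    rw [← finsum_sum_comm _ _ (fun i _ => oS_supp T (hy i))]
    refine finsum_congr fun v => ?_
    split_ifs <;> simp [Finset.mul_sum]
theorem caseI {J : Type} (U : Ultrafilter J) (m : ℕ) (hm : 1 ≤ m) (S : Finset (Pl K)) (hS : ∀ v, Sum.inl v ∈ S)
    (X : J → Fin (m + 2) → 𝓞 K) (hX : ∀ j i, X j i ≠ 0) (hs : ∀ j, ∑ i, X j i = 0) (iv : J → Pl K → Fin (m + 2))
    (hiv : ∀ j v i, pv v (X j i : K) ≤ pv v (X j (iv j v) : K)) (h : J → ℝ) (hh : ∀ j, h j = ph (cz (X j)) (iv j))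
    (hlim : Tendsto h U atTop) (hsm : ∀ i l, ∀ ε > 0, ∀ᶠ j in U.1, oS S ((X j i : K) / X j l) ≤ ε * h j)
    (δ : ℝ) (hδ : 0 < δ) (hδ1 : δ ≤ 1) (hL : ∀ᶠ j in U.1, ∀ z ∈ LL (X j), cz z ∉ Submodule.span K {1} → Real.exp (δ * h j) ≤ wn 1 (cz z)) : False := by
  classical
  have hx0 : ∀ j i, (X j i : K) ≠ 0 := fun j i => by simpa using hX j i
  set T : Finset (Pl K) := S ∪ (cdf_finite K).toFinset with hTdef
  have hST : S ⊆ T := Finset.subset_union_left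
  obtain ⟨C, hC, N0, hD⟩ := datum K m hm T (fun v => hST (hS v)) (fun v hv => Finset.mem_union_right _ (by simpa using hv))
  have big : ∀ B : ℝ, ∀ᶠ j in U.1, B ≤ h j := fun B => hlim.eventually_ge_atTop B
  have bigm : ∀ B e : ℝ, 0 < e → ∀ᶠ j in U.1, B ≤ e * h j := fun B e he => (big (B / e)).mono fun j hj => by
    rw [div_le_iff₀ he] at hj; linarith
  have hosT : ∀ ε > 0, ∀ᶠ j in U.1, ∑ q, oS T ((X j q : K) / X j 0) ≤ ε * h j := by
    intro ε hε
    have h1 : ∀ᶠ j in U.1, ∀ q, oS S ((X j q : K) / X j 0) ≤ (ε / (m + 2)) * h j := eventually_all.2 fun q => hsm q 0 _ (by positivity)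
    filter_upwards [h1] with j hj
    refine (Finset.sum_le_card_nsmul _ _ ((ε / (m + 2)) * h j) fun q _ => (oS_mono hST (div_ne_zero (hx0 _ _) (hx0 _ _))).trans (hj q)).trans (le_of_eq ?_)
    simp only [Finset.card_univ, Fintype.card_fin, nsmul_eq_mul]
    push_cast
    field_simp
  have hch : ∀ j, ∃ (F : Fin N0 → Fin (m + 1) → K) (g : Pl K → Fin (m + 2) → ℝ), (0 ≤ h j ∧ C ≤ Real.exp (δ * h j) ∧ (∀ z ∈ LL (X j), cz z ∉ Submodule.span K {1} → Real.exp (δ * h j) ≤ wn 1 (cz z))) →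
      (∀ v q, q ≠ iv j v → |g v q| ≤ 2 * h j) ∧
      ∑ v ∈ T, wt v * ∑ i, g v (pp (iv j v) i) ≤ - (δ * h j) + C + 2 * ∑ q, oS T ((X j q : K) / X j 0) ∧
      (∀ a : Fin (m + 1) → K, ∑ i, (X j i.succ : K) * a i = 0 → a ∈ Submodule.span K (Set.range F)) ∧
      (∀ v k i, pv v (∑ l, ((AA (iv j v) i l : ℤ) : K) * F k l) ≤ max C (cdf v) * Real.exp (g v (pp (iv j v) i))) ∧
      (∀ v ∉ T, ∀ k i, pv v (F k i) ≤ Real.exp (∑ q, |Real.log (pv v ((X j q : K) / X j 0))|)) := by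
    intro j
    by_cases hc : 0 ≤ h j ∧ C ≤ Real.exp (δ * h j) ∧ (∀ z ∈ LL (X j), cz z ∉ Submodule.span K {1} → Real.exp (δ * h j) ≤ wn 1 (cz z))
    · obtain ⟨F, g, hFg⟩ := hD (X j) (hX j) (hs j) (iv j) (hiv j) (h j) (Real.exp (δ * h j)) (hh j) hc.2.1 (Real.exp_le_exp.2 (by nlinarith [hc.1])) hc.2.2
      rw [Real.log_exp] at hFg
      exact ⟨F, g, fun _ => hFg⟩
    · exact ⟨0, 0, fun h => absurd h hc⟩
  choose F g hFg using hch
  have hFg' := ((big 0).and (((bigm (Real.log C) δ hδ).mono fun j hj => (Real.log_le_iff_le_exp (by linarith)).1 hj).and hL)).mono fun j hj => hFg j hj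
  choose kk hkk using fun v => uex U (P := fun j a => iv j v = a) (Eventually.of_forall fun j => ⟨_, rfl⟩)
  choose c hc using fun v i => ulim U (f := fun j => g j v (pp (kk v) i) / h j) (B := 2) (by
    filter_upwards [hFg', hkk v, big 1] with j h1 h2 h3
    rw [abs_div, abs_of_pos (by linarith : 0 < h j), div_le_iff₀ (by linarith)]
    exact h1.1 v _ (by rw [h2]; exact pp_ne _ _))
  have hkT : ∀ᶠ j in U.1, ∀ v ∈ T, iv j v = kk v := (eventually_all_finset T).2 fun v _ => hkk v
  have hneg : ∑ v ∈ T, wt v * ∑ i, c v i < 0 := by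
    have t1 : Tendsto (fun j => ∑ v ∈ T, wt v * ∑ i, g j v (pp (kk v) i) / h j) U (nhds (∑ v ∈ T, wt v * ∑ i, c v i)) :=
      tendsto_finset_sum _ fun v _ => (tendsto_finset_sum _ fun i _ => hc v i).const_mul _
    have t2 : ∑ v ∈ T, wt v * ∑ i, c v i ≤ - (δ / 4) := by
      refine le_of_tendsto t1 ?_
      filter_upwards [hFg', hkT, big 1, bigm C (δ / 4) (by positivity), hosT (δ / 4) (by positivity)] with j h1 h2 h3 h4 h5
      have h6 : ∑ v ∈ T, wt v * ∑ i, g j v (pp (kk v) i) / h j = (∑ v ∈ T, wt v * ∑ i, g j v (pp (iv j v) i)) / h j := by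
        rw [Finset.sum_div]
        refine Finset.sum_congr rfl fun v hv => ?_
        rw [h2 v hv, mul_div_assoc, Finset.sum_div]
      rw [h6, div_le_iff₀ (by linarith)]
      linarith [h1.2.1]
    linarith
  obtain ⟨D, hDD⟩ : ∃ D : ℝ, ∀ y : Fin (m + 1) → K, logHeight₁ (∑ i, y i) ≤ D + ∑ i, logHeight₁ (y i) := ⟨_, fun y => by
    have := logHeight₁_sum_le (s := Finset.univ) y
    simpa using this⟩
  have hp0 : ∀ᶠ j in U.1, ∃ p : Fin (m + 1), (1 / (4 * (m + 1))) * h j ≤ logHeight₁ ((X j p.succ : K) / X j (Fin.succ 0)) := by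
    filter_upwards [big (2 * D + 1)] with j hj
    by_contra hcon
    push Not at hcon
    have h1 := ph_le (x := cz (X j)) (hx0 j) (iv j) (Fin.succ 0)
    rw [← hh, Fin.sum_univ_succ] at h1
    have h2 : cz (X j) 0 / cz (X j) (Fin.succ 0) = - ∑ i : Fin (m + 1), (X j i.succ : K) / X j (Fin.succ 0) := by
      have h3 : ∑ i, (X j i : K) = 0 := by
        have := congrArg (fun y : 𝓞 K => (y : K)) (hs j); simpa using this
      rw [Fin.sum_univ_succ] at h3
      rw [← Finset.sum_div, ← neg_div]
      congr 1
      exact eq_neg_of_add_eq_zero_left h3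
    rw [h2, logHeight₁_neg] at h1
    have h4 := hDD fun i => (X j i.succ : K) / X j (Fin.succ 0)
    have h5 : ∑ i : Fin (m + 1), logHeight₁ ((X j i.succ : K) / X j (Fin.succ 0)) ≤ h j / 4 := by
      refine (Finset.sum_le_card_nsmul _ _ _ fun i _ => (hcon i).le).trans (le_of_eq ?_)
      simp only [Finset.card_univ, Fintype.card_fin, nsmul_eq_mul]
      push_cast
      field_simp
    change h j ≤ _ + ∑ i : Fin (m + 1), logHeight₁ ((X j i.succ : K) / X j (Fin.succ 0)) at h1
    linarith
  obtain ⟨p, hp⟩ := uex U hp0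
  have hp1 : p ≠ 0 := by
    rintro rfl
    obtain ⟨j, h1, h2⟩ := (hp.and (big 1)).exists
    rw [div_self (hx0 _ _), logHeight₁_one] at h1
    have : 0 < 1 / (4 * ((m:ℝ) + 1)) * h j := by positivity
    linarith
  obtain ⟨ε, hε, H0, hR⟩ := roth_machine (K := K) (n := m + 1) (by omega) AA AA_sq T (fun v => hST (hS v)) kk c hneg (1 / (4 * (m + 1))) (by positivity) 0 p hp1 N0
  have hbd : ∀ᶠ j in U.1, ∀ v ∈ T, ∀ i, max C (cdf v) * Real.exp (g j v (pp (kk v) i)) ≤ Real.exp (h j * (c v i + ε)) := by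
    refine (eventually_all_finset T).2 fun v _ => eventually_all.2 fun i => ?_
    filter_upwards [(hc v i).eventually_le_const (show c v i < c v i + ε / 2 by linarith), big 1, bigm (Real.log (max C (cdf v))) (ε / 2) (by positivity)] with j h1 h2 h3
    rw [div_le_iff₀ (by linarith)] at h1
    rw [← Real.exp_log (show 0 < max C (cdf v) from lt_max_of_lt_left (by linarith)), ← Real.exp_add, Real.exp_le_exp]
    nlinarith
  obtain ⟨j, h1, h2, h3, h4, h5, h6⟩ := (hFg'.and (hkT.and (hp.and (hbd.and ((hosT ε hε).and (big H0)))))).exists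
  refine absurd (hR (h j) (fun i => X j i.succ) (F j) (fun v => if v ∈ T then 0 else ∑ q, |Real.log (pv v ((X j q : K) / X j 0))|) (hx0 _ _) ?_ h1.2.2.1 ?_ (fsum_oS T fun q => div_ne_zero (hx0 _ _) (hx0 _ _)).1 ?_ ?_ ?_) (not_lt.2 h6)
  · rw [logHeight₁_neg]; exact h3
  · intro v hv k i
    have h7 := h1.2.2.2.1 v k i
    rw [h2 v hv] at h7
    exact h7.trans (h4 v hv i)
  · intro v; beta_reduce; split_ifs
    · exact le_rfl
    · exact Finset.sum_nonneg fun _ _ => abs_nonneg _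
  · intro v hv k i
    rw [if_neg hv]; exact h1.2.2.2.2 v hv k i
  · rw [(fsum_oS T fun q => div_ne_zero (hx0 _ _) (hx0 _ _)).2]; exact h5
end
section
variable {K : Type} [Field K] [NumberField K] {J : Type} {U : Ultrafilter J} {h : J → ℝ}
def Sm (U : Ultrafilter J) (h f : J → ℝ) : Prop := ∀ ε > 0, ∀ᶠ j in U.1, f j ≤ ε * h j
lemma Sm.mono {f g : J → ℝ} (hf : Sm U h f) (hg : ∀ᶠ j in U.1, g j ≤ f j) : Sm U h g := fun ε hε => by
  filter_upwards [hf ε hε, hg] with j h1 h2 using h2.trans h1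
lemma Sm.add {f g : J → ℝ} (hf : Sm U h f) (hg : Sm U h g) : Sm U h fun j => f j + g j := fun ε hε => by
  filter_upwards [hf (ε / 2) (by linarith), hg (ε / 2) (by linarith)] with j h1 h2
  linarith
lemma Sm.smul {f : J → ℝ} (hf : Sm U h f) {c : ℝ} (hc : 0 < c) : Sm U h fun j => c * f j := fun ε hε => by
  filter_upwards [hf (ε / c) (by positivity)] with j h1
  rw [div_mul_eq_mul_div, le_div_iff₀ hc] at h1
  linarith
lemma Sm.const (hl : Tendsto h U atTop) (c : ℝ) : Sm U h fun _ => c := fun ε hε => by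
  filter_upwards [hl.eventually_ge_atTop (c / ε)] with j hj
  rw [div_le_iff₀ hε] at hj; linarith
lemma Sm.sum {ι : Type} [Fintype ι] {f : ι → J → ℝ} (hl : Tendsto h U atTop) (hf : ∀ i, Sm U h (f i)) : Sm U h fun j => ∑ i, f i j := by
  classical
  have : ∀ s : Finset ι, Sm U h fun j => ∑ i ∈ s, f i j := by
    intro s
    induction s using Finset.induction_on with
    | empty => simpa using Sm.const hl 0
    | insert a s ha ih =>
      simp only [Finset.sum_insert ha]
      exact (hf a).add ih
  exact this _
lemma Sm.scale {f ht : J → ℝ} (hf : Sm U ht f) {e : ℝ} (he : 0 < e) (hh : ∀ᶠ j in U.1, e * ht j ≤ h j) : Sm U h f := fun ε hε => by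
  filter_upwards [hf (ε * e) (by positivity), hh] with j h1 h2
  nlinarith
abbrev SH (U : Ultrafilter J) (h : J → ℝ) (y : J → K) : Prop := Sm U h fun j => logHeight₁ (y j)
lemma SH.mul {y z : J → K} (hy : SH U h y) (hz : SH U h z) : SH U h fun j => y j * z j :=
  (hy.add hz).mono (Eventually.of_forall fun j => logHeight₁_mul_le _ _)
lemma SH.inv {y : J → K} (hy : SH U h y) : SH U h fun j => (y j)⁻¹ :=
  hy.mono (Eventually.of_forall fun j => (logHeight₁_inv _).le)
lemma SH.add1 (hl : Tendsto h U atTop) {y : J → K} (hy : SH U h y) : SH U h fun j => 1 + y j :=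
  (((Sm.const hl _).add (Sm.const hl _)).add hy).mono (Eventually.of_forall fun j => logHeight₁_add_le _ _)
lemma SH.congr {y z : J → K} (hy : SH U h y) (hz : ∀ᶠ j in U.1, z j = y j) : SH U h z :=
  Sm.mono hy (hz.mono fun j hj => by rw [hj])
lemma SH.one (hl : Tendsto h U atTop) : SH U h fun _ => (1 : K) := (Sm.const hl 0).mono (Eventually.of_forall fun j => by simp)
lemma SH.os {y : J → K} (hy : SH U h y) (S : Finset (Pl K)) (h0 : ∀ᶠ j in U.1, y j ≠ 0) : Sm U h fun j => oS S (y j) :=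
  (hy.smul two_pos).mono (h0.mono fun j hj => oS_le S hj)
lemma H_int (u : 𝓞 K) {B : ℝ} (hB : 1 ≤ B) (hu : ∀ v : InfinitePlace K, v (u : K) ≤ B) : logHeight₁ (u : K) ≤ Module.finrank ℚ K * Real.log B := by
  rw [NumberField.logHeight₁_eq, ← sum_wt_inf (K := K), Finset.sum_mul]
  have h1 : ∀ v : FinitePlace K, Real.posLog (v (u : K)) = 0 := fun v => by
    rw [Real.posLog_eq_zero_iff, abs_of_nonneg (apply_nonneg _ _)]
    exact pv_oint v u
  simp only [h1, finsum_zero, add_zero]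
  refine Finset.sum_le_sum fun v _ => ?_
  refine mul_le_mul_of_nonneg_left ?_ (wt_pos (Sum.inl v : Pl K)).le
  rw [Real.posLog_def]
  refine max_le (Real.log_nonneg hB) ?_
  rcases (apply_nonneg v (u : K)).eq_or_lt with h2 | h2
  · rw [← h2]; simp only [Real.log_zero]; exact Real.log_nonneg hB
  · exact Real.log_le_log h2 (hu v)
def PP (U : Ultrafilter J) (S : Finset (Pl K)) (n : ℕ) : Prop := ∀ (ι : Type) [Fintype ι], Fintype.card ι = n → ∀ (ht : J → ℝ) (x : J → ι → K), Tendsto ht U atTop →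
  (∀ᶠ j in U.1, ∀ i, x j i ≠ 0) → (∀ᶠ j in U.1, ∑ i, x j i = 0) →
  (∀ᶠ j in U.1, ∀ s : Finset ι, s.Nonempty → s ≠ Finset.univ → ∑ i ∈ s, x j i ≠ 0) →
  (∀ i, Sm U ht fun j => oS S (x j i)) → ∀ i l, SH U ht fun j => x j i / x j l
lemma merge (S : Finset (Pl K)) {n : ℕ} (hn : 2 ≤ n) (IH : PP U S n) {ι : Type} [Fintype ι] (hι : Fintype.card ι = n + 1) (x : J → ι → K) (hl : Tendsto h U atTop)
    (hx : ∀ᶠ j in U.1, ∀ i, x j i ≠ 0) (hs : ∀ᶠ j in U.1, ∑ i, x j i = 0)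
    (hns : ∀ᶠ j in U.1, ∀ s : Finset ι, s.Nonempty → s ≠ Finset.univ → ∑ i ∈ s, x j i ≠ 0)
    (ho : ∀ i, Sm U h fun j => oS S (x j i)) (a b : ι) (hab : a ≠ b) (hH : SH U h fun j => x j a / x j b) (q : ι) : SH U h fun j => x j q / x j b := by
  classical
  have hsum : ∀ j (s : Finset {i // i ≠ a}), ∑ q ∈ s, (x j q + if (q : ι) = b then x j a else 0) = ∑ i ∈ (s.map (Function.Embedding.subtype _)) ∪ (if ⟨b, hab.symm⟩ ∈ s then {a} else ∅), x j i := by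
    intro j s
    rw [Finset.sum_union, Finset.sum_add_distrib, Finset.sum_map]
    · congr 1
      have e1 : ∀ q : {i // i ≠ a}, ((q : ι) = b) ↔ q = ⟨b, hab.symm⟩ := fun q => by rw [Subtype.ext_iff]
      simp only [e1, Finset.sum_ite_eq']
      split_ifs <;> simp
    · split_ifs
      · simp
      · simp
  have hone : ∀ᶠ j in U.1, x j b + x j a ≠ 0 := by
    filter_upwards [hns] with j hj
    have := hj {b, a} (by simp) (fun hc => by
      have := congrArg Finset.card hc
      rw [Finset.card_pair hab.symm, Finset.card_univ] at this; omega)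
    rwa [Finset.sum_pair hab.symm] at this
  have hmem : ∀ (s : Finset {i // i ≠ a}), a ∈ (s.map (Function.Embedding.subtype _)) ∪ (if ⟨b, hab.symm⟩ ∈ s then {a} else ∅) ↔ ⟨b, hab.symm⟩ ∈ s := by
    intro s; split_ifs with hc <;> simp [hc]
  have hmem2 : ∀ (s : Finset {i // i ≠ a}) (i : {i // i ≠ a}), (i : ι) ∈ (s.map (Function.Embedding.subtype _)) ∪ (if ⟨b, hab.symm⟩ ∈ s then {a} else ∅) ↔ i ∈ s := by
    intro s i; have := i.2; split_ifs with hc <;> simp [this]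
  have key := IH {i // i ≠ a} (by rw [Fintype.card_subtype_compl]; simp [hι]) h (fun j q => x j q + if (q : ι) = b then x j a else 0) hl ?_ ?_ ?_ ?_
  · have h1 := SH.add1 hl hH
    by_cases hqb : q = b
    · rw [hqb]
      exact (SH.one hl).congr (hx.mono fun j hj => div_self (hj b))
    by_cases hqa : q = a
    · rw [hqa]; exact hH
    · have h2 := (key ⟨q, hqa⟩ ⟨b, hab.symm⟩).mul h1
      refine h2.congr ?_
      filter_upwards [hx, hone] with j h3 h4
      have := h3 b
      simp only [hqb, if_false, if_true, add_zero]
      field_simp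
  · filter_upwards [hx, hone] with j h1 h2 q
    split_ifs with hq
    · rw [hq]; exact h2
    · simpa using h1 q
  · filter_upwards [hs] with j hj
    rw [hsum, ← hj]
    congr 1
    ext i
    refine iff_of_true ?_ (Finset.mem_univ _)
    by_cases hi : i = a
    · rw [hi, hmem]; simp
    · exact (hmem2 _ ⟨i, hi⟩).2 (Finset.mem_univ _)
  · filter_upwards [hns] with j hj s hs1 hs2
    rw [hsum]
    refine hj _ ?_ fun hc => hs2 ?_
    · obtain ⟨i, hi⟩ := hs1
      exact ⟨i, (hmem2 s i).2 hi⟩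
    · ext i
      simp only [Finset.mem_univ, iff_true]
      rw [← hmem2, hc]; exact Finset.mem_univ _
  · rintro ⟨q, hq⟩
    by_cases hqb : q = b
    · simp only [hqb, if_true]
      have h1 := (ho b).add ((SH.add1 hl hH).os S (by
        filter_upwards [hx, hone] with j h3 h4
        have := h3 b
        rw [show 1 + x j a / x j b = (x j b + x j a) / x j b by field_simp]
        exact div_ne_zero h4 this))
      refine h1.mono ?_
      filter_upwards [hx, hone] with j h3 h4
      have h5 := h3 b
      have h6 : x j b + x j a = x j b * (1 + x j a / x j b) := by field_simp
      conv_lhs => rw [h6]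
      refine oS_mul S h5 fun h7 => h4 ?_
      rw [h6, h7, mul_zero]
    · simp only [hqb, if_false, add_zero]; exact ho q
end
section
variable {K : Type} [Field K] [NumberField K] {J : Type} {U : Ultrafilter J} {h : J → ℝ}
lemma caseII (S : Finset (Pl K)) {m : ℕ} (hm : 1 ≤ m) (IH : ∀ n < m + 2, PP U S n) (x : J → Fin (m + 2) → K) (hl : Tendsto h U atTop)
    (hx : ∀ᶠ j in U.1, ∀ i, x j i ≠ 0) (hs : ∀ᶠ j in U.1, ∑ i, x j i = 0)
    (hns : ∀ᶠ j in U.1, ∀ s : Finset (Fin (m + 2)), s.Nonempty → s ≠ Finset.univ → ∑ i ∈ s, x j i ≠ 0)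
    (ho : ∀ i, Sm U h fun j => oS S (x j i)) (u : J → Fin (m + 2) → K) (hu : ∀ i, SH U h fun j => u j i)
    (hu0 : ∀ᶠ j in U.1, u j 0 = 0 ∧ (∃ i, u j i ≠ 0) ∧ ∑ i, u j i * x j i = 0) : ∃ b, ∀ q, SH U h fun j => x j q / x j b := by
  classical
  have hB : ∀ᶠ j in U.1, ∃ B : Finset (Fin (m + 2)), (B.Nonempty ∧ (∀ i ∈ B, u j i ≠ 0) ∧ ∑ i ∈ B, u j i * x j i = 0) ∧
      ∀ B' : Finset (Fin (m + 2)), (B'.Nonempty ∧ (∀ i ∈ B', u j i ≠ 0) ∧ ∑ i ∈ B', u j i * x j i = 0) → B.card ≤ B'.card := by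
    filter_upwards [hu0] with j hj
    refine nat_min (fun B : Finset (Fin (m + 2)) => B.card) _ ⟨Finset.univ.filter fun i => u j i ≠ 0, ?_, fun i hi => (Finset.mem_filter.1 hi).2, ?_⟩
    · obtain ⟨i, hi⟩ := hj.2.1
      exact ⟨i, by simp [hi]⟩
    · rw [Finset.sum_filter]
      refine (Finset.sum_congr rfl fun i _ => ?_).trans hj.2.2
      split_ifs with h1
      · rfl
      · rw [not_not.1 h1, zero_mul]
  obtain ⟨B, hB⟩ := uex U hB
  have key := IH B.card ?_ {i // i ∈ B} (by simp) h (fun j i => u j i * x j i) hl ?_ ?_ ?_ ?_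
  · obtain ⟨a, ha, b, hb, hab⟩ : ∃ a ∈ B, ∃ b ∈ B, a ≠ b := by
      obtain ⟨j, ⟨h1, h2⟩, h3⟩ := (hB.and hx).exists
      obtain ⟨a, ha⟩ := h1.1
      refine ⟨a, ha, ?_⟩
      by_contra hc
      push Not at hc
      have : B = {a} := by
        ext i; rw [Finset.mem_singleton]; exact ⟨fun hi => (hc i hi).symm, fun hi => hi ▸ ha⟩
      have h4 := h1.2.2
      rw [this, Finset.sum_singleton] at h4
      exact mul_ne_zero (h1.2.1 a ha) (h3 a) h4
    refine ⟨b, merge S (n := m + 1) (by omega) (IH _ (by omega)) (by simp) x hl hx hs hns ho a b hab ?_⟩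
    refine (((key ⟨a, ha⟩ ⟨b, hb⟩).mul (hu a).inv).mul (hu b)).congr ?_
    filter_upwards [hB, hx] with j h1 h2
    have h3 := h1.1.2.1 a ha
    have h4 := h1.1.2.1 b hb
    have h5 := h2 b
    field_simp
  · obtain ⟨j, h1, h2⟩ := (hB.and hu0).exists
    have : B ⊂ Finset.univ := Finset.ssubset_univ_iff.2 fun hc => h1.1.2.1 0 (hc ▸ Finset.mem_univ _) h2.1
    simpa using Finset.card_lt_card this
  · filter_upwards [hB, hx] with j h1 h2 i
    exact mul_ne_zero (h1.1.2.1 i i.2) (h2 i)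
  · filter_upwards [hB] with j h1
    rw [← h1.1.2.2]
    exact Finset.sum_coe_sort B fun i => u j i * x j i
  · filter_upwards [hB] with j h1 s hs1 hs2 hc
    have h2 := h1.2 (s.map (Function.Embedding.subtype _)) ⟨hs1.map, fun i hi => ?_, ?_⟩
    · rw [Finset.card_map] at h2
      refine hs2 (Finset.eq_univ_of_card s (le_antisymm (Finset.card_le_univ s) ?_))
      simpa using h2
    · obtain ⟨i', _, rfl⟩ := Finset.mem_map.1 hi
      exact h1.1.2.1 i' i'.2
    · rw [Finset.sum_map]; exact hc
  · rintro ⟨i, hi⟩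
    refine (((hu i).os S (hB.mono fun j h1 => h1.1.2.1 i hi)).add (ho i)).mono ?_
    filter_upwards [hB, hx] with j h1 h2
    exact oS_mul S (h1.1.2.1 i hi) (h2 i)
lemma coreS (S : Finset (Pl K)) (hS : ∀ v, Sum.inl v ∈ S) {m : ℕ} (hm : 1 ≤ m) (IH : ∀ n < m + 2, PP U S n) (ht : J → ℝ) (x : J → Fin (m + 2) → K) (htl : Tendsto ht U atTop)
    (hx : ∀ j i, x j i ≠ 0) (hs : ∀ j, ∑ i, x j i = 0)
    (hns : ∀ᶠ j in U.1, ∀ s : Finset (Fin (m + 2)), s.Nonempty → s ≠ Finset.univ → ∑ i ∈ s, x j i ≠ 0)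
    (ho : ∀ i, Sm U ht fun j => oS S (x j i)) (i l) : SH U ht fun j => x j i / x j l := by
  classical
  by_contra hcon
  simp only [SH, Sm, not_forall] at hcon
  obtain ⟨e, he, hcon⟩ := hcon
  have hcon' := Ultrafilter.eventually_not.2 hcon
  choose iv hiv using fun j (v : Pl K) => Finite.exists_max fun i => pv v (x j i)
  obtain ⟨h, hh⟩ : ∃ h : J → ℝ, ∀ j, h j = ph (x j) (iv j) := ⟨_, fun j => rfl⟩
  have heh : ∀ᶠ j in U.1, e * ht j ≤ h j := hcon'.mono fun j hj => (not_le.1 hj).le.trans (by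
    rw [hh]; exact H_le_ph (hx j) (hiv j) i l)
  have hl : Tendsto h U atTop := tendsto_atTop_mono' _ heh (htl.const_mul_atTop he)
  have ho' : ∀ i, Sm U h fun j => oS S (x j i) := fun i => (ho i).scale he heh
  have fin : ∀ b, ¬ ∀ q, SH U h fun j => x j q / x j b := by
    intro b hb
    have h1 := (Sm.sum hl hb) (1 / 2) (by norm_num)
    obtain ⟨j, h2, h3⟩ := (h1.and (hl.eventually_ge_atTop 1)).exists
    have h4 := ph_le (hx j) (iv j) b
    rw [← hh] at h4
    linarith
  choose D hD X hXD using fun j => clear_den (x j)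
  have hD' : ∀ j, (D j : K) ≠ 0 := fun j => by simpa using hD j
  have hX0 : ∀ j i, (X j i : K) ≠ 0 := fun j i => by rw [hXD]; exact mul_ne_zero (hD' j) (hx j i)
  have hX : ∀ j i, X j i ≠ 0 := fun j i hc => hX0 j i (by rw [hc]; simp)
  have hXs : ∀ j, ∑ i, X j i = 0 := fun j => by
    rw [← RingOfIntegers.coe_eq_zero_iff]
    simp only [map_sum, hXD]
    rw [← Finset.mul_sum, hs, mul_zero]
  by_cases hI : ∃ δ > 0, δ ≤ 1 ∧ ∀ᶠ j in U.1, ∀ z ∈ LL (X j), cz z ∉ Submodule.span K {1} → Real.exp (δ * h j) ≤ wn 1 (cz z)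
  · obtain ⟨δ, hδ, hδ1, hI⟩ := hI
    refine caseI U m hm S hS X hX hXs iv (fun j v i => ?_) h (fun j => ?_) hl (fun i l => ?_) δ hδ hδ1 hI
    · rw [hXD, hXD, map_mul, map_mul]
      exact mul_le_mul_of_nonneg_left (hiv j v i) ((pv v).nonneg _)
    · rw [hh]; exact (ph_scale (hx j) (iv j) (hD' j) (hXD j)).symm
    · refine ((ho' i).add (ho' l)).mono (Eventually.of_forall fun j => ?_)
      rw [hXD, hXD, mul_div_mul_left _ _ (hD' j)]
      exact oS_div S (hx j i) (hx j l)
  · have hII : ∀ δ > 0, δ ≤ 1 → ∀ᶠ j in U.1, ∃ z, (z ∈ LL (X j) ∧ cz z ∉ Submodule.span K {1}) ∧ wn 1 (cz z) < Real.exp (δ * h j) := by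
      intro δ hδ hδ1
      have := Ultrafilter.eventually_not.2 fun hc => hI ⟨δ, hδ, hδ1, hc⟩
      filter_upwards [this] with j hj
      push Not at hj
      obtain ⟨z, h1, h2, h3⟩ := hj
      exact ⟨z, ⟨h1, h2⟩, h3⟩
    have hz : ∀ j, ∃ z, (∃ y, y ∈ LL (X j) ∧ cz y ∉ Submodule.span K {1}) → (z ∈ LL (X j) ∧ cz z ∉ Submodule.span K {1}) ∧
        ∀ y, (y ∈ LL (X j) ∧ cz y ∉ Submodule.span K {1}) → ⌊wn 1 (cz z)⌋₊ ≤ ⌊wn 1 (cz y)⌋₊ := by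
      intro j
      by_cases hc : ∃ y, y ∈ LL (X j) ∧ cz y ∉ Submodule.span K {1}
      · obtain ⟨z, hz⟩ := nat_min (fun y => ⌊wn 1 (cz y)⌋₊) _ hc
        exact ⟨z, fun _ => hz⟩
      · exact ⟨0, fun h => absurd h hc⟩
    choose z hz using hz
    have hz1 : ∀ᶠ j in U.1, z j ∈ LL (X j) ∧ cz (z j) ∉ Submodule.span K {1} := by
      filter_upwards [hII 1 one_pos le_rfl] with j hj
      obtain ⟨y, hy, _⟩ := hj
      exact (hz j ⟨y, hy⟩).1
    have hwn0 : ∀ (j : J) (y : Fin (m + 2) → 𝓞 K), 0 ≤ wn 1 (cz y) := fun j y => Finset.sum_nonneg fun v _ => Finset.sum_nonneg fun i _ => mul_nonneg zero_le_one (apply_nonneg _ _)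
    have hz2 : Sm U h fun j => Real.log (1 + wn 1 (cz (z j))) := by
      have h1 : Sm U h fun j => Real.log (1 + wn 1 (cz (z j))) - Real.log 3 := by
        intro ε hε
        filter_upwards [hII (min ε 1) (by positivity) (min_le_right _ _), hl.eventually_ge_atTop 0] with j hj hj0
        obtain ⟨y, hy, hyl⟩ := hj
        have h2 := (hz j ⟨y, hy⟩).2 y hy
        have h3 : wn 1 (cz (z j)) < wn 1 (cz y) + 1 := by
          have h4 := Nat.lt_floor_add_one (wn 1 (cz (z j)))
          have h5 := Nat.floor_le (hwn0 j y)
          have h6 : (⌊wn 1 (cz (z j))⌋₊ : ℝ) ≤ ⌊wn 1 (cz y)⌋₊ := by exact_mod_cast h2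
          linarith
        have h7 : Real.exp (min ε 1 * h j) ≤ Real.exp (ε * h j) := Real.exp_le_exp.2 (mul_le_mul_of_nonneg_right (min_le_left _ _) hj0)
        have h8 : 1 ≤ Real.exp (ε * h j) := Real.one_le_exp (by positivity)
        have h9 := Real.log_le_log (by linarith [hwn0 j (z j)]) (show 1 + wn 1 (cz (z j)) ≤ 3 * Real.exp (ε * h j) by linarith)
        rw [Real.log_mul (by norm_num) (Real.exp_pos _).ne', Real.log_exp] at h9
        linarith
      refine (h1.add (Sm.const hl (Real.log 3))).mono (Eventually.of_forall fun j => by simp)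
    have hsub : ∀ a b : 𝓞 K, ((a - b : 𝓞 K) : K) = (a : K) - b := fun a b => map_sub (algebraMap (𝓞 K) K) a b
    have hf : (0:ℝ) < Module.finrank ℚ K := by exact_mod_cast Module.finrank_pos
    have hbb := caseII S hm IH x hl (Eventually.of_forall hx) (Eventually.of_forall hs) hns ho' (fun j i => ((z j i - z j 0 : 𝓞 K) : K)) (fun i => ?_) ?_
    · obtain ⟨b, hb⟩ := hbb
      exact fin b hb
    · refine (((Sm.const hl (Real.log 2)).add hz2).smul hf).mono (Eventually.of_forall fun j => ?_)
      have h0 := hwn0 j (z j)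
      rw [← Real.log_mul (by norm_num) (by linarith)]
      refine H_int _ (by linarith) fun v => ?_
      have h1 := le_wn1 (cz (z j)) v i
      have h2 := le_wn1 (cz (z j)) v 0
      have h3 : v ((z j i - z j 0 : 𝓞 K) : K) ≤ v (z j i : K) + v (z j 0 : K) := by
        rw [hsub]; exact (pv (Sum.inl v : Pl K)).sub_le_add _ _
      simp only [cz] at h1 h2 h3 ⊢
      linarith
    · filter_upwards [hz1] with j hj
      refine ⟨by simp, ?_, ?_⟩
      · by_contra hc
        push Not at hc
        refine hj.2 (Submodule.mem_span_singleton.2 ⟨(z j 0 : K), ?_⟩)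
        ext i
        have := hc i
        rw [hsub, sub_eq_zero] at this
        simp [cz, this]
      · have h1 := congrArg (fun y : 𝓞 K => (y : K)) (mem_LL.1 hj.1)
        simp only [map_sum, map_mul, hXD, map_zero, mul_assoc] at h1
        rw [← Finset.mul_sum] at h1
        have h2 := (mul_eq_zero.1 h1).resolve_left (hD' j)
        have h3 : ∀ i, ((z j i - z j 0 : 𝓞 K) : K) * x j i = x j i * (z j i : K) - (z j 0 : K) * x j i := fun i => by rw [hsub]; ring
        simp only [h3]
        rw [Finset.sum_sub_distrib, h2, ← Finset.mul_sum, hs, mul_zero, sub_zero]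
theorem claim (U : Ultrafilter J) (S : Finset (Pl K)) (hS : ∀ v, Sum.inl v ∈ S) (n : ℕ) : PP U S n := by
  classical
  induction n using Nat.strong_induction_on with
  | _ n IH =>
  intro ι _ hι ht x htl hx hs hns ho i l
  by_cases hil : i = l
  · subst hil
    exact (SH.one htl).congr (hx.mono fun j hj => div_self (hj i))
  have hn : 2 ≤ n := by
    rw [← hι, ← Finset.card_pair hil]; exact Finset.card_le_univ _
  obtain ⟨m, rfl⟩ := Nat.exists_eq_add_of_le' hn
  rcases Nat.eq_zero_or_pos m with rfl | hm
  · have h2 : ({i, l} : Finset ι) = Finset.univ := Finset.eq_univ_of_card _ (by rw [Finset.card_pair hil, hι])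
    refine (Sm.const htl 0).mono ?_
    filter_upwards [hx, hs] with j h1 h3
    rw [← h2, Finset.sum_pair hil] at h3
    rw [eq_neg_of_add_eq_zero_left h3, neg_div, div_self (h1 l), logHeight₁_neg, logHeight₁_one]
  · have e := Fintype.equivFinOfCardEq hι
    obtain ⟨j0, h01, h02⟩ := (hx.and hs).exists
    have hgood : ∀ᶠ j in U.1, (if (∀ i, x j i ≠ 0) ∧ ∑ i, x j i = 0 then x j else x j0) = x j := by
      filter_upwards [hx, hs] with j h1 h2
      rw [if_pos ⟨h1, h2⟩]
    have hall : ∀ j, (∀ i, (if (∀ i, x j i ≠ 0) ∧ ∑ i, x j i = 0 then x j else x j0) i ≠ 0) ∧ ∑ i, (if (∀ i, x j i ≠ 0) ∧ ∑ i, x j i = 0 then x j else x j0) i = 0 := by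
      intro j
      by_cases hc : (∀ i, x j i ≠ 0) ∧ ∑ i, x j i = 0
      · rw [if_pos hc]; exact hc
      · rw [if_neg hc]; exact ⟨h01, h02⟩
    have key := coreS S hS hm IH ht (fun j q => (if (∀ i, x j i ≠ 0) ∧ ∑ i, x j i = 0 then x j else x j0) (e.symm q)) htl (fun j q => (hall j).1 _) (fun j => ?_) ?_ (fun q => ?_) (e i) (e l)
    · refine key.congr (hgood.mono fun j hj => ?_)
      rw [hj, e.symm_apply_apply, e.symm_apply_apply]
    · exact (e.symm.sum_comp (if (∀ i, x j i ≠ 0) ∧ ∑ i, x j i = 0 then x j else x j0)).trans (hall j).2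
    · filter_upwards [hgood, hns] with j hj h1 s hs1 hs2
      rw [hj]
      have := h1 (s.map e.symm.toEmbedding) hs1.map (fun hc => hs2 (Finset.eq_univ_of_card _ (by
        have := congrArg Finset.card hc
        rw [Finset.card_map, Finset.card_univ, hι] at this
        rw [this, Fintype.card_fin])))
      rwa [Finset.sum_map] at this
    · refine (ho (e.symm q)).mono (hgood.mono fun j hj => ?_)
      rw [hj]
end
section
variable {K : Type} [Field K] [NumberField K] {J : Type} (U : Ultrafilter J)
lemma unit_thm (S : Finset (Pl K)) (hS : ∀ v, Sum.inl v ∈ S) {ι : Type} [Fintype ι] (x : J → ι → K) (hx : ∀ j i, x j i ≠ 0) (ho : ∀ j i, oS S (x j i) = 0)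
    (hs : ∀ᶠ j in U.1, ∑ i, x j i = 0)
    (hns : ∀ᶠ j in U.1, ∀ s : Finset ι, s.Nonempty → s ≠ Finset.univ → ∑ i ∈ s, x j i ≠ 0) (i l : ι) :
    ∃ a, ∀ᶠ j in U.1, x j i / x j l = a := by
  by_cases hb : ∃ B : ℝ, ∀ᶠ j in U.1, logHeight₁ (x j i / x j l) ≤ B
  · obtain ⟨B, hB⟩ := hb
    have hfin : Finite {y : K | logHeight₁ y ≤ B} := finite_setOfPred_logHeight₁_le K B
    obtain ⟨a, ha⟩ := uex U (α := {y : K | logHeight₁ y ≤ B}) (P := fun j a => x j i / x j l = a) (hB.mono fun j hj => ⟨⟨_, hj⟩, rfl⟩)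
    exact ⟨a, ha⟩
  · exfalso
    have h1 : Tendsto (fun j => logHeight₁ (x j i / x j l)) U atTop := by
      rw [tendsto_atTop]
      intro B
      have := Ultrafilter.eventually_not.2 fun hc => hb ⟨B, hc⟩
      exact this.mono fun j hj => (not_le.1 hj).le
    have h2 := claim U S hS _ ι rfl _ x h1 (Eventually.of_forall hx) hs hns (fun i => (Sm.const h1 0).mono (Eventually.of_forall fun j => (ho j i).le)) i l (1 / 2) (by norm_num)
    obtain ⟨j, h3, h4⟩ := (h2.and (h1.eventually_ge_atTop 1)).exists
    linarith
lemma split (S : Finset (Pl K)) (hS : ∀ v, Sum.inl v ∈ S) {ι : Type} [Fintype ι] (x : J → ι → K) (hx : ∀ j i, x j i ≠ 0) (ho : ∀ j i, oS S (x j i) = 0)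
    (A : ι → Prop) [DecidablePred A] (hA : ∀ i l, A i → ¬ A l → ¬ ∃ a, ∀ᶠ j in U.1, x j i / x j l = a) (s : Finset ι) (hs : ∀ᶠ j in U.1, ∑ i ∈ s, x j i = 0) :
    ∀ᶠ j in U.1, ∑ i ∈ s with A i, x j i = 0 := by
  classical
  induction s using Finset.strongInduction with
  | H s IH =>
  rcases s.eq_empty_or_nonempty with rfl | hne
  · simp
  have hB : ∀ᶠ j in U.1, ∃ B : Finset ι, (B.Nonempty ∧ B ⊆ s ∧ ∑ i ∈ B, x j i = 0) ∧
      ∀ B' : Finset ι, (B'.Nonempty ∧ B' ⊆ s ∧ ∑ i ∈ B', x j i = 0) → B.card ≤ B'.card := by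
    filter_upwards [hs] with j hj
    exact nat_min (fun B : Finset ι => B.card) _ ⟨s, hne, subset_rfl, hj⟩
  obtain ⟨B, hB⟩ := uex U hB
  obtain ⟨j0, hj0⟩ := hB.exists
  have hBs := hj0.1.2.1
  have hBn := hj0.1.1
  have h0 : ∀ᶠ j in U.1, ∑ i ∈ B, x j i = 0 := hB.mono fun j hj => hj.1.2.2
  have h1 : ∀ᶠ j in U.1, ∑ i ∈ s \ B with A i, x j i = 0 := by
    refine IH _ (Finset.sdiff_ssubset hBs hBn) ?_
    filter_upwards [h0, hs] with j h1 h2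
    rw [← Finset.sum_sdiff hBs, h1, add_zero] at h2
    exact h2
  have hu := unit_thm U S hS (fun j (i : {i // i ∈ B}) => x j i) (fun j i => hx j i) (fun j i => ho j i) (h0.mono fun j hj => by
    rw [← hj]; exact Finset.sum_coe_sort B fun i => x j i) (by
    filter_upwards [hB] with j h1 t ht1 ht2 hc
    have h2 := h1.2 (t.map (Function.Embedding.subtype _)) ⟨ht1.map, fun i hi => ?_, ?_⟩
    · rw [Finset.card_map] at h2
      refine ht2 (Finset.eq_univ_of_card t (le_antisymm (Finset.card_le_univ t) ?_))
      simpa using h2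
    · obtain ⟨i', _, rfl⟩ := Finset.mem_map.1 hi
      exact hBs i'.2
    · rw [Finset.sum_map]; exact hc)
  have h2 : ∀ᶠ j in U.1, ∑ i ∈ B with A i, x j i = 0 := by
    by_cases hc : ∃ a ∈ B, A a
    · obtain ⟨a, ha, hAa⟩ := hc
      have : B.filter A = B := Finset.filter_true_of_mem fun i hi => by
        by_contra hAi
        exact hA a i hAa hAi (hu ⟨a, ha⟩ ⟨i, hi⟩)
      rwa [this]
    · push Not at hc
      rw [Finset.filter_false_of_mem hc]; simp
  filter_upwards [h1, h2] with j h3 h4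
  have h5 : s.filter A = (s \ B).filter A ∪ B.filter A := by
    rw [← Finset.filter_union, Finset.sdiff_union_of_subset hBs]
  rw [h5, Finset.sum_union (Finset.disjoint_filter_filter Finset.sdiff_disjoint), h3, h4, add_zero]
abbrev Qb := AlgebraicClosure ℚ
lemma algQ (x : Qb) : IsIntegral ℚ x := by
  have h := (AlgebraicClosure.isAlgebraic ℚ).isAlgebraic x
  have e : (DivisionRing.toRatAlgebra : Algebra ℚ Qb) = AlgebraicClosure.instAlgebra ℚ := Subsingleton.elim _ _
  rw [← e] at h
  exact h.isIntegral
lemma exK (F : Set Qbˣ) (hF : F.Finite) : ∃ K : IntermediateField ℚ Qb, ∃ _ : NumberField K, ∃ S : Finset (Pl K), (∀ v, Sum.inl v ∈ S) ∧ ∀ u ∈ Subgroup.closure F, ∃ y : K, (y : Qb) = u ∧ y ≠ 0 ∧ oS S y = 0 := by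
  classical
  set K := IntermediateField.adjoin ℚ ((fun u : Qbˣ => (u : Qb)) '' F) with hK
  have : Finite ((fun u : Qbˣ => (u : Qb)) '' F) := hF.image _
  have hfd : FiniteDimensional ℚ K := IntermediateField.finiteDimensional_adjoin fun x _ => algQ x
  have hnf : NumberField K := { to_charZero := inferInstance, to_finiteDimensional := hfd }
  have hmem : ∀ u ∈ F, (u : Qb) ∈ K := fun u hu => IntermediateField.subset_adjoin ℚ _ ⟨u, hu, rfl⟩
  have hfin : ({v : Pl K | ∃ v', v = Sum.inl v'} ∪ ⋃ u ∈ F, {v : Pl K | ∃ y : K, (y : Qb) = u ∧ pv v y ≠ 1}).Finite := by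
    refine Set.Finite.union ?_ (hF.biUnion fun u hu => ?_)
    · refine (Set.finite_range (Sum.inl : InfinitePlace K → Pl K)).subset ?_
      rintro _ ⟨v, rfl⟩; exact ⟨v, rfl⟩
    · refine (pv_finite (x := (⟨u, hmem u hu⟩ : K)) fun hc => u.ne_zero (congrArg Subtype.val hc)).subset ?_
      rintro v ⟨y, hy, hv⟩
      have : y = ⟨u, hmem u hu⟩ := Subtype.ext hy
      rwa [this] at hv
  refine ⟨K, hnf, hfin.toFinset, fun v => by simp, fun u hu => ?_⟩
  suffices h : ∃ y : K, (y : Qb) = u ∧ ∀ v ∉ hfin.toFinset, pv v y = 1 by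
    obtain ⟨y, hy, hv⟩ := h
    refine ⟨y, hy, fun hc => u.ne_zero (by rw [← hy, hc]; rfl), ?_⟩
    rw [oS, ← finsum_zero]
    refine finsum_congr fun v => ?_
    split_ifs with h1
    · simp
    · rw [hv v h1]; simp
  induction hu using Subgroup.closure_induction with
  | mem u hu =>
    refine ⟨⟨u, hmem u hu⟩, rfl, fun v hv => ?_⟩
    by_contra hc
    exact hv (hfin.mem_toFinset.2 (Or.inr (Set.mem_biUnion hu ⟨⟨u, hmem u hu⟩, rfl, hc⟩)))
  | one => exact ⟨1, rfl, fun v _ => map_one _⟩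
  | mul u w _ _ h1 h2 =>
    obtain ⟨y, hy, hv⟩ := h1
    obtain ⟨z, hz, hw⟩ := h2
    exact ⟨y * z, by simp [hy, hz], fun v h => by rw [map_mul, hv v h, hw v h, one_mul]⟩
  | inv u _ h1 =>
    obtain ⟨y, hy, hv⟩ := h1
    exact ⟨y⁻¹, by simp [hy], fun v h => by rw [map_inv₀, hv v h, inv_one]⟩
theorem splitQ (F : Set Qbˣ) (hF : F.Finite) {ι : Type} [Fintype ι] (x : J → ι → Qbˣ) (hx : ∀ j i, x j i ∈ Subgroup.closure F)
    (A : ι → Prop) [DecidablePred A] (hA : ∀ i l, A i → ¬ A l → ¬ ∃ a, ∀ᶠ j in U.1, x j i / x j l = a) (hs : ∀ᶠ j in U.1, ∑ i, (x j i : Qb) = 0) :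
    ∀ᶠ j in U.1, ∑ i with A i, (x j i : Qb) = 0 := by
  obtain ⟨K, _, S, hS, hK⟩ := exK F hF
  choose y hy hy0 hyS using fun j i => hK (x j i) (hx j i)
  have key := split U S hS y hy0 hyS A (fun i l h1 h2 h3 => hA i l h1 h2 ?_) Finset.univ (hs.mono fun j hj => ?_)
  · refine key.mono fun j hj => ?_
    have := congrArg (fun z : K => (z : Qb)) hj
    simpa [hy] using this
  · obtain ⟨a, ha⟩ := h3
    obtain ⟨j0, hj0⟩ := ha.exists
    refine ⟨x j0 i / x j0 l, ha.mono fun j hj => ?_⟩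
    have := congrArg (fun z : K => (z : Qb)) (hj.trans hj0.symm)
    refine Units.ext ?_
    simpa [hy] using this
  · refine Subtype.ext ?_
    simpa [hy] using hj
end
section
variable {J : Type} (U : Ultrafilter J) (Γ : Subgroup Qbˣ)
def Rep (f : J → Qb) : Prop := ∃ (ι : Type) (_ : Fintype ι) (c : ι → Qbˣ) (g : J → ι → Qbˣ), (∀ j i, g j i ∈ Γ) ∧ ∀ᶠ j in U.1, f j = ∑ i, (c i : Qb) * (g j i : Qb)
variable {U Γ}
lemma Rep.congr {f f' : J → Qb} (h : Rep U Γ f) (e : ∀ᶠ j in U.1, f' j = f j) : Rep U Γ f' := by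
  obtain ⟨ι, i, c, g, hg, h⟩ := h
  exact ⟨ι, i, c, g, hg, by filter_upwards [h, e] with j h1 h2; rw [h2, h1]⟩
lemma Rep.unit (g : J → Qbˣ) (hg : ∀ j, g j ∈ Γ) : Rep U Γ fun j => g j :=
  ⟨Unit, inferInstance, fun _ => 1, fun j _ => g j, fun j _ => hg j, by simp⟩
lemma Rep.const (a : Qb) : Rep U Γ fun _ => a := by
  by_cases h : a = 0
  · exact ⟨Empty, inferInstance, fun _ => 1, fun _ _ => 1, fun _ _ => one_mem _, by simp [h]⟩
  · exact ⟨Unit, inferInstance, fun _ => Units.mk0 a h, fun j _ => 1, fun j _ => one_mem _, by simp⟩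
lemma Rep.add {f f' : J → Qb} (h : Rep U Γ f) (h' : Rep U Γ f') : Rep U Γ fun j => f j + f' j := by
  obtain ⟨ι, i, c, g, hg, h⟩ := h
  obtain ⟨ι', i', c', g', hg', h'⟩ := h'
  refine ⟨ι ⊕ ι', inferInstance, Sum.elim c c', fun j => Sum.elim (g j) (g' j), fun j => ?_, ?_⟩
  · rintro (a | a)
    · exact hg j a
    · exact hg' j a
  · filter_upwards [h, h'] with j h1 h2
    rw [h1, h2, Fintype.sum_sum_type]; rfl
lemma Rep.mul {f f' : J → Qb} (h : Rep U Γ f) (h' : Rep U Γ f') : Rep U Γ fun j => f j * f' j := by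
  obtain ⟨ι, i, c, g, hg, h⟩ := h
  obtain ⟨ι', i', c', g', hg', h'⟩ := h'
  refine ⟨ι × ι', inferInstance, fun a => c a.1 * c' a.2, fun j a => g j a.1 * g' j a.2, fun j a => mul_mem (hg j _) (hg' j _), ?_⟩
  filter_upwards [h, h'] with j h1 h2
  rw [h1, h2, Finset.sum_mul_sum, Fintype.sum_prod_type]
  refine Finset.sum_congr rfl fun a _ => Finset.sum_congr rfl fun b _ => ?_
  push_cast; ring
lemma Rep.sum {α : Type} (s : Finset α) {f : α → J → Qb} (h : ∀ a ∈ s, Rep U Γ (f a)) : Rep U Γ fun j => ∑ a ∈ s, f a j := by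
  classical
  induction s using Finset.induction_on with
  | empty => simpa using Rep.const 0
  | insert a s ha ih =>
    simp only [Finset.sum_insert ha]
    exact (h a (Finset.mem_insert_self _ _)).add (ih fun b hb => h b (Finset.mem_insert_of_mem hb))
def MRep (U : Ultrafilter J) (Γ : Subgroup Qbˣ) {n : ℕ} (X : J → Matrix (Fin n) (Fin n) Qb) : Prop := ∀ a b, Rep U Γ fun j => X j a b
lemma MRep.mul {n : ℕ} {X Y : J → Matrix (Fin n) (Fin n) Qb} (h : MRep U Γ X) (h' : MRep U Γ Y) : MRep U Γ fun j => X j * Y j :=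
  fun a b => by
    simp only [Matrix.mul_apply]
    exact Rep.sum _ fun c _ => (h a c).mul (h' c b)
lemma MRep.const {n : ℕ} (X : Matrix (Fin n) (Fin n) Qb) : MRep U Γ fun _ => X := fun a b => Rep.const _
lemma MRep.add {n : ℕ} {X Y : J → Matrix (Fin n) (Fin n) Qb} (h : MRep U Γ X) (h' : MRep U Γ Y) : MRep U Γ fun j => X j + Y j :=
  fun a b => (h a b).add (h' a b)
lemma MRep.diag {n : ℕ} {d : J → Fin n → Qb} (h : ∀ a, Rep U Γ fun j => d j a) : MRep U Γ fun j => Matrix.diagonal (d j) := fun a b => by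
  by_cases hab : a = b
  · subst hab; simpa using h a
  · simpa [hab] using Rep.const 0
lemma Rep.good (u : Qbˣ) (q : ℤ) (hq : q ≠ 0) (hu : u ^ q ∈ Γ) (m : J → ℤ) : Rep U Γ fun j => ((u ^ m j : Qbˣ) : Qb) := by
  obtain ⟨a, ha⟩ := uex U (α := Set.Ico 0 |q|) (P := fun j a => m j % q = a) (Eventually.of_forall fun j =>
    ⟨⟨m j % q, Int.emod_nonneg _ hq, Int.emod_lt_abs _ hq⟩, rfl⟩)
  refine ((Rep.const ((u ^ (a : ℤ) : Qbˣ) : Qb)).mul (Rep.unit (fun j => (u ^ q) ^ (m j / q)) fun j => Subgroup.zpow_mem _ hu _)).congr ?_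
  filter_upwards [ha] with j hj
  rw [← Units.val_mul, ← hj, ← _root_.zpow_mul, ← _root_.zpow_add, Int.emod_add_mul_ediv]
lemma graded (hU : ∀ P : J → Prop, (∀ᶠ j in U.1, P j) → ∃ a b, a ≠ b ∧ P a ∧ P b) {m : J → ℤ} (hm : Function.Injective m)
    {F0 : Set Qbˣ} (hF0 : F0.Finite) (hΓ : Γ ≤ Subgroup.closure F0) {β : Type} [Fintype β] (d : β → Qbˣ) (hd : ∀ l (q : ℤ), q ≠ 0 → d l ^ q ∉ Γ)
    {f : J → Qb} (hf : Rep U Γ f) {g : β → J → Qb} (hg : ∀ l, Rep U Γ (g l)) (h : ∀ᶠ j in U.1, f j + ∑ l, ((d l ^ m j : Qbˣ) : Qb) * g l j = 0) :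
    ∀ᶠ j in U.1, f j = 0 := by
  classical
  obtain ⟨ι, _, c, x, hx, hf⟩ := hf
  choose κ iκ e y hy hg using hg
  set F : Set Qbˣ := F0 ∪ Set.range c ∪ Set.range d ∪ Set.range (fun p : Σ l, κ l => e p.1 p.2) with hF
  have hFf : F.Finite := ((hF0.union (Set.finite_range _)).union (Set.finite_range _)).union (Set.finite_range _)
  have m0 : ∀ u ∈ F, u ∈ Subgroup.closure F := fun u hu => Subgroup.subset_closure hu
  have hΓF : ∀ u ∈ Γ, u ∈ Subgroup.closure F := fun u hu => Subgroup.closure_mono (fun z hz => Or.inl (Or.inl (Or.inl hz))) (hΓ hu)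
  have hc : ∀ i, c i ∈ Subgroup.closure F := fun i => m0 _ (Or.inl (Or.inl (Or.inr ⟨i, rfl⟩)))
  have hdF : ∀ i, d i ∈ Subgroup.closure F := fun i => m0 _ (Or.inl (Or.inr ⟨i, rfl⟩))
  have he : ∀ l i, e l i ∈ Subgroup.closure F := fun l i => m0 _ (Or.inr ⟨⟨l, i⟩, rfl⟩)
  have key := splitQ U F hFf (ι := ι ⊕ Σ l, κ l) (fun j => Sum.elim (fun i => c i * x j i) fun p => d p.1 ^ m j * (e p.1 p.2 * y p.1 j p.2))
    (by
      rintro j (i | p)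
      · exact mul_mem (hc i) (hΓF _ (hx j i))
      · exact mul_mem (Subgroup.zpow_mem _ (hdF _) _) (mul_mem (he _ _) (hΓF _ (hy _ j _))))
    (fun i => i.isLeft = true)
    (by
      rintro (i | i) (l | p) h1 h2 ⟨a, ha⟩
      · simp at h2
      · obtain ⟨j, j', hne, h3, h4⟩ := hU _ ha
        simp only [Sum.elim_inl, Sum.elim_inr] at h3 h4
        refine hd p.1 (m j - m j') (sub_ne_zero.2 fun hc => hne (hm hc)) ?_
        have h5 : d p.1 ^ (m j - m j') = (x j i / x j' i) * (y p.1 j' p.2 / y p.1 j p.2) := by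
          rw [← h4, div_eq_div_iff_mul_eq_mul] at h3
          rw [_root_.zpow_sub, ← div_eq_mul_inv, div_mul_div_comm, div_eq_div_iff_mul_eq_mul]
          refine mul_left_cancel (a := c i * e p.1 p.2) ?_
          calc _ = (c i * x j' i) * (d p.1 ^ m j * (e p.1 p.2 * y p.1 j p.2)) := by ac_rfl
            _ = _ := by rw [← h3]; ac_rfl
        rw [h5]
        exact mul_mem (div_mem (hx _ _) (hx _ _)) (div_mem (hy _ _ _) (hy _ _ _))
      · simp at h1
      · simp at h1)
    (by
      filter_upwards [h, hf, eventually_all.2 hg] with j h1 h2 h3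
      rw [h2] at h1
      rw [Fintype.sum_sum_type, Fintype.sum_sigma, ← h1]
      congr 1
      refine Finset.sum_congr rfl fun l _ => ?_
      rw [h3 l, Finset.mul_sum]
      simp)
  filter_upwards [key, hf] with j h1 h2
  rw [h2, ← h1, Finset.sum_filter, Fintype.sum_sum_type]
  simp
end
section
variable {n : ℕ}
abbrev Mx (n : ℕ) := Matrix (Fin n) (Fin n) Qb
abbrev GN (n : ℕ) := GL (Fin n) Qb
lemma root_iff (A : Mx n) (u : Qb) : A.charpoly.IsRoot u ↔ ∃ v ≠ 0, A *ᵥ v = u • v := by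
  rw [Polynomial.IsRoot.def, Matrix.eval_charpoly, ← Matrix.exists_mulVec_eq_zero_iff]
  refine exists_congr fun v => and_congr_right fun _ => ?_
  rw [Matrix.sub_mulVec, sub_eq_zero, eq_comm]
  simp [Matrix.scalar_apply, ← Matrix.smul_one_eq_diagonal, Matrix.smul_mulVec]
lemma diagz (A : Mx n) (hA : Module.End.IsSemisimple A.mulVecLin) :
    ∃ (P : GN n) (d : Fin n → Qb), A * P.val = P * diagonal d := by
  classical
  set f := A.mulVecLin with hf
  have htop : ⊤ ≤ Submodule.span Qb {v | ∃ μ : Qb, f v = μ • v} := by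
    rw [← Module.End.iSup_maxGenEigenspace_eq_top f]
    refine iSup_le fun μ v hv => Submodule.subset_span ⟨μ, ?_⟩
    rw [hA.isFinitelySemisimple.maxGenEigenspace_eq_eigenspace] at hv
    exact Module.End.mem_eigenspace_iff.1 hv
  let b0 := Module.Basis.ofSpan htop
  have : Finite ((linearIndepOn_empty Qb id).extend (Set.empty_subset {v | ∃ μ : Qb, f v = μ • v})) := Module.Finite.finite_basis b0
  have := Fintype.ofFinite ((linearIndepOn_empty Qb id).extend (Set.empty_subset {v | ∃ μ : Qb, f v = μ • v}))
  have hc := Module.finrank_eq_card_basis b0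
  rw [Module.finrank_fin_fun] at hc
  let b := b0.reindex (Fintype.equivFinOfCardEq hc.symm)
  have hb : ∀ i, ∃ μ, f (b i) = μ • b i := fun i => by
    have := Module.Basis.ofSpan_subset htop ⟨(Fintype.equivFinOfCardEq hc.symm).symm i, rfl⟩
    simpa [b, b0] using this
  choose d hd using hb
  let P : GN n := ⟨(Pi.basisFun Qb (Fin n)).toMatrix b, b.toMatrix (Pi.basisFun Qb (Fin n)), Module.Basis.toMatrix_mul_toMatrix_flip _ _, Module.Basis.toMatrix_mul_toMatrix_flip _ _⟩
  refine ⟨P, d, ?_⟩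
  ext a i
  rw [Matrix.mul_diagonal]
  have := congrFun (hd i) a
  simpa [f, P, Matrix.mul_apply, Matrix.mulVec, dotProduct, Module.Basis.toMatrix_apply, mul_comm] using this
noncomputable def Dg : (Fin n → Qbˣ) →* GN n :=
  (Units.map (diagonalRingHom (Fin n) Qb).toMonoidHom).comp (MulEquiv.piUnits.symm.toMonoidHom)
lemma diagG (g : GN n) (hg : Module.End.IsSemisimple g.val.mulVecLin) :
    ∃ (P : GN n) (d : Fin n → Qbˣ), (∀ k : ℤ, g ^ k = P * Dg (d ^ k) * P⁻¹) ∧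
      ∀ u : Qbˣ, g.val.charpoly.IsRoot (u : Qb) ↔ ∃ l, d l = u := by
  obtain ⟨P, d, h⟩ := diagz _ hg
  have hd : ∀ l, d l ≠ 0 := by
    intro l hl
    have h1 := congrArg Matrix.det h
    rw [Matrix.det_mul, Matrix.det_mul, Matrix.det_diagonal, Finset.prod_eq_zero (Finset.mem_univ l) hl, mul_zero] at h1
    have h2 := ((g * P).isUnit.map Matrix.detMonoidHom).ne_zero
    rw [Matrix.coe_detMonoidHom, Units.val_mul, Matrix.det_mul] at h2
    exact h2 h1
  have h1 : g = P * Dg (fun l => Units.mk0 (d l) (hd l)) * P⁻¹ := by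
    rw [eq_mul_inv_iff_mul_eq]
    exact Units.ext h
  refine ⟨P, fun l => Units.mk0 (d l) (hd l), fun k => by rw [h1, conj_zpow, map_zpow], fun u => ?_⟩
  rw [root_iff]
  have hv : ∀ w : Fin n → Qb, g.val *ᵥ (P.val *ᵥ w) = P.val *ᵥ (diagonal d *ᵥ w) := fun w => by
    rw [Matrix.mulVec_mulVec, h, Matrix.mulVec_mulVec]
  have hP : Function.Injective P.val.mulVec := Matrix.mulVec_injective_of_isUnit P.isUnit
  constructor
  · rintro ⟨v, hv0, h2⟩
    obtain ⟨w, rfl⟩ : ∃ w, P.val *ᵥ w = v := ⟨P⁻¹.val *ᵥ v, by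
      rw [Matrix.mulVec_mulVec, ← Units.val_mul]; simp⟩
    rw [hv, ← Matrix.mulVec_smul] at h2
    have h3 := hP h2
    have hw : w ≠ 0 := by rintro rfl; simp at hv0
    obtain ⟨l, hl⟩ := Function.ne_iff.1 hw
    refine ⟨l, Units.ext ?_⟩
    have := congrFun h3 l
    rw [Matrix.mulVec_diagonal] at this
    exact mul_right_cancel₀ hl this
  · rintro ⟨l, rfl⟩
    refine ⟨P.val *ᵥ Pi.single l 1, ?_, ?_⟩
    · intro hc
      have := hP (hc.trans (Matrix.mulVec_zero _).symm)
      simpa using congrFun this l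
    · rw [hv, ← Matrix.mulVec_smul]
      congr 1
      ext a
      rw [Matrix.mulVec_diagonal]
      by_cases ha : a = l
      · subst ha; simp
      · simp [ha]
lemma jc (g : GN n) : ∃ (ν : Mx n) (s : GN n), IsNilpotent ν ∧ Commute ν s ∧ g.val = s + ν ∧
    Module.End.IsSemisimple s.val.mulVecLin ∧ ∀ u : Qb, s.val.charpoly.IsRoot u → g.val.charpoly.IsRoot u := by
  obtain ⟨ν', hν, s', hs, hnil, hss, hsum⟩ := Module.End.exists_isNilpotent_isSemisimple (f := g.val.toLin')
  have hc0 : Commute ν' s' := Algebra.commute_of_mem_adjoin_singleton_of_commute hs (Algebra.commute_of_mem_adjoin_self hν).symm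
  set ν := LinearMap.toMatrixAlgEquiv' ν' with hνd
  set s := LinearMap.toMatrixAlgEquiv' s' with hsd
  have hn : IsNilpotent ν := hnil.map LinearMap.toMatrixAlgEquiv'
  have hc : Commute ν s := hc0.map LinearMap.toMatrixAlgEquiv'
  have hsum' : g.val = s + ν := by
    have := congrArg LinearMap.toMatrixAlgEquiv' hsum
    rw [map_add] at this
    rw [add_comm, ← this]
    exact (LinearMap.toMatrix'_toLin' _).symm
  have hu : IsUnit s := by
    have h1 : s = g.val + -ν := by rw [hsum']; abel
    rw [h1]
    refine hn.neg.isUnit_add_left_of_commute g.isUnit ?_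
    rw [hsum']
    exact (hc.add_right (Commute.refl ν)).neg_left
  obtain ⟨σ, hσ⟩ := hu
  refine ⟨ν, σ, hn, by rwa [hσ], by rwa [hσ], ?_, fun u hur => ?_⟩
  · rw [hσ]
    exact (congrArg Module.End.IsSemisimple (Matrix.toLin'_toMatrix' s')).mpr hss
  rw [root_iff, hσ] at hur
  rw [root_iff, hsum']
  obtain ⟨v, hv0, hv⟩ := hur
  obtain ⟨N, hN⟩ := hn
  have hex : ∃ t, ν ^ t *ᵥ v = 0 := ⟨N, by rw [hN, Matrix.zero_mulVec]⟩
  classical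
  obtain ⟨t, ht⟩ : ∃ t, Nat.find hex = t + 1 := Nat.exists_eq_succ_of_ne_zero fun h0 => by
    have := Nat.find_spec hex
    rw [h0, pow_zero, Matrix.one_mulVec] at this
    exact hv0 this
  have h1 := Nat.find_spec hex
  rw [ht] at h1
  refine ⟨ν ^ t *ᵥ v, Nat.find_min hex (by omega), ?_⟩
  rw [Matrix.add_mulVec, Matrix.mulVec_mulVec, Matrix.mulVec_mulVec, ← pow_succ', h1, add_zero, ← (hc.pow_left t).eq, ← Matrix.mulVec_mulVec, hv, Matrix.mulVec_smul]
def agr (ν : Mx n) : Subgroup (GN n × GN n) where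
  carrier := {p | Commute ν p.1.val ∧ Commute ν p.2.val ∧ ∀ i η, ν ^ (i + 1) *ᵥ η = 0 → (ν ^ i * p.1.val) *ᵥ η = (ν ^ i * p.2.val) *ᵥ η}
  one_mem' := ⟨Commute.one_right _, Commute.one_right _, fun _ _ _ => rfl⟩
  mul_mem' := by
    rintro ⟨x, y⟩ ⟨x', y'⟩ ⟨h1, h2, h3⟩ ⟨h1', h2', h3'⟩
    refine ⟨by simpa using h1.mul_right h1', by simpa using h2.mul_right h2', fun i η h => ?_⟩
    have e := h3' i η h
    have e' := h3 i (x'.val *ᵥ η) (by rw [Matrix.mulVec_mulVec, (h1'.pow_left _).eq, ← Matrix.mulVec_mulVec, h, Matrix.mulVec_zero])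
    simp only [Prod.mk_mul_mk, Units.val_mul]
    rw [← mul_assoc, ← Matrix.mulVec_mulVec, e', ← mul_assoc, (h2.pow_left i).eq, Matrix.mulVec_mulVec, mul_assoc, ← Matrix.mulVec_mulVec, e, Matrix.mulVec_mulVec, mul_assoc]
  inv_mem' := by
    rintro ⟨x, y⟩ ⟨h1, h2, h3⟩
    have h1i : Commute ν x⁻¹.val := h1.units_inv_right
    have h2i : Commute ν y⁻¹.val := h2.units_inv_right
    refine ⟨h1i, h2i, fun i η h => ?_⟩
    have e := h3 i (x⁻¹.val *ᵥ η) (by rw [Matrix.mulVec_mulVec, (h1i.pow_left _).eq, ← Matrix.mulVec_mulVec, h, Matrix.mulVec_zero])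
    have e2 := congrArg (fun w => y⁻¹.val *ᵥ w) e
    simp only [Matrix.mulVec_mulVec] at e2
    simp only [Prod.inv_mk]
    rw [(h2i.pow_left i).eq]
    rw [← mul_assoc, ← mul_assoc, mul_assoc _ _ x⁻¹.val, Units.mul_inv, mul_one, (h2.pow_left i).eq, mul_assoc y.val, Units.inv_mul_cancel_left] at e2
    exact e2.symm
lemma agr_jc {ν : Mx n} {s g : GN n} (hc : Commute ν s) (h : g.val = s + ν) (k : ℤ) : (g ^ k, s ^ k) ∈ agr ν := by
  have h0 : (g, s) ∈ agr ν := ⟨by simp only [h]; exact hc.add_right (Commute.refl ν), hc, fun i η hη => by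
    simp only [h]
    rw [mul_add, ← pow_succ, Matrix.add_mulVec, hη, add_zero]⟩
  exact Subgroup.zpow_mem _ h0 k
end
section
variable {n : ℕ} {J : Type} {U : Ultrafilter J} {Γ : Subgroup Qbˣ}
lemma MRep.ss (g : GN n) (hg : Module.End.IsSemisimple g.val.mulVecLin)
    (hr : ∀ u : Qbˣ, g.val.charpoly.IsRoot (u : Qb) → u ∈ Γ) (k : J → ℤ) : MRep U Γ fun j => (g ^ k j).val := by
  obtain ⟨P, d, h, hd⟩ := diagG g hg
  simp only [h, Units.val_mul]
  exact ((MRep.const _).mul (MRep.diag fun a => Rep.unit _ fun j => Subgroup.zpow_mem _ (hr _ ((hd _).2 ⟨a, rfl⟩)) _)).mul (MRep.const _)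
theorem coreG (hU : ∀ P : J → Prop, (∀ᶠ j in U.1, P j) → ∃ a b, a ≠ b ∧ P a ∧ P b) {m : J → ℤ} (hm : Function.Injective m)
    {F0 : Set Qbˣ} (hF0 : F0.Finite) (hΓ : Γ ≤ Subgroup.closure F0) (g p : GN n) (hg : Module.End.IsSemisimple g.val.mulVecLin)
    (lam : Qbˣ) (hlam : g.val.charpoly.IsRoot (lam : Qb)) (hbad : ∀ q : ℤ, q ≠ 0 → lam ^ q ∉ Γ)
    (hp : ∀ u : Qbˣ, p.val.charpoly.IsRoot (u : Qb) → u ∈ Γ)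
    (A B : J → GN n) (hA : MRep U Γ fun j => (A j)⁻¹.val) (hB : MRep U Γ fun j => (B j)⁻¹.val) (k : J → ℤ)
    (h : ∀ j, g ^ m j = A j * p ^ k j * B j) : False := by
  classical
  obtain ⟨P, d, hd, hdr⟩ := diagG g hg
  obtain ⟨l0, hl0⟩ := (hdr lam).1 hlam
  obtain ⟨ν, s, ⟨N, hN⟩, hc, hps, hs, hsr⟩ := jc p
  let bad : Fin n → Prop := fun l => ∀ q : ℤ, q ≠ 0 → d l ^ q ∉ Γ
  let E : J → Mx n → Mx n := fun j X => (A j)⁻¹.val * (P.val * X * P⁻¹.val) * (B j)⁻¹.val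
  have hE : ∀ X : J → Mx n, MRep U Γ X → MRep U Γ fun j => E j (X j) := fun X hX =>
    (hA.mul (((MRep.const _).mul hX).mul (MRep.const _))).mul hB
  let F : J → Mx n := fun j => E j (diagonal fun l => if bad l then 0 else ((d l ^ m j : Qbˣ) : Qb))
  have hF : MRep U Γ F := hE _ (MRep.diag fun a => by
    by_cases ha : bad a
    · simp only [ha, if_true]; exact Rep.const 0
    · simp only [ha, if_false]
      simp only [bad, not_forall, not_not] at ha
      obtain ⟨q, hq, hq'⟩ := ha
      exact Rep.good _ q hq hq' _)
  have hdet : ∀ j, (F j).det = 0 := fun j => by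
    have : bad l0 := by intro q hq; rw [hl0]; exact hbad q hq
    simp only [F, E, Matrix.det_mul, Matrix.det_diagonal]
    have hz : (∏ l, if bad l then 0 else ((d l ^ m j : Qbˣ) : Qb)) = 0 := Finset.prod_eq_zero (Finset.mem_univ l0) (if_pos this)
    rw [hz]
    simp
  let G : {l // bad l} → J → Mx n := fun l j => E j (diagonal (Pi.single l.1 1))
  have hG : ∀ l, MRep U Γ (G l) := fun l => hE _ (MRep.const _)
  have hsum : ∀ j, (p ^ k j).val = F j + ∑ l : {l // bad l}, ((d l.1 ^ m j : Qbˣ) : Qb) • G l j := fun j => by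
    have h1 : p ^ k j = (A j)⁻¹ * (P * Dg (d ^ m j) * P⁻¹) * (B j)⁻¹ := by rw [← hd, h j]; group
    have h2 : (p ^ k j).val = E j (diagonal fun l => ((d l ^ m j : Qbˣ) : Qb)) := by rw [h1]; rfl
    have h3 : (diagonal fun l => ((d l ^ m j : Qbˣ) : Qb)) = (diagonal fun l => if bad l then 0 else ((d l ^ m j : Qbˣ) : Qb)) +
        ∑ l : {l // bad l}, ((d l.1 ^ m j : Qbˣ) : Qb) • diagonal (Pi.single l.1 1) := by
      ext a b
      by_cases hab : a = b
      · subst hab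
        rw [Matrix.add_apply, Matrix.sum_apply]
        simp only [Matrix.diagonal_apply_eq, Matrix.smul_apply, smul_eq_mul]
        by_cases ha : bad a
        · rw [Finset.sum_eq_single ⟨a, ha⟩]
          · simp [ha]
          · intro l _ hl
            have : a ≠ l.1 := fun hc => hl (Subtype.ext hc.symm)
            simp [this]
          · simp
        · rw [Finset.sum_eq_zero]
          · simp [ha]
          · intro l _
            have : a ≠ l.1 := fun hc => ha (hc ▸ l.2)
            simp [this]
      · rw [Matrix.add_apply, Matrix.sum_apply]
        simp [hab]
    rw [h2, h3]
    simp only [E, F, G, Matrix.mul_add, Matrix.add_mul, Matrix.mul_sum, Matrix.sum_mul, Matrix.mul_smul, Matrix.smul_mul]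
  have hS : MRep U Γ fun j => (s ^ k j).val := MRep.ss s hs (fun u hu => hp u (hsr _ hu)) k
  have key : ∀ (i : ℕ) (η : Fin n → Qb), ν ^ (i + 1) *ᵥ η = 0 → ∀ᶠ j in U.1, (ν ^ i * (F j + (-1 : Mx n) * (s ^ k j).val)) *ᵥ η = 0 := by
    intro i η hη
    have hv : ∀ X : J → Mx n, MRep U Γ X → ∀ a, Rep U Γ fun j => ((ν ^ i * X j) *ᵥ η) a := fun X hX a =>
      show Rep U Γ fun j => ∑ b, (ν ^ i * X j) a b * η b from Rep.sum _ fun b _ => (((MRep.const _).mul hX) a b).mul (Rep.const _)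
    suffices hh : ∀ a, ∀ᶠ j in U.1, ((ν ^ i * (F j + (-1 : Mx n) * (s ^ k j).val)) *ᵥ η) a = 0 by
      filter_upwards [eventually_all.2 hh] with j hj
      exact funext hj
    intro a
    refine graded hU hm hF0 hΓ (fun l : {l // bad l} => d l.1) (fun l => l.2) (hv _ (hF.add ((MRep.const _).mul hS)) a) (fun l => hv _ (hG l) a) (Eventually.of_forall fun j => ?_)
    have h1 := congrFun ((agr_jc hc hps (k j)).2.2 i η hη) a
    simp only [hsum] at h1
    rw [← sub_eq_zero] at h1
    rw [← h1]
    simp only [Matrix.mul_add, Matrix.add_mulVec, Matrix.mul_sum, Matrix.sum_mulVec, Pi.add_apply, Finset.sum_apply, Matrix.mul_smul, Matrix.smul_mulVec, Pi.smul_apply, smul_eq_mul, Matrix.neg_mul, Matrix.one_mul, Matrix.mul_neg, Matrix.neg_mulVec, Pi.neg_apply]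
    ring
  have key2 : ∀ᶠ j in U.1, ∀ i : Fin N, ∀ η, ν ^ (i.1 + 1) *ᵥ η = 0 → (ν ^ i.1 * (F j + (-1 : Mx n) * (s ^ k j).val)) *ᵥ η = 0 := by
    refine eventually_all.2 fun i => ?_
    obtain ⟨S, hS⟩ := (IsNoetherian.noetherian (LinearMap.ker (ν ^ (i.1 + 1)).mulVecLin) : (LinearMap.ker (ν ^ (i.1 + 1)).mulVecLin).FG)
    have h1 : ∀ᶠ j in U.1, ∀ η ∈ S, (ν ^ i.1 * (F j + (-1 : Mx n) * (s ^ k j).val)) *ᵥ η = 0 :=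
      (Filter.eventually_all_finset S).2 fun η hη => key i.1 η (by
        have : η ∈ LinearMap.ker (ν ^ (i.1 + 1)).mulVecLin := hS ▸ Submodule.subset_span hη
        exact this)
    filter_upwards [h1] with j hj η hη
    have h2 : Submodule.span Qb (S : Set (Fin n → Qb)) ≤ LinearMap.ker (ν ^ i.1 * (F j + (-1 : Mx n) * (s ^ k j).val)).mulVecLin :=
      Submodule.span_le.2 fun η hη => hj η hη
    rw [hS] at h2
    exact h2 (show η ∈ LinearMap.ker (ν ^ (i.1 + 1)).mulVecLin from hη)
  obtain ⟨j, hj⟩ := key2.exists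
  obtain ⟨η, hη0, hη⟩ := Matrix.exists_mulVec_eq_zero_iff.2 (hdet j)
  have hex : ∃ t, ν ^ t *ᵥ η = 0 := ⟨N, by rw [hN, Matrix.zero_mulVec]⟩
  obtain ⟨t, ht⟩ : ∃ t, Nat.find hex = t + 1 := Nat.exists_eq_succ_of_ne_zero fun h0 => by
    have := Nat.find_spec hex
    rw [h0, pow_zero, Matrix.one_mulVec] at this
    exact hη0 this
  have h1 := Nat.find_spec hex
  rw [ht] at h1
  have htN : t < N := by
    have := Nat.find_min' hex (m := N) (by rw [hN, Matrix.zero_mulVec])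
    omega
  have h2 := hj ⟨t, htN⟩ η h1
  have hcs : Commute ν (s ^ k j).val := (agr_jc hc hps (k j)).2.1
  have h3 : (s ^ k j).val *ᵥ (ν ^ t *ᵥ η) = 0 := by
    rw [Matrix.mul_add, Matrix.add_mulVec, ← Matrix.mulVec_mulVec, hη, Matrix.mulVec_zero, zero_add] at h2
    simp only [Matrix.neg_mul, Matrix.one_mul, Matrix.mul_neg, Matrix.neg_mulVec, neg_eq_zero] at h2
    rw [Matrix.mulVec_mulVec, ← (hcs.pow_left t).eq, h2]
  have h4 := Matrix.mulVec_injective_of_isUnit (s ^ k j).isUnit (h3.trans (Matrix.mulVec_zero _).symm)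
  exact Nat.find_min hex (by omega) h4
end
section
variable {n r : ℕ} (γs : Fin r → GN n)
noncomputable def GG : Subgroup Qbˣ where
  carrier := {x | ∃ v : Fin r → Qbˣ, (∀ i, v i ∈ eigGroup (γs i)) ∧ x = ∏ i, v i}
  one_mem' := ⟨1, fun i => one_mem _, by simp⟩
  mul_mem' := by
    rintro _ _ ⟨v, hv, rfl⟩ ⟨w, hw, rfl⟩
    exact ⟨v * w, fun i => mul_mem (hv i) (hw i), by simp [Finset.prod_mul_distrib]⟩
  inv_mem' := by
    rintro _ ⟨v, hv, rfl⟩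
    exact ⟨v⁻¹, fun i => inv_mem (hv i), by simp⟩
lemma mem_GG (i : Fin r) (u : Qbˣ) (hu : (γs i).val.charpoly.IsRoot (u : Qb)) : u ∈ GG γs := by
  classical
  refine ⟨Pi.mulSingle i u, fun l => ?_, by simp⟩
  by_cases h : l = i
  · subst h
    rw [Pi.mulSingle_eq_same]
    exact Subgroup.subset_closure hu
  · rw [Pi.mulSingle_eq_of_ne h]; exact one_mem _
def FF : Set Qbˣ := ⋃ i, {u : Qbˣ | (γs i).val.charpoly.IsRoot (u : Qb)}
lemma FF_fin : (FF γs).Finite := Set.finite_iUnion fun i =>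
  Set.Finite.preimage Units.val_injective.injOn (Polynomial.finite_setOf_isRoot (Matrix.charpoly_monic _).ne_zero)
lemma GG_le : GG γs ≤ Subgroup.closure (FF γs) := by
  rintro _ ⟨v, hv, rfl⟩
  exact Subgroup.prod_mem _ fun i _ => Subgroup.closure_mono (fun u hu => Set.mem_iUnion.2 ⟨i, hu⟩) (hv i)
variable {J : Type} {U : Ultrafilter J}
lemma MRep.list (k : J → Fin r → ℤ) (L : List (Fin r)) (hL : ∀ i ∈ L, IsSemisimpleElt (γs i)) :
    MRep U (GG γs) fun j => ((L.map fun i => γs i ^ k j i).prod)⁻¹.val := by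
  induction L with
  | nil => simpa using MRep.const (U := U) (Γ := GG γs) 1
  | cons a L ih =>
    have h1 := MRep.ss (U := U) (γs a) (hL a (by simp)) (mem_GG γs a) fun j => - k j a
    have h2 := (ih fun i hi => hL i (by simp [hi])).mul h1
    simp only [List.map_cons, List.prod_cons, _root_.mul_inv_rev, Units.val_mul]
    simpa only [_root_.zpow_neg] using h2
lemma splitP (hss : ∀ i j : Fin r, ¬ IsSemisimpleElt (γs i) → ¬ IsSemisimpleElt (γs j) → i = j) (k : J → Fin r → ℤ) :
    ∃ (A B : J → GN n) (p : GN n) (kp : J → ℤ), (MRep U (GG γs) fun j => (A j)⁻¹.val) ∧ (MRep U (GG γs) fun j => (B j)⁻¹.val) ∧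
      (∀ u : Qbˣ, p.val.charpoly.IsRoot (u : Qb) → u ∈ GG γs) ∧ ∀ j, (List.ofFn fun i => γs i ^ k j i).prod = A j * p ^ kp j * B j := by
  have hl : ∀ j, (List.ofFn fun i => γs i ^ k j i) = (List.finRange r).map fun i => γs i ^ k j i := fun j => List.ofFn_eq_map
  by_cases h : ∀ i, IsSemisimpleElt (γs i)
  · refine ⟨fun j => ((List.finRange r).map fun i => γs i ^ k j i).prod, fun _ => 1, 1, fun _ => 0, MRep.list γs k _ fun i _ => h i, by simpa using MRep.const (U := U) (Γ := GG γs) 1, fun u hu => ?_, fun j => by rw [hl]; simp⟩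
    obtain ⟨v, hv, h1⟩ := (root_iff _ _).1 hu
    rw [Units.val_one, Matrix.one_mulVec] at h1
    have : u = 1 := by
      obtain ⟨l, hl⟩ := Function.ne_iff.1 hv
      have h2 := congrFun h1 l
      rw [Pi.smul_apply, smul_eq_mul] at h2
      exact Units.ext (mul_right_cancel₀ hl (by rw [← h2, Units.val_one, one_mul]))
    rw [this]; exact one_mem _
  · push Not at h
    obtain ⟨p, hp⟩ := h
    obtain ⟨s, t, hst⟩ := List.append_of_mem (List.mem_finRange p)
    have hnd := List.nodup_finRange r
    rw [hst, List.nodup_middle, List.nodup_cons, List.mem_append, not_or] at hnd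
    have hS : ∀ i, i ≠ p → IsSemisimpleElt (γs i) := fun i hi => by_contra fun hc => hi (hss i p hc hp)
    refine ⟨fun j => (s.map fun i => γs i ^ k j i).prod, fun j => (t.map fun i => γs i ^ k j i).prod, γs p, fun j => k j p,
      MRep.list γs k _ fun i hi => hS i fun hc => hnd.1.1 (hc ▸ hi), MRep.list γs k _ fun i hi => hS i fun hc => hnd.1.2 (hc ▸ hi), mem_GG γs p, fun j => ?_⟩
    rw [hl, hst]
    simp [mul_assoc]
end
end RM
/-- Key matrix statement: if `γ₁,…,γ_r ∈ GL_n(ℚ̄)` are all semi-simple with at most one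
exception and `γ` is semi-simple with an eigenvalue `λ` that is not a root of unity and
satisfies `⟨λ⟩ ∩ Λ(γ₁)⋯Λ(γ_r) = {1}`, then `⟨γ⟩ ∩ ⟨γ₁⟩⋯⟨γ_r⟩` is finite; in particular the
set of exponents `m` with `γ^m ∈ ⟨γ₁⟩⋯⟨γ_r⟩` is finite and `⟨γ⟩ ⊄ ⟨γ₁⟩⋯⟨γ_r⟩`. -/
theorem stmt_9 {n : ℕ} (hn : 1 ≤ n) (r : ℕ) (γs : Fin r → GL (Fin n) (AlgebraicClosure ℚ))
    (hss : ∀ i j : Fin r, ¬ IsSemisimpleElt (γs i) → ¬ IsSemisimpleElt (γs j) → i = j)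
    (γ : GL (Fin n) (AlgebraicClosure ℚ)) (hγ : IsSemisimpleElt γ)
    (lam : (AlgebraicClosure ℚ)ˣ)
    (heig : ((γ : Matrix (Fin n) (Fin n) (AlgebraicClosure ℚ)).charpoly).IsRoot
      (lam : AlgebraicClosure ℚ))
    (hru : ∀ k : ℤ, k ≠ 0 → lam ^ k ≠ 1)
    (hint : ∀ x : (AlgebraicClosure ℚ)ˣ, x ∈ Subgroup.zpowers lam →
      (∃ v : Fin r → (AlgebraicClosure ℚ)ˣ,
        (∀ i, v i ∈ eigGroup (γs i)) ∧ x = ∏ i, v i) → x = 1) :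
    Set.Finite {x : GL (Fin n) (AlgebraicClosure ℚ) |
        x ∈ Subgroup.zpowers γ ∧
        ∃ k : Fin r → ℤ, x = (List.ofFn fun i => γs i ^ k i).prod} ∧
    Set.Finite {m : ℤ | ∃ k : Fin r → ℤ, γ ^ m = (List.ofFn fun i => γs i ^ k i).prod} ∧
    ¬ ((Subgroup.zpowers γ : Set (GL (Fin n) (AlgebraicClosure ℚ))) ⊆
        {x | ∃ k : Fin r → ℤ, x = (List.ofFn fun i => γs i ^ k i).prod}) := by
  classical
  set Γ : Subgroup RM.Qbˣ := RM.GG γs with hΓ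
  have hbad : ∀ q : ℤ, q ≠ 0 → lam ^ q ∉ Γ := fun q hq hc => hru q hq (hint _ ⟨q, rfl⟩ hc)
  have hM : Set.Finite {m : ℤ | ∃ k : Fin r → ℤ, γ ^ m = (List.ofFn fun i => γs i ^ k i).prod} := by
    by_contra hinf
    have := Set.Infinite.to_subtype hinf
    let e := Infinite.natEmbedding {m : ℤ | ∃ k : Fin r → ℤ, γ ^ m = (List.ofFn fun i => γs i ^ k i).prod}
    choose k hk using fun j => (e j).2
    have hm : Function.Injective fun j => ((e j : ℤ)) := fun a b h => e.injective (Subtype.ext h)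
    obtain ⟨A, B, p, kp, hA, hB, hp, h⟩ := RM.splitP (U := Filter.hyperfilter ℕ) γs hss k
    refine RM.coreG (U := Filter.hyperfilter ℕ) (fun P hP => ?_) hm (RM.FF_fin γs) (RM.GG_le γs) γ p hγ lam heig hbad hp A B hA hB kp fun j => ?_
    · have h1 : ¬ {a | P a}.Finite := fun hf => (Filter.notMem_hyperfilter_of_finite hf) hP
      obtain ⟨a, ha, b, hb, hab⟩ := Set.Infinite.nontrivial h1
      exact ⟨a, b, hab, ha, hb⟩
    · rw [hk j, h j]
  refine ⟨(hM.image fun m => γ ^ m).subset ?_, hM, fun hc => ?_⟩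
  · rintro _ ⟨⟨m, rfl⟩, k, hk⟩
    exact ⟨m, ⟨k, hk⟩, rfl⟩
  · refine Set.infinite_univ (hM.subset fun m _ => ?_)
    exact hc ⟨m, rfl⟩
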